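/- arXiv:math/0703549 — 2 statements merged into one kernel-verified Lean document; each statement's English description precedes it below -/
import Mathlib

section
/- Let g ≥ 2 and n = 2g+2. Then the number of GL₂(𝔽_q)-orbits of rational n-sets S of P¹ with the property that there exists γ ∈ GL₂(𝔽_q) with γ(S) = S and J(γ,S) not a square in 𝔽_q* — which equals the number sd(g) of k-isomorphism classes of self-dual hyperelliptic curves of genus g over 𝔽_q — is sd(g) = Σ_{m | 2g+2, m > 1} φ(m)·[A₀((2g+2)/m)]_{m | q+1 and (2g+2)/m odd} + Σ_{m | 2g, m > 1} φ(m)·( [A₀(2g/m)]_{m | q+1 and 2g/m ≢ (q+1)/m (mod 2)} + [A₂(2g/m)]_{m | q−1 and (q−1)/m odd} ). -/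
noncomputable section

open Polynomial

namespace Hyp

attribute [local instance] Classical.propDecidable Classical.decEq

variable (F : Type) [Field F] [Fintype F]

/-- The embedding of `F` into its algebraic closure. -/
def em : F →+* AlgebraicClosure F := algebraMap F (AlgebraicClosure F)

/-- The Frobenius `t ↦ t^q` acting on `P¹(k̄) = k̄ ∪ {∞}`, where `∞ = none`. -/
def frobP1 : Option (AlgebraicClosure F) → Option (AlgebraicClosure F) :=
  Option.map fun x => x ^ Fintype.card F

variable {F}

/-- The Möbius action of a `2×2` matrix `(a b; c d)` over `F` on `P¹(k̄) = k̄ ∪ {∞}`: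
`t ↦ (at+b)/(ct+d)`, with the usual conventions at `∞` and at poles. -/
def moebius (γ : Matrix (Fin 2) (Fin 2) F) :
    Option (AlgebraicClosure F) → Option (AlgebraicClosure F)
  | none =>
      if γ 1 0 = 0 then none else some (em F (γ 0 0) / em F (γ 1 0))
  | some x =>
      if em F (γ 1 0) * x + em F (γ 1 1) = 0 then none
      else some ((em F (γ 0 0) * x + em F (γ 0 1)) / (em F (γ 1 0) * x + em F (γ 1 1)))

/-- The local multiplier `j(γ,t)`. -/
def locMult (γ : Matrix (Fin 2) (Fin 2) F) :
    Option (AlgebraicClosure F) → AlgebraicClosure F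
  | none => if γ 1 0 = 0 then em F (γ 1 1) else em F (-γ.det / γ 1 0)
  | some x =>
      if em F (γ 1 0) * x + em F (γ 1 1) = 0 then em F (γ 1 0)
      else em F γ.det / (em F (γ 1 0) * x + em F (γ 1 1))

/-- The global multiplier `J(γ,S) = ∏_{t ∈ S} j(γ,t)`. -/
def Jmult (γ : Matrix (Fin 2) (Fin 2) F) (S : Finset (Option (AlgebraicClosure F))) :
    AlgebraicClosure F :=
  ∏ t ∈ S, locMult γ t

/-- `S` is a rational `n`-set of `P¹`: it has `n` elements and is Frobenius-stable. -/
def IsRatSet (n : ℕ) (S : Finset (Option (AlgebraicClosure F))) : Prop :=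
  S.card = n ∧ S.image (frobP1 F) = S

/-- `m` is the order of `γ` in `PGL₂(F)`: the least positive integer such that `γ^m`
is a scalar matrix. -/
def IsPGLOrder (γ : Matrix (Fin 2) (Fin 2) F) (m : ℕ) : Prop :=
  IsLeast {n : ℕ | 0 < n ∧ ∃ lam : F, γ ^ n = lam • (1 : Matrix (Fin 2) (Fin 2) F)} m

/-- `J(γ,S)` is a square in `F*`. -/
def IsSquareJ (γ : Matrix (Fin 2) (Fin 2) F) (S : Finset (Option (AlgebraicClosure F))) : Prop :=
  ∃ v : F, v ≠ 0 ∧ Jmult γ S = em F (v * v)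

/-- The monic polynomial `f_S(x) = ∏_{t ∈ S, t ≠ ∞} (x - t)` attached to a finite subset
of `P¹(k̄)`. -/
def fpoly (S : Finset (Option (AlgebraicClosure F))) : Polynomial (AlgebraicClosure F) :=
  ∏ t ∈ S, t.elim 1 fun a => X - C a

/-- `t` belongs to `P¹(F) = F ∪ {∞}` inside `P¹(k̄)`. -/
def inP1k (t : Option (AlgebraicClosure F)) : Prop :=
  t = none ∨ ∃ x : F, t = some (em F x)

/-- `t` belongs to `P¹(𝔽_{q²})` inside `P¹(k̄)`. -/
def inP1k2 [Fintype F] (t : Option (AlgebraicClosure F)) : Prop :=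
  t = none ∨ ∃ x : AlgebraicClosure F, x ^ Fintype.card F ^ 2 = x ∧ t = some x

/-- `A₂(n) = (qⁿ - (-1)ⁿ)/(q+1)`. -/
def A2 (q n : ℕ) : ℚ := ((q : ℚ) ^ n - (-1) ^ n) / ((q : ℚ) + 1)

/-- `A₀(n) = (q^{n+1} - qⁿ - (-1)^{⌈n/2⌉} q + (-1)^{⌈(n-1)/2⌉})/(q²+1)`. -/
def A0 (q n : ℕ) : ℚ :=
  ((q : ℚ) ^ (n + 1) - (q : ℚ) ^ n - (-1) ^ ((n + 1) / 2) * (q : ℚ) + (-1) ^ (n / 2)) /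
    ((q : ℚ) ^ 2 + 1)

/-- The `GL₂(F)`-orbit of a finite subset of `P¹(k̄)` under the Möbius action. -/
def orbitSet {F : Type} [Field F] [Fintype F]
    (S : Finset (Option (AlgebraicClosure F))) :
    Set (Finset (Option (AlgebraicClosure F))) :=
  {T | ∃ γ : GL (Fin 2) F, T = S.image (moebius γ.val)}

section StableSets

variable {X : Type*} [DecidableEq X]

/-- The `n`-element subsets stable under a self-map. -/
def stableSets (f : X → X) (n : ℕ) : Set (Finset X) := {S | S.card = n ∧ S.image f = S}

theorem image_eq_self_iff {f : X → X} (hf : f.Injective) (S : Finset X) :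
    S.image f = S ↔ ∀ x ∈ S, f x ∈ S := by
  constructor
  · intro h x hx
    rw [← h]
    exact Finset.mem_image_of_mem f hx
  · intro h
    apply Finset.eq_of_subset_of_card_le
    · intro y hy
      obtain ⟨x, hx, rfl⟩ := Finset.mem_image.1 hy
      exact h x hx
    · rw [Finset.card_image_of_injective S hf]

theorem mem_of_image_eq_self {f : X → X} (hf : f.Injective) {S : Finset X}
    (h : S.image f = S) {x : X} : f x ∈ S ↔ x ∈ S := by
  constructor
  · intro hx
    rw [← h] at hx
    obtain ⟨y, hy, e⟩ := Finset.mem_image.1 hx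
    exact hf e ▸ hy
  · exact (image_eq_self_iff hf S).1 h x

theorem iterate_mem_of_image_eq_self {f : X → X} {S : Finset X}
    (h : S.image f = S) {x : X} (hx : x ∈ S) (i : ℕ) : f^[i] x ∈ S := by
  induction i with
  | zero => exact hx
  | succ i ih =>
    rw [Function.iterate_succ_apply', ← h]
    exact Finset.mem_image_of_mem f ih

/-- The forward orbit of a periodic point, as a finset. -/
def orbitFinset (f : X → X) (x : X) : Finset X :=
  (Finset.range (Function.minimalPeriod f x)).image fun i => f^[i] x

theorem card_orbitFinset (f : X → X) (x : X) :
    (orbitFinset f x).card = Function.minimalPeriod f x := by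
  unfold orbitFinset
  rw [Finset.card_image_of_injOn, Finset.card_range]
  intro i hi j hj h
  exact Function.iterate_injOn_Iio_minimalPeriod (by simpa using hi) (by simpa using hj) h

theorem mem_orbitFinset_self {f : X → X} {x : X} (hx : 0 < Function.minimalPeriod f x) :
    x ∈ orbitFinset f x :=
  Finset.mem_image.2 ⟨0, by simpa using hx, rfl⟩

theorem iterate_mem_orbitFinset {f : X → X} {x : X} (hx : 0 < Function.minimalPeriod f x)
    (i : ℕ) : f^[i] x ∈ orbitFinset f x :=
  Finset.mem_image.2 ⟨i % Function.minimalPeriod f x, by simpa using Nat.mod_lt _ hx,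
    Function.iterate_mod_minimalPeriod_eq⟩

theorem orbitFinset_subset {f : X → X} {S : Finset X} (h : S.image f = S) {x : X}
    (hx : x ∈ S) : orbitFinset f x ⊆ S := by
  intro y hy
  obtain ⟨i, -, rfl⟩ := Finset.mem_image.1 hy
  exact iterate_mem_of_image_eq_self h hx i

theorem image_orbitFinset {f : X → X} (hf : f.Injective) {x : X}
    (hx : 0 < Function.minimalPeriod f x) : (orbitFinset f x).image f = orbitFinset f x := by
  rw [image_eq_self_iff hf]
  intro y hy
  obtain ⟨i, -, rfl⟩ := Finset.mem_image.1 hy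
  rw [← Function.iterate_succ_apply' f]
  exact iterate_mem_orbitFinset hx _

theorem disjoint_orbitFinset {f : X → X} (hf : f.Injective) {S : Finset X}
    (h : S.image f = S) {x : X} (hx : x ∉ S) : Disjoint S (orbitFinset f x) := by
  rw [Finset.disjoint_left]
  intro y hy hy'
  obtain ⟨i, -, rfl⟩ := Finset.mem_image.1 hy'
  apply hx
  clear hy'
  induction i with
  | zero => exact hy
  | succ i ih =>
    rw [Function.iterate_succ_apply', mem_of_image_eq_self hf h] at hy
    exact ih hy

theorem minimalPeriod_pos_of_mem {f : X → X} (hf : f.Injective) {S : Finset X}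
    (h : S.image f = S) {x : X} (hx : x ∈ S) :
    0 < Function.minimalPeriod f x ∧ Function.minimalPeriod f x ≤ S.card := by
  have hpos : 0 < Function.minimalPeriod f x := by
    by_contra h0
    have h0' : Function.minimalPeriod f x = 0 := by omega
    have hinj : Function.Injective fun i : ℕ => (⟨f^[i] x, iterate_mem_of_image_eq_self h hx i⟩ : S) := by
      intro i j hij
      have hij' : f^[i] x = f^[j] x := by simpa using hij
      by_contra hne
      rcases Nat.lt_or_gt_of_ne hne with hlt | hlt
      · obtain ⟨k, rfl⟩ := Nat.exists_eq_add_of_lt hlt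
        rw [show i + k + 1 = i + (k + 1) by ring, Function.iterate_add_apply] at hij'
        have := (hf.iterate i hij').symm
        exact absurd (Function.IsPeriodicPt.minimalPeriod_pos (Nat.succ_pos k) this) h0
      · obtain ⟨k, rfl⟩ := Nat.exists_eq_add_of_lt hlt
        rw [show j + k + 1 = j + (k + 1) by ring, Function.iterate_add_apply] at hij'
        have := hf.iterate j hij'
        exact absurd (Function.IsPeriodicPt.minimalPeriod_pos (Nat.succ_pos k) this) h0
    exact not_injective_infinite_finite _ hinj
  refine ⟨hpos, ?_⟩
  rw [← card_orbitFinset]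
  exact Finset.card_le_card (orbitFinset_subset h hx)

theorem finite_stableSets {f : X → X} (hf : f.Injective)
    (hfin : ∀ i, 0 < i → {x | f^[i] x = x}.Finite) (n : ℕ) : (stableSets f n).Finite := by
  have hU : (⋃ i ∈ Finset.Icc 1 n, {x | f^[i] x = x}).Finite :=
    Set.Finite.biUnion (Finset.finite_toSet _) fun i hi => hfin i (by simp at hi; omega)
  apply (hU.finite_subsets.preimage (Finset.coe_injective.injOn)).subset
  rintro S ⟨hc, hS⟩
  intro x hx
  have hp := minimalPeriod_pos_of_mem hf hS hx
  simp only [Set.mem_iUnion]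
  exact ⟨Function.minimalPeriod f x, by simp; omega, Function.iterate_minimalPeriod⟩

/-- The weight with which a point of period dividing `i` enters the recurrence. -/
def periodWeight (f : X → X) (x : X) (i : ℕ) : ℤ :=
  (if f^[i] x = x then 1 else 0) - 2 * (if 2 ∣ i ∧ f^[i / 2] x = x then 1 else 0)

theorem periodWeight_eq (f : X → X) (x : X) (i : ℕ) :
    periodWeight f x i = (if Function.minimalPeriod f x ∣ i then 1 else 0)
      - 2 * (if 2 * Function.minimalPeriod f x ∣ i then 1 else 0) := by
  have h1 : ∀ j, f^[j] x = x ↔ Function.minimalPeriod f x ∣ j := fun j =>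
    Function.isPeriodicPt_iff_minimalPeriod_dvd
  have h2 : (2 ∣ i ∧ f^[i / 2] x = x) ↔ 2 * Function.minimalPeriod f x ∣ i := by
    rw [h1]
    constructor
    · rintro ⟨⟨k, rfl⟩, h⟩
      rw [Nat.mul_div_cancel_left _ two_pos] at h
      exact Nat.mul_dvd_mul_left 2 h
    · rintro ⟨k, rfl⟩
      refine ⟨⟨_, mul_assoc 2 _ k⟩, ?_⟩
      rw [mul_assoc, Nat.mul_div_cancel_left _ two_pos]
      exact dvd_mul_right _ _
  simp only [periodWeight, h1 i, h2]

theorem periodWeight_add (f : X → X) (x : X) (hx : 0 < Function.minimalPeriod f x) (i : ℕ) :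
    periodWeight f x (i + Function.minimalPeriod f x) = - periodWeight f x i := by
  rw [periodWeight_eq, periodWeight_eq]
  set d := Function.minimalPeriod f x
  have h1 : d ∣ i + d ↔ d ∣ i := (Nat.dvd_add_iff_left dvd_rfl).symm
  by_cases h : d ∣ i
  · obtain ⟨k, rfl⟩ := h
    have e1 : 2 * d ∣ d * k + d ↔ 2 ∣ k + 1 := by
      rw [show d * k + d = d * (k + 1) by ring, mul_comm 2 d, Nat.mul_dvd_mul_iff_left hx]
    have e2 : 2 * d ∣ d * k ↔ 2 ∣ k := by
      rw [mul_comm 2 d, Nat.mul_dvd_mul_iff_left hx]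
    simp only [h1, e1, e2, dvd_mul_right, if_true]
    by_cases hk : 2 ∣ k
    · rw [if_neg (by omega), if_pos hk]; norm_num
    · rw [if_pos (by omega), if_neg hk]; norm_num
  · have e1 : ¬ 2 * d ∣ i + d := fun h' => h (h1.1 ((dvd_mul_left d 2).trans h'))
    have e2 : ¬ 2 * d ∣ i := fun h' => h ((dvd_mul_left d 2).trans h')
    simp [h1, h, e1, e2]

theorem ncard_stableSets_mem {f : X → X} (hf : f.Injective)
    (hfin : ∀ i, 0 < i → {x | f^[i] x = x}.Finite) {x : X}
    (hx : 0 < Function.minimalPeriod f x) (n : ℕ) :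
    (({S | S ∈ stableSets f n ∧ x ∈ S}.ncard : ℕ) : ℤ) =
      ∑ i ∈ Finset.range n, periodWeight f x (i + 1) * ((stableSets f (n - 1 - i)).ncard : ℤ) := by
  induction n using Nat.strong_induction_on with
  | _ n ih =>
  set d := Function.minimalPeriod f x with hd
  have hw : ∀ i, i + 1 < d → periodWeight f x (i + 1) = 0 := by
    intro i hi
    rw [periodWeight_eq, ← hd, if_neg (Nat.not_dvd_of_pos_of_lt (by omega) hi),
      if_neg (Nat.not_dvd_of_pos_of_lt (by omega) (by omega))]
    norm_num
  by_cases hn : n < d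
  · rw [Finset.sum_eq_zero]
    · have : {S | S ∈ stableSets f n ∧ x ∈ S} = ∅ := by
        ext S
        simp only [Set.mem_ofPred_eq, Set.mem_empty_iff_false, iff_false]
        rintro ⟨⟨hc, hS⟩, hxS⟩
        have := (minimalPeriod_pos_of_mem hf hS hxS).2
        omega
      rw [this]; simp
    · intro i hi
      rw [hw i (by simp at hi; omega), zero_mul]
  · push Not at hn
    obtain ⟨k, rfl⟩ := Nat.exists_eq_add_of_le' hn
    have hbij : {S | S ∈ stableSets f (k + d) ∧ x ∈ S}.ncard =
        {S | S ∈ stableSets f k ∧ x ∉ S}.ncard := by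
      apply Set.ncard_congr (fun S _ => S \ orbitFinset f x)
      · rintro S ⟨⟨hc, hS⟩, hxS⟩
        refine ⟨⟨?_, ?_⟩, ?_⟩
        · rw [Finset.card_sdiff_of_subset (orbitFinset_subset hS hxS), card_orbitFinset, hc]
          omega
        · rw [Finset.image_sdiff _ _ hf, hS, image_orbitFinset hf hx]
        · simp [mem_orbitFinset_self hx]
      · rintro S T ⟨⟨-, hS⟩, hxS⟩ ⟨⟨-, hT⟩, hxT⟩ h
        rw [← Finset.sdiff_union_of_subset (orbitFinset_subset hS hxS), h,
          Finset.sdiff_union_of_subset (orbitFinset_subset hT hxT)]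
      · rintro S ⟨⟨hc, hS⟩, hxS⟩
        have hdis := disjoint_orbitFinset hf hS hxS
        refine ⟨S ∪ orbitFinset f x, ⟨⟨?_, ?_⟩, ?_⟩, ?_⟩
        · rw [Finset.card_union_of_disjoint hdis, card_orbitFinset, hc]
        · rw [Finset.image_union, hS, image_orbitFinset hf hx]
        · exact Finset.mem_union_right _ (mem_orbitFinset_self hx)
        · rw [Finset.union_sdiff_right, hdis.sdiff_eq_left]
    have hsplit : (stableSets f k).ncard =
        {S | S ∈ stableSets f k ∧ x ∈ S}.ncard + {S | S ∈ stableSets f k ∧ x ∉ S}.ncard := by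
      rw [← Set.ncard_union_eq ?_ ((finite_stableSets hf hfin k).subset fun S h => h.1)
        ((finite_stableSets hf hfin k).subset fun S h => h.1)]
      · congr 1
        ext S
        simp only [Set.mem_union, Set.mem_ofPred_eq]
        tauto
      · rw [Set.disjoint_left]
        rintro S ⟨-, h⟩ ⟨-, h'⟩
        exact h' h
    have hk := ih k (by omega)
    rw [hbij]
    have hsum : ∑ i ∈ Finset.range (k + d),
        periodWeight f x (i + 1) * ((stableSets f (k + d - 1 - i)).ncard : ℤ)
        = ((stableSets f k).ncard : ℤ) - ∑ i ∈ Finset.range k,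
          periodWeight f x (i + 1) * ((stableSets f (k - 1 - i)).ncard : ℤ) := by
      obtain ⟨e, he⟩ : ∃ e, d = e + 1 := ⟨d - 1, by omega⟩
      rw [add_comm k d, Finset.sum_range_add, he, Finset.sum_range_succ, Finset.sum_eq_zero,
        zero_add, ← he]
      · have h1 : periodWeight f x d = 1 := by
          rw [periodWeight_eq, ← hd, if_pos dvd_rfl,
            if_neg (Nat.not_dvd_of_pos_of_lt (by omega) (by omega))]
          norm_num
        rw [h1, one_mul, sub_eq_add_neg, ← Finset.sum_neg_distrib]
        congr 1
        · congr 3; omega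
        · apply Finset.sum_congr rfl
          intro i _
          rw [show d + i + 1 = i + 1 + d by ring, hd, periodWeight_add f x hx, ← hd,
            show d + k - 1 - (d + i) = k - 1 - i by omega]
          ring
      · intro i hi
        rw [hw i (by simp at hi; omega), zero_mul]
    rw [hsum, ← hk]
    have : ((stableSets f k).ncard : ℤ) = ({S | S ∈ stableSets f k ∧ x ∈ S}.ncard : ℤ)
      + ({S | S ∈ stableSets f k ∧ x ∉ S}.ncard : ℤ) := by exact_mod_cast hsplit
    linarith

theorem card_mul_ncard_stableSets {f : X → X} (hf : f.Injective)
    (hfin : ∀ i, 0 < i → {x | f^[i] x = x}.Finite) (n : ℕ) :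
    (n : ℤ) * ((stableSets f n).ncard : ℤ) =
      ∑ i ∈ Finset.range n, (({x | f^[i + 1] x = x}.ncard : ℤ)
        - 2 * (if 2 ∣ i + 1 then ({x | f^[(i + 1) / 2] x = x}.ncard : ℤ) else 0))
          * ((stableSets f (n - 1 - i)).ncard : ℤ) := by
  have hU : (⋃ i ∈ Finset.Icc 1 n, {x | f^[i] x = x}).Finite :=
    Set.Finite.biUnion (Finset.finite_toSet _) fun i hi => hfin i (by simp at hi; omega)
  set U := hU.toFinset with hUdef
  have hUmem : ∀ i, 1 ≤ i → i ≤ n → ∀ x, f^[i] x = x → x ∈ U := by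
    intro i h1 h2 x hx
    rw [hUdef, Set.Finite.mem_toFinset]
    simp only [Set.mem_iUnion]
    exact ⟨i, by simp; omega, hx⟩
  have hUpos : ∀ x ∈ U, 0 < Function.minimalPeriod f x := by
    intro x hx
    rw [hUdef, Set.Finite.mem_toFinset] at hx
    simp only [Set.mem_iUnion] at hx
    obtain ⟨i, hi, h⟩ := hx
    exact Function.IsPeriodicPt.minimalPeriod_pos (by simp at hi; omega) h
  have hWfin := finite_stableSets hf hfin n
  set W := hWfin.toFinset with hWdef
  have hWmem : ∀ S, S ∈ W ↔ S ∈ stableSets f n := fun S => Set.Finite.mem_toFinset _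
  have hcount : n * W.card = ∑ x ∈ U, (W.filter fun S => x ∈ S).card := by
    have := Finset.sum_card_bipartiteAbove_eq_sum_card_bipartiteBelow
      (s := U) (t := W) (fun x S => x ∈ S)
    refine Eq.trans ?_ this.symm
    rw [mul_comm, Finset.sum_const_nat]
    intro S hS
    have hS' := (hWmem S).1 hS
    rw [← hS'.1]
    congr 1
    ext x
    simp only [Finset.mem_bipartiteBelow]
    constructor
    · exact fun h => h.2
    · intro hx
      have hp := minimalPeriod_pos_of_mem hf hS'.2 hx
      exact ⟨hUmem _ hp.1 (hS'.1 ▸ hp.2) x Function.iterate_minimalPeriod, hx⟩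
  have hfix : ∀ i, 1 ≤ i → i ≤ n →
      ({x | f^[i] x = x}.ncard : ℤ) = ∑ x ∈ U, if f^[i] x = x then 1 else 0 := by
    intro i h1 h2
    rw [Finset.sum_boole, ← Set.ncard_coe_finset]
    congr 2
    ext x
    simp only [Set.mem_ofPred_eq, Finset.coe_filter]
    exact ⟨fun h => ⟨hUmem i h1 h2 x h, h⟩, fun h => h.2⟩
  have hW : (stableSets f n).ncard = W.card := Set.ncard_eq_toFinset_card _ hWfin
  rw [hW]
  have : (n : ℤ) * (W.card : ℤ) = ∑ x ∈ U, ((W.filter fun S => x ∈ S).card : ℤ) := by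
    exact_mod_cast hcount
  rw [this]
  have h2 : ∀ x ∈ U, ((W.filter fun S => x ∈ S).card : ℤ) = ∑ i ∈ Finset.range n,
      periodWeight f x (i + 1) * ((stableSets f (n - 1 - i)).ncard : ℤ) := by
    intro x hx
    rw [← ncard_stableSets_mem hf hfin (hUpos x hx), ← Set.ncard_coe_finset]
    congr 2
    ext S
    simp [hWmem]
  rw [Finset.sum_congr rfl h2, Finset.sum_comm]
  apply Finset.sum_congr rfl
  intro i hi
  have hi' : i + 1 ≤ n := by simpa using hi
  rw [← Finset.sum_mul]
  congr 1
  simp only [periodWeight]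
  rw [Finset.sum_sub_distrib, ← hfix (i + 1) (by omega) hi', ← Finset.mul_sum]
  congr 2
  by_cases h : 2 ∣ i + 1
  · rw [if_pos h, hfix _ (by omega) (by omega)]
    simp only [h, true_and]
  · simp [h]

end StableSets

section Recurrence

theorem powerSeries_eq_of_derivative_mul {A Y : PowerSeries ℚ} (hA : PowerSeries.constantCoeff A = 1)
    (hY : PowerSeries.constantCoeff Y = 1)
    (h : PowerSeries.derivative ℚ Y * A = Y * PowerSeries.derivative ℚ A) : Y = A := by
  have hinv : A * A⁻¹ = 1 := PowerSeries.mul_inv_cancel A (by simp [hA])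
  have hd : PowerSeries.derivative ℚ A * A⁻¹ + A * PowerSeries.derivative ℚ A⁻¹ = 0 := by
    have := congrArg (PowerSeries.derivative ℚ) hinv
    rw [Derivation.leibniz] at this
    simp only [smul_eq_mul, Derivation.map_one_eq_zero] at this
    linear_combination this
  have hZ : PowerSeries.derivative ℚ (Y * A⁻¹) = 0 := by
    have h0 : A * (A * PowerSeries.derivative ℚ (Y * A⁻¹)) = 0 := by
      rw [Derivation.leibniz]
      simp only [smul_eq_mul]
      linear_combination (A * Y) * hd + A * A⁻¹ * h
    have hA0 : A ≠ 0 := by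
      rintro rfl
      simp at hA
    simpa [hA0] using h0
  have h1 : Y * A⁻¹ = 1 := by
    apply PowerSeries.derivative.ext
    · rw [hZ, Derivation.map_one_eq_zero]
    · simp [hA, hY]
  calc Y = Y * A⁻¹ * A := by rw [mul_assoc, mul_comm A⁻¹, hinv, mul_one]
    _ = A := by rw [h1, one_mul]

theorem mk_pow_mul (a : ℚ) : (PowerSeries.mk fun i => a ^ i) * (1 - PowerSeries.C a * PowerSeries.X) = 1 := by
  ext n
  rcases n with _ | n
  · simp
  · rw [mul_sub, mul_one, mul_left_comm, ← mul_assoc, map_sub, mul_assoc, PowerSeries.coeff_C_mul,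
      PowerSeries.coeff_succ_mul_X]
    simp [pow_succ, PowerSeries.coeff_one]
    ring

theorem mk_even_pow_mul (a : ℚ) :
    (PowerSeries.mk fun i => if 2 ∣ i + 1 then a ^ ((i + 1) / 2) else 0) * (1 - PowerSeries.C a * PowerSeries.X ^ 2)
      = PowerSeries.C a * PowerSeries.X := by
  ext n
  have e : (PowerSeries.mk fun i => if 2 ∣ i + 1 then a ^ ((i + 1) / 2) else 0)
      * (1 - PowerSeries.C a * PowerSeries.X ^ 2) = (PowerSeries.mk fun i => if 2 ∣ i + 1 then a ^ ((i + 1) / 2) else 0)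
      - PowerSeries.C a * ((PowerSeries.mk fun i => if 2 ∣ i + 1 then a ^ ((i + 1) / 2) else 0) * PowerSeries.X ^ 2) := by
    ring
  rw [e, map_sub, PowerSeries.coeff_C_mul, PowerSeries.coeff_C_mul, PowerSeries.coeff_mul_X_pow', PowerSeries.coeff_mk, PowerSeries.coeff_X]
  rcases n with _ | _ | n
  · norm_num
  · norm_num
  · simp only [show 2 ≤ n + 1 + 1 by omega, if_true, show n + 1 + 1 - 2 = n by omega, PowerSeries.coeff_mk,
      show ¬ n + 1 + 1 = 1 by omega, if_false]
    have : 2 ∣ n + 1 + 1 + 1 ↔ 2 ∣ n + 1 := by omega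
    simp only [this]
    by_cases h : 2 ∣ n + 1
    · rw [if_pos h, if_pos h, show (n + 1 + 1 + 1) / 2 = (n + 1) / 2 + 1 by omega]
      ring
    · rw [if_neg h, if_neg h]
      ring

theorem generating_function_stable {q e : ℚ} {s : ℕ → ℚ} (h0 : s 0 = 1)
    (hs : ∀ n : ℕ, (n : ℚ) * s n = ∑ i ∈ Finset.range n, (q ^ (i + 1) - e ^ (i + 1)
      - 2 * (if 2 ∣ i + 1 then q ^ ((i + 1) / 2) - e ^ ((i + 1) / 2) else 0)) * s (n - 1 - i)) :
    PowerSeries.mk s * ((1 - PowerSeries.C q * PowerSeries.X) * (1 - PowerSeries.C e * PowerSeries.X ^ 2)) =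
      (1 - PowerSeries.C e * PowerSeries.X) * (1 - PowerSeries.C q * PowerSeries.X ^ 2) := by
  have hG := mk_pow_mul q
  have hG' := mk_pow_mul e
  have hH := mk_even_pow_mul q
  have hH' := mk_even_pow_mul e
  set G := PowerSeries.mk fun i => q ^ i
  set G' := PowerSeries.mk fun i => e ^ i
  set H := PowerSeries.mk fun i => if 2 ∣ i + 1 then q ^ ((i + 1) / 2) else 0
  set H' := PowerSeries.mk fun i => if 2 ∣ i + 1 then e ^ ((i + 1) / 2) else 0
  have hD : PowerSeries.derivative ℚ (PowerSeries.mk s) =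
      (PowerSeries.C q * G - PowerSeries.C e * G' - 2 * (H - H')) * PowerSeries.mk s := by
    ext n
    rw [PowerSeries.coeff_derivative, PowerSeries.coeff_mk, PowerSeries.coeff_mul,
      Finset.Nat.sum_antidiagonal_eq_sum_range_succ_mk]
    have := hs (n + 1)
    push_cast at this
    rw [mul_comm, this]
    apply Finset.sum_congr rfl
    intro i hi
    have h2 : (2 : PowerSeries ℚ) = PowerSeries.C 2 := (map_ofNat PowerSeries.C 2).symm
    simp only [map_sub, PowerSeries.coeff_C_mul, PowerSeries.coeff_mk, G, G', H, H', h2]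
    congr 1
    split_ifs <;> ring
  have dC : ∀ a : ℚ, PowerSeries.derivative ℚ (PowerSeries.C a) = 0 := fun a => PowerSeries.derivative_C
  have dX : PowerSeries.derivative ℚ (PowerSeries.X : PowerSeries ℚ) = 1 := PowerSeries.derivative_X
  apply powerSeries_eq_of_derivative_mul
  · simp
  · simp [h0]
  · simp only [Derivation.leibniz, map_sub, Derivation.map_one_eq_zero, dC, dX, smul_eq_mul, hD,
      Derivation.leibniz_pow, nsmul_eq_mul]
    set S := PowerSeries.mk s
    push_cast
    simp only [pow_one]
    generalize (PowerSeries.C q : PowerSeries ℚ) = q at *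
    generalize (PowerSeries.C e : PowerSeries ℚ) = e at *
    generalize (PowerSeries.X : PowerSeries ℚ) = x at *
    linear_combination (S * (1 - e * x ^ 2) * (1 - e * x) * (1 - q * x ^ 2) * q) * hG
      - (S * (1 - q * x) * (1 - e * x ^ 2) * (1 - q * x ^ 2) * e) * hG'
      - 2 * (S * (1 - q * x) * (1 - e * x ^ 2) * (1 - e * x)) * hH
      + 2 * (S * (1 - q * x) * (1 - e * x) * (1 - q * x ^ 2)) * hH'

theorem linear_recurrence_stable {q e : ℚ} {s : ℕ → ℚ} (h0 : s 0 = 1)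
    (hs : ∀ n : ℕ, (n : ℚ) * s n = ∑ i ∈ Finset.range n, (q ^ (i + 1) - e ^ (i + 1)
      - 2 * (if 2 ∣ i + 1 then q ^ ((i + 1) / 2) - e ^ ((i + 1) / 2) else 0)) * s (n - 1 - i)) :
    s 1 = q - e ∧ s 2 = q * (q - e) + e - q ∧ s 3 = q * s 2 + e * s 1 ∧
      ∀ n, s (n + 4) = q * s (n + 3) + e * s (n + 2) - e * q * s (n + 1) := by
  have h := generating_function_stable h0 hs
  have key : ∀ n, s (n + 3) = q * s (n + 2) + e * s (n + 1) - e * q * s n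
      + (if n = 0 then e * q else 0) := by
    intro n
    have hn := congrArg (PowerSeries.coeff (n + 3)) h
    have e1 : PowerSeries.mk s * ((1 - PowerSeries.C q * PowerSeries.X) * (1 - PowerSeries.C e * PowerSeries.X ^ 2)) = PowerSeries.mk s
      - PowerSeries.C q * (PowerSeries.mk s * PowerSeries.X ^ 1) - PowerSeries.C e * (PowerSeries.mk s * PowerSeries.X ^ 2)
      + PowerSeries.C (e * q) * (PowerSeries.mk s * PowerSeries.X ^ 3) := by
      rw [map_mul]; ring
    have e2 : ((1 - PowerSeries.C e * PowerSeries.X) * (1 - PowerSeries.C q * PowerSeries.X ^ 2) : PowerSeries ℚ) = 1 - PowerSeries.C e * (1 * PowerSeries.X ^ 1)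
      - PowerSeries.C q * (1 * PowerSeries.X ^ 2) + PowerSeries.C (e * q) * (1 * PowerSeries.X ^ 3) := by
      rw [map_mul]; ring
    rw [e1, e2] at hn
    simp only [map_sub, map_add, PowerSeries.coeff_C_mul, PowerSeries.coeff_mul_X_pow', PowerSeries.coeff_mk,
      PowerSeries.coeff_one] at hn
    simp only [show 1 ≤ n + 3 by omega, show 2 ≤ n + 3 by omega, show 3 ≤ n + 3 by omega, if_true,
      show n + 3 - 1 = n + 2 by omega, show n + 3 - 2 = n + 1 by omega,
      show n + 3 - 3 = n by omega, show ¬ n + 3 = 0 by omega, show ¬ n + 2 = 0 by omega,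
      show ¬ n + 1 = 0 by omega, if_false] at hn
    split_ifs at hn ⊢ <;> linarith
  have h1 : s 1 = q - e := by
    have := hs 1
    simp [h0] at this
    linarith
  have h2 : s 2 = q * (q - e) + e - q := by
    have := hs 2
    simp [Finset.sum_range_succ, h0, h1] at this
    linarith
  refine ⟨h1, h2, ?_, ?_⟩
  · have := key 0
    simp [h0] at this
    linarith
  · intro n
    have := key (n + 1)
    simpa using this

theorem eq_A2_of_recurrence {q : ℕ} {s : ℕ → ℚ} (h0 : s 0 = 1)
    (hs : ∀ n : ℕ, (n : ℚ) * s n = ∑ i ∈ Finset.range n, ((q : ℚ) ^ (i + 1) - 1 ^ (i + 1)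
      - 2 * (if 2 ∣ i + 1 then (q : ℚ) ^ ((i + 1) / 2) - 1 ^ ((i + 1) / 2) else 0))
        * s (n - 1 - i)) (n : ℕ) (hn : 0 < n) :
    s n = ((q : ℚ) - 1) * A2 q n := by
  obtain ⟨h1, h2, h3, hr⟩ := linear_recurrence_stable h0 hs
  have hq : (q : ℚ) + 1 ≠ 0 := by positivity
  obtain ⟨n, rfl⟩ : ∃ k, n = k + 1 := ⟨n - 1, by omega⟩
  unfold A2
  induction n using Nat.strong_induction_on with
  | _ n ih =>
  rcases n with _ | _ | _ | n
  · rw [zero_add, h1]; field_simp; ring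
  · rw [h2]; field_simp; ring
  · rw [h3, h2, h1]; field_simp; ring
  · rw [show n + 1 + 1 + 1 + 1 = n + 4 by ring, hr, ih n (by omega) (by omega),
      show n + 2 = n + 1 + 1 by ring, ih (n + 1) (by omega) (by omega),
      show n + 3 = n + 2 + 1 by ring, ih (n + 2) (by omega) (by omega)]
    field_simp
    ring

theorem eq_A0_of_recurrence {q : ℕ} {s : ℕ → ℚ} (h0 : s 0 = 1)
    (hs : ∀ n : ℕ, (n : ℚ) * s n = ∑ i ∈ Finset.range n, ((q : ℚ) ^ (i + 1) - (-1) ^ (i + 1)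
      - 2 * (if 2 ∣ i + 1 then (q : ℚ) ^ ((i + 1) / 2) - (-1) ^ ((i + 1) / 2) else 0))
        * s (n - 1 - i)) (n : ℕ) (hn : 0 < n) :
    s n = ((q : ℚ) + 1) * A0 q n := by
  obtain ⟨h1, h2, h3, hr⟩ := linear_recurrence_stable h0 hs
  have hq : (q : ℚ) ^ 2 + 1 ≠ 0 := by positivity
  obtain ⟨n, rfl⟩ : ∃ k, n = k + 1 := ⟨n - 1, by omega⟩
  unfold A0
  induction n using Nat.strong_induction_on with
  | _ n ih =>
  rcases n with _ | _ | _ | n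
  · rw [zero_add, h1]; norm_num; field_simp
  · rw [h2]; norm_num; field_simp; ring
  · rw [h3, h2, h1]; norm_num; field_simp; ring
  · rw [show n + 1 + 1 + 1 + 1 = n + 4 by ring, hr, ih n (by omega) (by omega),
      show n + 2 = n + 1 + 1 by ring, ih (n + 1) (by omega) (by omega),
      show n + 3 = n + 2 + 1 by ring, ih (n + 2) (by omega) (by omega)]
    rw [show (n + 4 + 1) / 2 = (n + 1) / 2 + 2 by omega, show (n + 4) / 2 = n / 2 + 2 by omega,
      show (n + 1 + 1) / 2 = n / 2 + 1 by omega, show (n + 1 + 1 + 1) / 2 = (n + 1) / 2 + 1 by omega]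
    field_simp
    ring

end Recurrence

section TwistedFrobenius

theorem finite_card_ge_two {F : Type} [Field F] [Fintype F] : 2 ≤ Fintype.card F :=
  Fintype.one_lt_card

theorem cast_card_closure {F : Type} [Field F] [Fintype F] :
    ((Fintype.card F : ℕ) : AlgebraicClosure F) = 0 := by
  rw [← map_natCast (algebraMap F (AlgebraicClosure F)), FiniteField.cast_card_eq_zero, map_zero]

theorem pow_card_injective {F : Type} [Field F] [Fintype F] :
    Function.Injective fun x : AlgebraicClosure F => x ^ Fintype.card F :=
  (FiniteField.frobeniusAlgHom F (AlgebraicClosure F)).toRingHom.injective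

/-- The power map `z ↦ z ^ e` on the units of the algebraic closure. -/
def powUnits (F : Type) [Field F] (e : ℤ) (z : (AlgebraicClosure F)ˣ) : (AlgebraicClosure F)ˣ :=
  z ^ e

theorem powUnits_injective {F : Type} [Field F] [Fintype F] {e : ℤ}
    (he : e = 1 ∨ e = -1) : Function.Injective (powUnits F (e * Fintype.card F)) := by
  have h1 : Function.Injective fun z : (AlgebraicClosure F)ˣ => z ^ Fintype.card F := by
    intro x y h
    apply Units.ext
    apply pow_card_injective
    simpa using congrArg Units.val h
  intro x y h
  unfold powUnits at h
  rcases he with rfl | rfl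
  · apply h1
    simpa using h
  · apply h1
    simpa using h

theorem powUnits_iterate {F : Type} [Field F] (e : ℤ) (i : ℕ) (z : (AlgebraicClosure F)ˣ) :
    (powUnits F e)^[i] z = z ^ (e ^ i) := by
  induction i with
  | zero => simp
  | succ i ih => rw [Function.iterate_succ_apply', ih, powUnits, ← zpow_mul, pow_succ]

theorem fixed_powUnits {F : Type} [Field F] [Fintype F] {e : ℤ} (he : e = 1 ∨ e = -1) {i : ℕ}
    (hi : 0 < i) :
    {z | (powUnits F (e * Fintype.card F))^[i] z = z}.Finite ∧
    ({z | (powUnits F (e * Fintype.card F))^[i] z = z}.ncard : ℤ) =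
      (Fintype.card F : ℤ) ^ i - e ^ i := by
  have hq := finite_card_ge_two (F := F)
  set q := Fintype.card F
  have hei : e ^ i = 1 ∨ e ^ i = -1 := by
    rcases he with rfl | rfl
    · left; simp
    · exact neg_one_pow_eq_or ℤ i
  have hqi : (2 : ℤ) ≤ (q : ℤ) ^ i := by
    have : q ^ 1 ≤ q ^ i := Nat.pow_le_pow_right (by omega) hi
    have h2 : 2 ≤ q ^ i := by
      rw [pow_one] at this
      exact hq.trans this
    exact_mod_cast h2
  obtain ⟨N, hN⟩ : ∃ N : ℕ, (N : ℤ) = (q : ℤ) ^ i - e ^ i :=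
    ⟨((q : ℤ) ^ i - e ^ i).toNat, Int.toNat_of_nonneg (by rcases hei with h | h <;> omega)⟩
  have hN0 : N ≠ 0 := by rcases hei with h | h <;> omega
  have hNK : (N : AlgebraicClosure F) ≠ 0 := by
    have : ((N : ℤ) : AlgebraicClosure F) = ((q : ℤ) ^ i - e ^ i : ℤ) := by rw [hN]
    have hc : (q : AlgebraicClosure F) = 0 := cast_card_closure
    rw [Int.cast_natCast] at this
    rw [this]
    push_cast
    rw [hc, zero_pow hi.ne']
    have h3 : ((e ^ i : ℤ) : AlgebraicClosure F) ≠ 0 := by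
      rcases hei with h | h <;> rw [h] <;> simp
    push_cast at h3
    simpa using h3
  have : NeZero (N : AlgebraicClosure F) := ⟨hNK⟩
  have : NeZero N := ⟨hN0⟩
  have hset : {z | (powUnits F (e * q))^[i] z = z} =
      (rootsOfUnity N (AlgebraicClosure F) : Set (AlgebraicClosure F)ˣ) := by
    ext z
    simp only [Set.mem_ofPred_eq, SetLike.mem_coe, mem_rootsOfUnity]
    rw [powUnits_iterate, ← zpow_natCast, hN, mul_pow]
    rcases hei with h | h
    · rw [h, one_mul, zpow_sub_one, mul_inv_eq_one]
    · rw [h, neg_one_mul, zpow_neg, sub_neg_eq_add, zpow_add_one, inv_eq_iff_mul_eq_one]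
  have hcard := HasEnoughRootsOfUnity.natCard_rootsOfUnity (AlgebraicClosure F) N
  rw [hset, ← hN, ← Nat.card_coe_set_eq]
  refine ⟨?_, by exact_mod_cast hcard⟩
  rw [← Set.finite_coe_iff]
  exact Nat.finite_of_card_ne_zero (hcard.trans_ne hN0)

theorem finite_fixed_powUnits {F : Type} [Field F] [Fintype F] {e : ℤ} (he : e = 1 ∨ e = -1) :
    ∀ i, 0 < i → {z | (powUnits F (e * Fintype.card F))^[i] z = z}.Finite :=
  fun _ hi => (fixed_powUnits he hi).1

theorem stableSets_zero {X : Type*} [DecidableEq X] (f : X → X) : (stableSets f 0).ncard = 1 := by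
  have : stableSets f 0 = {∅} := by
    ext S
    simp only [stableSets, Set.mem_ofPred_eq, Set.mem_singleton_iff, Finset.card_eq_zero]
    constructor
    · exact fun h => h.1
    · rintro rfl
      simp
  rw [this, Set.ncard_singleton]

theorem recurrence_powUnits {F : Type} [Field F] [Fintype F] {e : ℤ} (he : e = 1 ∨ e = -1)
    (n : ℕ) :
    (n : ℚ) * ((stableSets (powUnits F (e * Fintype.card F)) n).ncard : ℚ) =
      ∑ i ∈ Finset.range n, ((Fintype.card F : ℚ) ^ (i + 1) - (e : ℚ) ^ (i + 1)
      - 2 * (if 2 ∣ i + 1 then (Fintype.card F : ℚ) ^ ((i + 1) / 2) - (e : ℚ) ^ ((i + 1) / 2)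
          else 0))
        * ((stableSets (powUnits F (e * Fintype.card F)) (n - 1 - i)).ncard : ℚ) := by
  have h := card_mul_ncard_stableSets (powUnits_injective (F := F) he) (finite_fixed_powUnits he) n
  have h' := congrArg (fun z : ℤ => (z : ℚ)) h
  push_cast at h'
  rw [h']
  apply Finset.sum_congr rfl
  intro i _
  have hc : ∀ j, 0 < j → (({z | (powUnits F (e * Fintype.card F))^[j] z = z}.ncard : ℕ) : ℚ) =
      (Fintype.card F : ℚ) ^ j - (e : ℚ) ^ j := by
    intro j hj
    exact_mod_cast congrArg (fun z : ℤ => (z : ℚ)) (fixed_powUnits (F := F) he hj).2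
  rw [hc (i + 1) (by omega)]
  by_cases h2 : 2 ∣ i + 1
  · rw [if_pos h2, if_pos h2, hc _ (by omega)]
  · rw [if_neg h2, if_neg h2]

theorem ncard_stableSets_split {F : Type} [Field F] [Fintype F] {n : ℕ} (hn : 0 < n) :
    ((stableSets (powUnits F (1 * Fintype.card F)) n).ncard : ℚ) =
      ((Fintype.card F : ℚ) - 1) * A2 (Fintype.card F) n := by
  refine eq_A2_of_recurrence (s := fun n =>
    ((stableSets (powUnits F (1 * Fintype.card F)) n).ncard : ℚ)) ?_ ?_ n hn
  · simp only [stableSets_zero, Nat.cast_one]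
  · intro n
    have := recurrence_powUnits (F := F) (Or.inl rfl) n
    rw [Int.cast_one] at this
    exact this

theorem ncard_stableSets_nonsplit {F : Type} [Field F] [Fintype F] {n : ℕ} (hn : 0 < n) :
    ((stableSets (powUnits F (-1 * Fintype.card F)) n).ncard : ℚ) =
      ((Fintype.card F : ℚ) + 1) * A0 (Fintype.card F) n := by
  refine eq_A0_of_recurrence (s := fun n =>
    ((stableSets (powUnits F (-1 * Fintype.card F)) n).ncard : ℚ)) ?_ ?_ n hn
  · simp only [stableSets_zero, Nat.cast_one]
  · intro n
    have := recurrence_powUnits (F := F) (Or.inr rfl) n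
    rw [Int.cast_neg, Int.cast_one] at this
    exact this

/-- Stable sets that are unions of cosets of the cyclic group generated by `ζ`. -/
def stableCosetSets {F : Type} [Field F] (e : ℤ) (ζ : (AlgebraicClosure F)ˣ) (L : ℕ) :
    Set (Finset (AlgebraicClosure F)ˣ) :=
  {R | R ∈ stableSets (powUnits F e) L ∧ ∀ z ∈ R, ζ * z ∈ R}

theorem exists_fibres {F : Type} [Field F] {ζ : (AlgebraicClosure F)ˣ} (hζ : 0 < orderOf ζ) :
    ∃ fib : (AlgebraicClosure F)ˣ → Finset (AlgebraicClosure F)ˣ,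
      (∀ b x, x ∈ fib b ↔ x ^ orderOf ζ = b) ∧ ∀ b, (fib b).card = orderOf ζ := by
  set m := orderOf ζ with hm
  have hsurj : ∀ b : (AlgebraicClosure F)ˣ, ∃ z : (AlgebraicClosure F)ˣ, z ^ m = b := by
    intro b
    obtain ⟨z, hz⟩ := IsAlgClosed.exists_pow_nat_eq (b : AlgebraicClosure F) hζ
    have hz0 : z ≠ 0 := by
      rintro rfl
      rw [zero_pow hζ.ne'] at hz
      exact b.ne_zero hz.symm
    exact ⟨Units.mk0 z hz0, Units.ext (by simpa using hz)⟩
  choose z0 hz0 using hsurj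
  have hprim : IsPrimitiveRoot (ζ : AlgebraicClosure F) m :=
    IsPrimitiveRoot.coe_units_iff.2 (IsPrimitiveRoot.orderOf ζ)
  refine ⟨fun b => (Finset.range m).image fun i => z0 b * ζ ^ i, ?_, ?_⟩
  · intro b x
    simp only [Finset.mem_image, Finset.mem_range]
    constructor
    · rintro ⟨i, -, rfl⟩
      rw [mul_pow, hz0, ← pow_mul, mul_comm i, pow_mul, hm, pow_orderOf_eq_one, one_pow, mul_one]
    · intro hx
      have : NeZero m := ⟨hζ.ne'⟩
      have h1 : ((x / z0 b : (AlgebraicClosure F)ˣ) : AlgebraicClosure F) ^ m = 1 := by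
        rw [← Units.val_pow_eq_pow_val, div_pow, hx, hz0, div_self', Units.val_one]
      obtain ⟨i, hi, e⟩ := hprim.eq_pow_of_pow_eq_one h1
      refine ⟨i, hi, ?_⟩
      have e' : ζ ^ i = x / z0 b := Units.ext (by simpa using e)
      rw [e', mul_div_cancel]
  · intro b
    rw [Finset.card_image_of_injOn, Finset.card_range]
    intro i hi j hj h
    have h' : ζ ^ i = ζ ^ j := mul_left_cancel h
    exact pow_injOn_Iio_orderOf (by simpa using hi) (by simpa using hj) h'

theorem ncard_stableCosetSets {F : Type} [Field F] {e : ℤ} {ζ : (AlgebraicClosure F)ˣ}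
    (hf : (powUnits F e).Injective) (hζ : 0 < orderOf ζ) (L : ℕ) :
    (stableCosetSets e ζ L).ncard =
      if orderOf ζ ∣ L then (stableSets (powUnits F e) (L / orderOf ζ)).ncard else 0 := by
  obtain ⟨fib, hmem, hcard⟩ := exists_fibres hζ
  set m := orderOf ζ with hm
  have hfibcard : ∀ B : Finset (AlgebraicClosure F)ˣ, (B.biUnion fib).card = m * B.card := by
    intro B
    rw [Finset.card_biUnion]
    · rw [Finset.sum_congr rfl fun b _ => hcard b, Finset.sum_const, smul_eq_mul, mul_comm]
    · intro b _ c _ hbc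
      change Disjoint (fib b) (fib c)
      rw [Finset.disjoint_left]
      intro x hx hx'
      rw [hmem] at hx hx'
      exact hbc (hx ▸ hx')
  have hmemB : ∀ (B : Finset (AlgebraicClosure F)ˣ) x, x ∈ B.biUnion fib ↔ x ^ m ∈ B := by
    intro B x
    simp [hmem]
  have hζpow : ∀ R ∈ stableCosetSets e ζ L, ∀ i : ℕ, ∀ z ∈ R, ζ ^ i * z ∈ R := by
    intro R hR i
    induction i with
    | zero => intro z hz; simpa using hz
    | succ i ih =>
      intro z hz
      rw [pow_succ', mul_assoc]
      exact hR.2 _ (ih z hz)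
  have hprim : IsPrimitiveRoot (ζ : AlgebraicClosure F) m :=
    IsPrimitiveRoot.coe_units_iff.2 (IsPrimitiveRoot.orderOf ζ)
  have hfull : ∀ R ∈ stableCosetSets e ζ L, (R.image (· ^ m)).biUnion fib = R := by
    intro R hR
    ext x
    rw [hmemB, Finset.mem_image]
    constructor
    · rintro ⟨y, hy, hxy⟩
      have : NeZero m := ⟨hζ.ne'⟩
      have h1 : ((x / y : (AlgebraicClosure F)ˣ) : AlgebraicClosure F) ^ m = 1 := by
        rw [← Units.val_pow_eq_pow_val, div_pow, ← hxy, div_self', Units.val_one]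
      obtain ⟨i, hi, ei⟩ := hprim.eq_pow_of_pow_eq_one h1
      have e' : ζ ^ i = x / y := Units.ext (by simpa using ei)
      have := hζpow R hR i y hy
      rwa [e', div_mul_cancel] at this
    · exact fun hx => ⟨x, hx, rfl⟩
  split_ifs with hdvd
  · obtain ⟨r, rfl⟩ := hdvd
    rw [Nat.mul_div_cancel_left _ hζ]
    symm
    apply Set.ncard_congr (fun B _ => B.biUnion fib)
    · rintro B ⟨hc, hB⟩
      refine ⟨⟨by rw [hfibcard, hc], ?_⟩, ?_⟩
      · rw [image_eq_self_iff hf]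
        intro x hx
        rw [hmemB] at hx ⊢
        have := (image_eq_self_iff hf B).1 hB _ hx
        unfold powUnits at this ⊢
        rwa [← zpow_natCast, ← zpow_mul, mul_comm, zpow_mul, zpow_natCast]
      · intro z hz
        rw [hmemB] at hz ⊢
        rwa [mul_pow, hm, pow_orderOf_eq_one, one_mul]
    · rintro B B' - - h
      have hpow : ∀ b, ∃ x : (AlgebraicClosure F)ˣ, x ^ m = b := by
        intro b
        have : (fib b).Nonempty := by
          rw [← Finset.card_pos, hcard]
          exact hζ
        obtain ⟨x, hx⟩ := this
        exact ⟨x, (hmem b x).1 hx⟩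
      ext b
      obtain ⟨x, rfl⟩ := hpow b
      rw [← hmemB, ← hmemB, h]
    · intro R hR
      refine ⟨R.image (· ^ m), ⟨?_, ?_⟩, hfull R hR⟩
      · have h1 := hfibcard (R.image (· ^ m))
        rw [hfull R hR, hR.1.1] at h1
        exact (Nat.eq_of_mul_eq_mul_left hζ h1).symm
      · rw [image_eq_self_iff hf]
        intro b hb
        obtain ⟨x, hx, rfl⟩ := Finset.mem_image.1 hb
        refine Finset.mem_image.2 ⟨powUnits F e x, (image_eq_self_iff hf R).1 hR.1.2 x hx, ?_⟩
        simp only [powUnits]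
        rw [← zpow_natCast, ← zpow_mul, mul_comm, zpow_mul, zpow_natCast]
  · have : stableCosetSets e ζ L = ∅ := by
      ext R
      simp only [Set.mem_empty_iff_false, iff_false]
      intro hR
      apply hdvd
      have h1 := hfibcard (R.image (· ^ m))
      rw [hfull R hR, hR.1.1] at h1
      exact ⟨_, h1⟩
    rw [this, Set.ncard_empty]

end TwistedFrobenius

section ProjectiveLine

variable {K : Type*} [Field K]

/-- The standard representative of a point of the projective line. -/
def vec : Option K → Fin 2 → K
  | none => ![1, 0]
  | some x => ![x, 1]

/-- The Möbius action over an arbitrary field. -/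
def mob (M : Matrix (Fin 2) (Fin 2) K) : Option K → Option K
  | none => if M 1 0 = 0 then none else some (M 0 0 / M 1 0)
  | some x =>
      if M 1 0 * x + M 1 1 = 0 then none
      else some ((M 0 0 * x + M 0 1) / (M 1 0 * x + M 1 1))

/-- The factor by which `M` scales standard representatives. -/
def lam (M : Matrix (Fin 2) (Fin 2) K) : Option K → K
  | none => if M 1 0 = 0 then M 0 0 else M 1 0
  | some x => if M 1 0 * x + M 1 1 = 0 then M 0 0 * x + M 0 1 else M 1 0 * x + M 1 1

/-- The product of the scaling factors over a finite set. -/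
def lamProd (M : Matrix (Fin 2) (Fin 2) K) (S : Finset (Option K)) : K :=
  ∏ t ∈ S, lam M t

theorem vec_ne_zero (t : Option K) : vec t ≠ 0 := by
  intro h
  cases t with
  | none => simpa [vec] using congrFun h 0
  | some x => simpa [vec] using congrFun h 1

theorem mulVec_vec (M : Matrix (Fin 2) (Fin 2) K) (t : Option K) :
    M.mulVec (vec t) = lam M t • vec (mob M t) := by
  cases t with
  | none =>
    by_cases h : M 1 0 = 0
    · ext i
      fin_cases i <;> simp [Matrix.mulVec, dotProduct, Fin.sum_univ_two, vec, lam, mob, h]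
    · ext i
      fin_cases i <;> simp [Matrix.mulVec, dotProduct, Fin.sum_univ_two, vec, lam, mob, h]
      field_simp
  | some x =>
    by_cases h : M 1 0 * x + M 1 1 = 0
    · ext i
      fin_cases i <;> simp [Matrix.mulVec, dotProduct, Fin.sum_univ_two, vec, lam, mob, h]
    · ext i
      fin_cases i <;> simp [Matrix.mulVec, dotProduct, Fin.sum_univ_two, vec, lam, mob, h]
      rw [mul_div_cancel₀ _ h]

theorem lam_ne_zero {M : Matrix (Fin 2) (Fin 2) K} (hM : M.det ≠ 0) (t : Option K) :
    lam M t ≠ 0 := by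
  intro h
  have h1 := mulVec_vec M t
  rw [h, zero_smul] at h1
  exact vec_ne_zero t (Matrix.eq_zero_of_mulVec_eq_zero hM h1)

theorem smul_vec_inj {c d : K} {s t : Option K} (hc : c ≠ 0) (hd : d ≠ 0)
    (h : c • vec s = d • vec t) : s = t ∧ c = d := by
  have h0 := congrFun h 0
  have h1 := congrFun h 1
  cases s <;> cases t <;> simp_all [vec]

theorem mob_lam_of_mulVec {M : Matrix (Fin 2) (Fin 2) K} (hM : M.det ≠ 0) {s t : Option K} {c : K}
    (hc : c ≠ 0) (h : M.mulVec (vec t) = c • vec s) : mob M t = s ∧ lam M t = c := by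
  rw [mulVec_vec] at h
  exact smul_vec_inj (lam_ne_zero hM t) hc h

theorem mob_lam_mul {M N : Matrix (Fin 2) (Fin 2) K} (hM : M.det ≠ 0) (hN : N.det ≠ 0)
    (t : Option K) :
    mob (M * N) t = mob M (mob N t) ∧ lam (M * N) t = lam M (mob N t) * lam N t := by
  apply mob_lam_of_mulVec
  · rw [Matrix.det_mul]
    exact mul_ne_zero hM hN
  · exact mul_ne_zero (lam_ne_zero hM _) (lam_ne_zero hN _)
  · rw [← Matrix.mulVec_mulVec, mulVec_vec N, Matrix.mulVec_smul, mulVec_vec M, smul_smul, mul_comm]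

theorem mob_lam_scalar {a : K} (ha : a ≠ 0) (t : Option K) :
    mob (a • (1 : Matrix (Fin 2) (Fin 2) K)) t = t ∧
      lam (a • (1 : Matrix (Fin 2) (Fin 2) K)) t = a := by
  apply mob_lam_of_mulVec
  · simp [ha]
  · exact ha
  · simp [Matrix.smul_mulVec]

theorem mob_one (t : Option K) : mob (1 : Matrix (Fin 2) (Fin 2) K) t = t := by
  simpa using (mob_lam_scalar one_ne_zero t).1

theorem lam_one (t : Option K) : lam (1 : Matrix (Fin 2) (Fin 2) K) t = 1 := by
  simpa using (mob_lam_scalar one_ne_zero t).2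

theorem mob_injective {M : Matrix (Fin 2) (Fin 2) K} (hM : M.det ≠ 0) :
    Function.Injective (mob M) := by
  have h0 : IsUnit M.det := isUnit_iff_ne_zero.2 hM
  have h : (M⁻¹).det ≠ 0 := by
    rw [Matrix.det_nonsing_inv]
    exact h0.ringInverse.ne_zero
  intro s t hst
  rw [← mob_one s, ← mob_one t, ← Matrix.nonsing_inv_mul M h0, (mob_lam_mul h hM s).1,
    (mob_lam_mul h hM t).1, hst]

theorem lamProd_ne_zero {M : Matrix (Fin 2) (Fin 2) K} (hM : M.det ≠ 0) (S : Finset (Option K)) :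
    lamProd M S ≠ 0 :=
  Finset.prod_ne_zero_iff.2 fun t _ => lam_ne_zero hM t

theorem lamProd_mul {M N : Matrix (Fin 2) (Fin 2) K} (hM : M.det ≠ 0) (hN : N.det ≠ 0)
    (S : Finset (Option K)) :
    lamProd (M * N) S = lamProd M (S.image (mob N)) * lamProd N S := by
  unfold lamProd
  rw [Finset.prod_image fun _ _ _ _ h => mob_injective hN h, ← Finset.prod_mul_distrib]
  exact Finset.prod_congr rfl fun t _ => (mob_lam_mul hM hN t).2

theorem image_mob_mul {M N : Matrix (Fin 2) (Fin 2) K} (hM : M.det ≠ 0) (hN : N.det ≠ 0)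
    (S : Finset (Option K)) : S.image (mob (M * N)) = (S.image (mob N)).image (mob M) := by
  rw [Finset.image_image]
  exact Finset.image_congr fun t _ => (mob_lam_mul hM hN t).1

theorem lamProd_scalar {a : K} (ha : a ≠ 0) (S : Finset (Option K)) :
    lamProd (a • (1 : Matrix (Fin 2) (Fin 2) K)) S = a ^ S.card := by
  unfold lamProd
  rw [Finset.prod_congr rfl fun t _ => (mob_lam_scalar ha t).2, Finset.prod_const]

theorem image_mob_one (S : Finset (Option K)) :
    S.image (mob (1 : Matrix (Fin 2) (Fin 2) K)) = S := by
  rw [Finset.image_congr fun t _ => mob_one t]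
  exact Finset.image_id

theorem lamProd_one (S : Finset (Option K)) :
    lamProd (1 : Matrix (Fin 2) (Fin 2) K) S = 1 :=
  Finset.prod_eq_one fun t _ => lam_one t

theorem lamProd_pow {M : Matrix (Fin 2) (Fin 2) K} (hM : M.det ≠ 0) {S : Finset (Option K)}
    (hS : S.image (mob M) = S) (i : ℕ) :
    S.image (mob (M ^ i)) = S ∧ lamProd (M ^ i) S = lamProd M S ^ i := by
  induction i with
  | zero => simp [image_mob_one, lamProd_one]
  | succ i ih =>
    have h : (M ^ i).det ≠ 0 := by
      rw [Matrix.det_pow]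
      exact pow_ne_zero _ hM
    rw [pow_succ, image_mob_mul h hM, lamProd_mul h hM, hS, pow_succ, ih.1, ih.2]
    exact ⟨rfl, rfl⟩

theorem mob_map (φ : K →+* K) (M : Matrix (Fin 2) (Fin 2) K) (t : Option K) :
    mob (M.map φ) (t.map φ) = (mob M t).map φ := by
  cases t <;> simp only [mob, Option.map_none, Option.map_some, Matrix.map_apply, ← map_mul,
    ← map_add, map_eq_zero_iff φ φ.injective, ← map_div₀] <;> split_ifs <;> rfl

theorem lam_map (φ : K →+* K) (M : Matrix (Fin 2) (Fin 2) K) (t : Option K) :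
    lam (M.map φ) (t.map φ) = φ (lam M t) := by
  cases t <;> simp only [lam, Option.map_none, Option.map_some, Matrix.map_apply, ← map_mul,
    ← map_add, map_eq_zero_iff φ φ.injective] <;> split_ifs <;> rfl

end ProjectiveLine

section Cocycle

/-- The matrix over the algebraic closure attached to an element of `GL₂(F)`. -/
def mat (γ : GL (Fin 2) F) : Matrix (Fin 2) (Fin 2) (AlgebraicClosure F) :=
  γ.val.map (em F)

/-- The Frobenius endomorphism of the algebraic closure. -/
def frobK (F : Type) [Field F] [Fintype F] : AlgebraicClosure F →+* AlgebraicClosure F :=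
  (FiniteField.frobeniusAlgHom F (AlgebraicClosure F)).toRingHom

theorem frobK_apply (x : AlgebraicClosure F) : frobK F x = x ^ Fintype.card F := rfl

theorem frobP1_eq (t : Option (AlgebraicClosure F)) : frobP1 F t = t.map (frobK F) := rfl

theorem frobP1_injective : Function.Injective (frobP1 F) :=
  Option.map_injective pow_card_injective

omit [Fintype F] in
theorem em_injective : Function.Injective (em F) := (em F).injective

theorem em_pow_card (x : F) : em F x ^ Fintype.card F = em F x := by
  rw [← map_pow, FiniteField.pow_card]

omit [Fintype F] in
theorem moebius_eq_mob (γ : Matrix (Fin 2) (Fin 2) F) : moebius γ = mob (γ.map (em F)) := by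
  ext1 t
  cases t with
  | none => simp only [moebius, mob, Matrix.map_apply, map_eq_zero_iff _ (em F).injective]
  | some x =>
    simp only [moebius, mob, Matrix.map_apply]
    congr

omit [Fintype F] in
theorem det_mat_ne_zero (γ : GL (Fin 2) F) : (mat γ).det ≠ 0 := by
  have h : (mat γ).det = em F γ.val.det := ((em F).map_det γ.val).symm
  rw [h]
  exact (map_ne_zero_iff _ em_injective).2 γ.det.ne_zero

omit [Fintype F] in
theorem mat_mul (γ γ' : GL (Fin 2) F) : mat (γ * γ') = mat γ * mat γ' := by
  simp [mat, Matrix.map_mul]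

omit [Fintype F] in
theorem mat_one : mat (1 : GL (Fin 2) F) = 1 := by
  simp [mat]

theorem mat_map_frobK (γ : GL (Fin 2) F) : (mat γ).map (frobK F) = mat γ := by
  ext i j
  simp [mat, frobK_apply, em_pow_card]

theorem mob_frobP1 (γ : GL (Fin 2) F) (t : Option (AlgebraicClosure F)) :
    mob (mat γ) (frobP1 F t) = frobP1 F (mob (mat γ) t) := by
  rw [frobP1_eq, frobP1_eq, ← mob_map, mat_map_frobK]

theorem lam_frobP1 (γ : GL (Fin 2) F) (t : Option (AlgebraicClosure F)) :
    lam (mat γ) (frobP1 F t) = lam (mat γ) t ^ Fintype.card F := by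
  rw [frobP1_eq, ← frobK_apply, ← lam_map, mat_map_frobK]

theorem lamProd_pow_card {γ : GL (Fin 2) F} {S : Finset (Option (AlgebraicClosure F))}
    (hS : S.image (frobP1 F) = S) :
    lamProd (mat γ) S ^ Fintype.card F = lamProd (mat γ) S := by
  unfold lamProd
  rw [← Finset.prod_pow]
  conv_rhs => rw [← hS, Finset.prod_image fun _ _ _ _ h => frobP1_injective h]
  exact Finset.prod_congr rfl fun t _ => (lam_frobP1 γ t).symm

theorem exists_em_eq {x : AlgebraicClosure F} (hx : x ^ Fintype.card F = x) :
    ∃ y : F, em F y = x := by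
  have hcard : 1 < Fintype.card F := Fintype.one_lt_card
  have hne : (X ^ Fintype.card F - X : (AlgebraicClosure F)[X]) ≠ 0 :=
    FiniteField.X_pow_card_sub_X_ne_zero _ hcard
  have h1 : Finset.univ.image (em F) = (X ^ Fintype.card F - X : (AlgebraicClosure F)[X]).roots.toFinset := by
    apply Finset.eq_of_subset_of_card_le
    · intro z hz
      obtain ⟨y, -, rfl⟩ := Finset.mem_image.1 hz
      rw [Multiset.mem_toFinset, mem_roots hne]
      simp [em_pow_card]
    · rw [Finset.card_image_of_injective _ em_injective, Finset.card_univ]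
      refine (Multiset.toFinset_card_le _).trans ((card_roots' _).trans ?_)
      rw [FiniteField.X_pow_card_sub_X_natDegree_eq _ hcard]
  have h2 : x ∈ (X ^ Fintype.card F - X : (AlgebraicClosure F)[X]).roots.toFinset := by
    rw [Multiset.mem_toFinset, mem_roots hne]
    simp [hx]
  rw [← h1] at h2
  obtain ⟨y, -, hy⟩ := Finset.mem_image.1 h2
  exact ⟨y, hy⟩

theorem exists_square_iff (hq : Odd (Fintype.card F)) (x : AlgebraicClosure F) :
    (∃ v : F, v ≠ 0 ∧ x = em F (v * v)) ↔ x ^ ((Fintype.card F - 1) / 2) = 1 := by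
  have hcard : 1 < Fintype.card F := Fintype.one_lt_card
  obtain ⟨h, hh⟩ := hq
  have e1 : (Fintype.card F - 1) / 2 = h := by omega
  rw [e1]
  constructor
  · rintro ⟨v, hv, rfl⟩
    have : v ^ (Fintype.card F - 1) = 1 := FiniteField.pow_card_sub_one_eq_one v hv
    rw [← map_pow, ← pow_two, ← pow_mul, show 2 * h = Fintype.card F - 1 by omega, this, map_one]
  · intro hx
    obtain ⟨y, hy⟩ := IsAlgClosed.exists_pow_nat_eq x (n := 2) (by omega)
    have hy1 : y ^ (2 * h) = 1 := by rw [pow_mul, hy, hx]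
    have hy2 : y ^ Fintype.card F = y := by rw [hh, pow_succ, hy1, one_mul]
    obtain ⟨v, rfl⟩ := exists_em_eq hy2
    refine ⟨v, ?_, by rw [map_mul, ← pow_two, hy]⟩
    rintro rfl
    rw [map_zero, zero_pow (by omega)] at hy1
    exact zero_ne_one hy1

/-- The sign of a point: `-1` at infinity, `1` elsewhere. -/
def ptSign : Option (AlgebraicClosure F) → AlgebraicClosure F
  | none => -1
  | some _ => 1

omit [Fintype F] in
theorem locMult_mul_lam (γ : GL (Fin 2) F) (t : Option (AlgebraicClosure F)) :
    locMult γ.val t * lam (mat γ) t = (mat γ).det * (ptSign t * ptSign (mob (mat γ) t)) := by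
  have hdet : (mat γ).det = mat γ 0 0 * mat γ 1 1 - mat γ 0 1 * mat γ 1 0 := Matrix.det_fin_two _
  have hdet' : em F γ.val.det = (mat γ).det := (em F).map_det γ.val
  have hm : ∀ i j, em F (γ.val i j) = mat γ i j := fun _ _ => rfl
  have h10 : γ.val 1 0 = 0 ↔ mat γ 1 0 = 0 := by
    rw [← hm, map_eq_zero_iff _ em_injective]
  cases t with
  | none =>
    by_cases h : mat γ 1 0 = 0
    · simp only [locMult, lam, mob, h10, h, if_true, hm, ptSign, hdet]
      ring
    · simp only [locMult, lam, mob, h10, h, if_false, ptSign, map_div₀, map_neg, hdet', hm]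
      field_simp
  | some x =>
    simp only [locMult, lam, mob, hm, hdet']
    by_cases h : mat γ 1 0 * x + mat γ 1 1 = 0
    · simp only [h, if_true, ptSign, hdet]
      linear_combination (-mat γ 0 0) * h + 2 * mat γ 0 0 * h
    · simp only [h, if_false, ptSign]
      field_simp

omit [Fintype F] in
theorem Jmult_mul_lamProd {γ : GL (Fin 2) F} {S : Finset (Option (AlgebraicClosure F))}
    (hS : S.image (moebius γ.val) = S) :
    Jmult γ.val S * lamProd (mat γ) S = (mat γ).det ^ S.card := by
  rw [moebius_eq_mob] at hS
  change S.image (mob (mat γ)) = S at hS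
  unfold Jmult lamProd
  rw [← Finset.prod_mul_distrib, Finset.prod_congr rfl fun t _ => locMult_mul_lam γ t,
    Finset.prod_mul_distrib, Finset.prod_const, Finset.prod_mul_distrib]
  have h : ∏ t ∈ S, ptSign (mob (mat γ) t) = ∏ t ∈ S, ptSign t := by
    conv_rhs => rw [← hS, Finset.prod_image fun _ _ _ _ h => mob_injective (det_mat_ne_zero γ) h]
  rw [h, ← Finset.prod_mul_distrib, Finset.prod_eq_one, mul_one]
  intro t _
  cases t <;> simp [ptSign]

/-- The quadratic character of the cocycle. -/
def IsBad (γ : GL (Fin 2) F) (S : Finset (Option (AlgebraicClosure F))) : Prop :=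
  lamProd (mat γ) S ^ ((Fintype.card F - 1) / 2) ≠ 1

theorem isSquareJ_iff (hq : Odd (Fintype.card F)) {γ : GL (Fin 2) F}
    {S : Finset (Option (AlgebraicClosure F))} (hc : Even S.card)
    (hS : S.image (moebius γ.val) = S) : ¬ IsSquareJ γ.val S ↔ IsBad γ S := by
  unfold IsSquareJ IsBad
  rw [exists_square_iff hq]
  have h := congrArg (· ^ ((Fintype.card F - 1) / 2)) (Jmult_mul_lamProd hS)
  simp only [mul_pow] at h
  have hd : ((mat γ).det ^ S.card) ^ ((Fintype.card F - 1) / 2) = 1 := by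
    rw [← exists_square_iff hq]
    obtain ⟨r, hr⟩ := hc
    refine ⟨γ.val.det ^ r, pow_ne_zero _ γ.det.ne_zero, ?_⟩
    rw [← pow_add, ← hr, map_pow]
    congr 1
    exact ((em F).map_det γ.val).symm
  rw [hd] at h
  rw [not_iff_not]
  constructor
  · intro h1
    rwa [h1, one_mul] at h
  · intro h1
    rwa [h1, mul_one] at h

theorem lamProd_pow_half (hq : Odd (Fintype.card F)) (γ : GL (Fin 2) F)
    {S : Finset (Option (AlgebraicClosure F))} (hS : S.image (frobP1 F) = S) :
    lamProd (mat γ) S ^ ((Fintype.card F - 1) / 2) = 1 ∨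
      lamProd (mat γ) S ^ ((Fintype.card F - 1) / 2) = -1 := by
  have h := lamProd_pow_card (γ := γ) hS
  obtain ⟨r, hr⟩ := hq
  rw [← sq_eq_one_iff, ← pow_mul, show (Fintype.card F - 1) / 2 * 2 = 2 * r by omega]
  rw [hr, pow_succ] at h
  exact mul_right_cancel₀ (lamProd_ne_zero (det_mat_ne_zero γ) S) (h.trans (one_mul _).symm)

end Cocycle

section OrbitCount

omit [Fintype F] in
theorem lamProd_mat_mul (γ γ' : GL (Fin 2) F) (S : Finset (Option (AlgebraicClosure F))) :
    lamProd (mat (γ * γ')) S = lamProd (mat γ) (S.image (mob (mat γ'))) * lamProd (mat γ') S := by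
  rw [mat_mul, lamProd_mul (det_mat_ne_zero γ) (det_mat_ne_zero γ')]

omit [Fintype F] in
theorem image_mat_mul (γ γ' : GL (Fin 2) F) (S : Finset (Option (AlgebraicClosure F))) :
    S.image (mob (mat (γ * γ'))) = (S.image (mob (mat γ'))).image (mob (mat γ)) := by
  rw [mat_mul, image_mob_mul (det_mat_ne_zero γ) (det_mat_ne_zero γ')]

theorem isBad_mul (hq : Odd (Fintype.card F)) {γ γ' : GL (Fin 2) F}
    {S : Finset (Option (AlgebraicClosure F))} (hS : S.image (frobP1 F) = S)
    (hγ' : S.image (mob (mat γ')) = S) :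
    IsBad (γ * γ') S ↔ (IsBad γ S ↔ ¬ IsBad γ' S) := by
  have h2 : (2 : AlgebraicClosure F) ≠ 0 := by
    have : (2 : F) ≠ 0 := by
      apply Ring.two_ne_zero
      intro h
      rw [FiniteField.even_card_iff_char_two] at h
      obtain ⟨r, hr⟩ := hq
      omega
    have h := (map_ne_zero_iff (em F) em_injective).2 this
    rwa [map_ofNat] at h
  have hm : (-1 : AlgebraicClosure F) ≠ 1 := by
    intro h
    apply h2
    linear_combination -h
  unfold IsBad
  rw [lamProd_mat_mul, hγ', mul_pow]
  rcases lamProd_pow_half hq γ hS with h | h <;> rcases lamProd_pow_half hq γ' hS with h' | h' <;>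
    rw [h, h'] <;> simp [hm]

omit [Fintype F] in
theorem lamProd_conj (g γ : GL (Fin 2) F) {S : Finset (Option (AlgebraicClosure F))}
    (hγ : S.image (mob (mat γ)) = S) :
    lamProd (mat (g * γ * g⁻¹)) (S.image (mob (mat g))) = lamProd (mat γ) S := by
  have h := lamProd_mat_mul (g * γ * g⁻¹) g S
  rw [inv_mul_cancel_right, lamProd_mat_mul, hγ, mul_comm] at h
  exact (mul_right_cancel₀ (lamProd_ne_zero (det_mat_ne_zero g) S) h).symm

theorem orbit_count {G X : Type*} [Group G] [Fintype G] [MulAction G X] {Y : Set X}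
    (hY : Y.Finite) (hinv : ∀ (g : G), ∀ x ∈ Y, g • x ∈ Y) (bad : G → X → Prop)
    (hmul : ∀ x ∈ Y, ∀ g h : G, g • x = x → h • x = x → (bad (g * h) x ↔ (bad g x ↔ ¬ bad h x)))
    (hconj : ∀ x ∈ Y, ∀ g h : G, g • x = x → bad g x → bad (h * g * h⁻¹) (h • x)) :
    {A : Set X | ∃ x ∈ Y, (∃ g : G, g • x = x ∧ bad g x) ∧ A = MulAction.orbit G x}.ncard *
      Fintype.card G = 2 * ∑ g : G, {x ∈ Y | g • x = x ∧ bad g x}.ncard := by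
  set Y' : Finset X := hY.toFinset.filter fun x => ∃ g : G, g • x = x ∧ bad g x with hY'
  have hmemY' : ∀ x, x ∈ Y' ↔ x ∈ Y ∧ ∃ g : G, g • x = x ∧ bad g x := by
    intro x
    simp [hY']
  have hset : {A : Set X | ∃ x ∈ Y, (∃ g : G, g • x = x ∧ bad g x) ∧ A = MulAction.orbit G x} =
      (Y'.image fun x => MulAction.orbit G x : Finset (Set X)) := by
    ext A
    simp only [Set.mem_ofPred_eq, Finset.coe_image, Set.mem_image, Finset.mem_coe, hmemY']
    constructor
    · rintro ⟨x, h1, h2, rfl⟩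
      exact ⟨x, ⟨h1, h2⟩, rfl⟩
    · rintro ⟨x, ⟨h1, h2⟩, rfl⟩
      exact ⟨x, h1, h2, rfl⟩
  have hsmul : ∀ (h : G), ∀ x ∈ Y', h • x ∈ Y' := by
    intro h x hx
    rw [hmemY'] at hx ⊢
    obtain ⟨hx, g, hg, hb⟩ := hx
    refine ⟨hinv h x hx, h * g * h⁻¹, ?_, hconj x hx g h hg hb⟩
    rw [mul_smul, inv_smul_smul, mul_smul, hg]
  have hstab : ∀ x ∈ Y', (Finset.univ.filter fun g : G => g • x = x).card =
      2 * (Finset.univ.filter fun g : G => g • x = x ∧ bad g x).card := by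
    intro x hx
    obtain ⟨hxY, g₀, hg₀, hb₀⟩ := (hmemY' x).1 hx
    have hsplit : (Finset.univ.filter fun g : G => g • x = x).card =
        (Finset.univ.filter fun g : G => g • x = x ∧ bad g x).card +
        (Finset.univ.filter fun g : G => g • x = x ∧ ¬ bad g x).card := by
      rw [← Finset.filter_filter, ← Finset.filter_filter, Finset.card_filter_add_card_filter_not]
    rw [hsplit, two_mul]
    congr 1
    apply Finset.card_bij' (fun g _ => g * g₀) (fun g _ => g * g₀⁻¹)
    · intro g hg
      simp only [Finset.mem_filter, Finset.mem_univ, true_and] at hg ⊢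
      refine ⟨by rw [mul_smul, hg₀, hg.1], ?_⟩
      rw [hmul x hxY g g₀ hg.1 hg₀]
      tauto
    · intro g hg
      simp only [Finset.mem_filter, Finset.mem_univ, true_and] at hg ⊢
      have h1 : (g * g₀⁻¹) • x = x := by
        rw [mul_smul, inv_smul_eq_iff.2 hg₀.symm, hg.1]
      refine ⟨h1, ?_⟩
      have h2 := hmul x hxY (g * g₀⁻¹) g₀ h1 hg₀
      rw [inv_mul_cancel_right] at h2
      tauto
    · intro g _
      simp
    · intro g _
      simp
  have hdouble : ∑ g : G, {x ∈ Y | g • x = x ∧ bad g x}.ncard =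
      ∑ x ∈ Y', (Finset.univ.filter fun g : G => g • x = x ∧ bad g x).card := by
    have h1 : ∀ g : G, {x ∈ Y | g • x = x ∧ bad g x}.ncard =
        ∑ x ∈ Y', if g • x = x ∧ bad g x then 1 else 0 := by
      intro g
      rw [← Finset.card_filter, ← Set.ncard_coe_finset]
      congr 1
      ext x
      simp only [Set.mem_ofPred_eq, Finset.coe_filter, hmemY']
      constructor
      · exact fun h => ⟨⟨h.1, g, h.2⟩, h.2⟩
      · exact fun h => ⟨h.1.1, h.2⟩
    rw [Finset.sum_congr rfl fun g _ => h1 g, Finset.sum_comm]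
    exact Finset.sum_congr rfl fun x _ => (Finset.card_filter _ _).symm
  rw [hset, Set.ncard_coe_finset, hdouble, Finset.mul_sum,
    ← Finset.sum_congr rfl hstab, ← Finset.sum_fiberwise_of_maps_to
      (t := Y'.image fun x => MulAction.orbit G x) (g := fun x => MulAction.orbit G x)
      fun x hx => Finset.mem_image_of_mem _ hx, ← smul_eq_mul, ← Finset.sum_const]
  apply Finset.sum_congr rfl
  intro A hA
  obtain ⟨x₀, hx₀, rfl⟩ := Finset.mem_image.1 hA
  have hfib : ((Y'.filter fun x => MulAction.orbit G x = MulAction.orbit G x₀ : Finset X) : Set X) =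
      MulAction.orbit G x₀ := by
    ext x
    rw [Finset.coe_filter, Set.mem_ofPred_eq, MulAction.orbit_eq_iff]
    constructor
    · exact fun h => h.2
    · intro h
      refine ⟨?_, h⟩
      obtain ⟨g, rfl⟩ := h
      exact hsmul g x₀ hx₀
  have hcard : ∀ x ∈ Y'.filter fun x => MulAction.orbit G x = MulAction.orbit G x₀,
      (Y'.filter fun x => MulAction.orbit G x = MulAction.orbit G x₀).card *
        (Finset.univ.filter fun g : G => g • x = x).card = Fintype.card G := by
    intro x hx
    have hx' := (Finset.mem_filter.1 hx).2
    rw [← Set.ncard_coe_finset, hfib, ← hx', ← Nat.card_eq_fintype_card,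
      ← MulAction.index_stabilizer, ← Subgroup.index_mul_card (MulAction.stabilizer G x)]
    congr 1
    rw [Nat.card_eq_fintype_card, Fintype.card_subtype]
    rfl
  have hpos : 0 < (Y'.filter fun x => MulAction.orbit G x = MulAction.orbit G x₀).card :=
    Finset.card_pos.2 ⟨x₀, Finset.mem_filter.2 ⟨hx₀, rfl⟩⟩
  apply Nat.eq_of_mul_eq_mul_left hpos
  rw [Finset.mul_sum, Finset.sum_congr rfl hcard, Finset.sum_const, smul_eq_mul]

/-- The action of `GL₂(F)` on finite subsets of the projective line. -/
@[reducible]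
def glAction (F : Type) [Field F] :
    MulAction (GL (Fin 2) F) (Finset (Option (AlgebraicClosure F))) where
  smul γ S := S.image (mob (mat γ))
  one_smul S := by
    change S.image (mob (mat 1)) = S
    rw [mat_one, image_mob_one]
  mul_smul γ γ' S := image_mat_mul γ γ' S

/-- Rational `n`-sets fixed by `γ` with nonsquare multiplier. -/
def badSets (n : ℕ) (γ : GL (Fin 2) F) : Set (Finset (Option (AlgebraicClosure F))) :=
  {S ∈ stableSets (frobP1 F) n | S.image (mob (mat γ)) = S ∧ IsBad γ S}

theorem finite_fixed_frobP1 {i : ℕ} (hi : 0 < i) :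
    {t | (frobP1 F)^[i] t = t}.Finite := by
  have h1 : ∀ t : Option (AlgebraicClosure F),
      (frobP1 F)^[i] t = t.map fun x => x ^ Fintype.card F ^ i := by
    intro t
    clear hi
    induction i with
    | zero => cases t <;> simp
    | succ i ih =>
      rw [Function.iterate_succ_apply', ih]
      cases t <;> simp [frobP1, pow_succ, pow_mul]
  have h2 : {x : AlgebraicClosure F | x ^ Fintype.card F ^ i = x}.Finite := by
    have hcard : 1 < Fintype.card F ^ i := Nat.one_lt_pow hi.ne' Fintype.one_lt_card
    apply ((X ^ (Fintype.card F ^ i) - X : (AlgebraicClosure F)[X]).roots.toFinset.finite_toSet).subset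
    intro x hx
    rw [Finset.mem_coe, Multiset.mem_toFinset,
      mem_roots (FiniteField.X_pow_card_sub_X_ne_zero _ hcard)]
    simpa [sub_eq_zero] using hx
  apply ((h2.image some).insert none).subset
  intro t ht
  rw [Set.mem_ofPred_eq, h1] at ht
  cases t with
  | none => exact Set.mem_insert _ _
  | some x =>
    apply Set.mem_insert_of_mem
    exact ⟨x, by simpa using ht, rfl⟩

theorem finite_ratSets (n : ℕ) : (stableSets (frobP1 F) n).Finite :=
  finite_stableSets frobP1_injective (fun _ hi => finite_fixed_frobP1 hi) n

theorem image_mem_ratSets (γ : GL (Fin 2) F) {n : ℕ} {S : Finset (Option (AlgebraicClosure F))}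
    (hS : S ∈ stableSets (frobP1 F) n) : S.image (mob (mat γ)) ∈ stableSets (frobP1 F) n := by
  refine ⟨?_, ?_⟩
  · rw [Finset.card_image_of_injective _ (mob_injective (det_mat_ne_zero γ)), hS.1]
  · conv_rhs => rw [← hS.2]
    rw [Finset.image_image, Finset.image_image]
    exact Finset.image_congr fun t _ => (mob_frobP1 γ t).symm

theorem orbits_mul_card (hq : Odd (Fintype.card F)) {n : ℕ} (hn : Even n) :
    {A : Set (Finset (Option (AlgebraicClosure F))) |
        ∃ S : Finset (Option (AlgebraicClosure F)),
          S.card = n ∧ S.image (frobP1 F) = S ∧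
          (∃ γ : GL (Fin 2) F, S.image (moebius γ.val) = S ∧ ¬ IsSquareJ γ.val S) ∧
          A = orbitSet S}.ncard * Fintype.card (GL (Fin 2) F) =
      2 * ∑ γ : GL (Fin 2) F, (badSets n γ).ncard := by
  let _ := glAction F
  have h := orbit_count (finite_ratSets (F := F) n) (fun γ S hS => image_mem_ratSets γ hS)
    (fun (γ : GL (Fin 2) F) S => IsBad γ S)
    (fun S hS γ γ' _ hγ' => isBad_mul hq hS.2 hγ')
    (fun S _ γ g hγ hb => by
      unfold IsBad at hb ⊢
      rwa [← lamProd_conj g γ hγ] at hb)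
  refine Eq.trans ?_ h
  congr 2
  ext A
  simp only [Set.mem_ofPred_eq]
  have horb : ∀ S : Finset (Option (AlgebraicClosure F)),
      orbitSet S = MulAction.orbit (GL (Fin 2) F) S := by
    intro S
    ext T
    simp only [orbitSet, Set.mem_ofPred_eq, MulAction.mem_orbit_iff, moebius_eq_mob]
    exact exists_congr fun γ => eq_comm
  constructor
  · rintro ⟨S, h1, h2, ⟨γ, h3, h4⟩, rfl⟩
    refine ⟨S, ⟨h1, h2⟩, ⟨γ, ?_, (isSquareJ_iff hq (h1 ▸ hn) h3).1 h4⟩, horb S⟩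
    rw [moebius_eq_mob] at h3
    exact h3
  · rintro ⟨S, ⟨h1, h2⟩, ⟨γ, h3, h4⟩, rfl⟩
    have h3' : S.image (moebius γ.val) = S := by
      rw [moebius_eq_mob]
      exact h3
    exact ⟨S, h1, h2, ⟨γ, h3', (isSquareJ_iff hq (h1 ▸ hn) h3').2 h4⟩, (horb S).symm⟩

theorem ncard_badSets_conj (n : ℕ) (g γ : GL (Fin 2) F) :
    (badSets n (g * γ * g⁻¹)).ncard = (badSets n γ).ncard := by
  symm
  have hinj : Function.Injective fun S : Finset (Option (AlgebraicClosure F)) =>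
      S.image (mob (mat g)) := Finset.image_injective (mob_injective (det_mat_ne_zero g))
  apply Set.ncard_congr fun S _ => S.image (mob (mat g))
  · rintro S ⟨hS, hγ, hb⟩
    refine ⟨image_mem_ratSets g hS, ?_, ?_⟩
    · rw [← image_mat_mul, inv_mul_cancel_right, image_mat_mul, hγ]
    · unfold IsBad at hb ⊢
      rwa [lamProd_conj g γ hγ]
  · intro S T _ _ h
    exact hinj h
  · rintro T ⟨hT, hγ, hb⟩
    have hT' : (T.image (mob (mat g⁻¹))).image (mob (mat g)) = T := by
      rw [← image_mat_mul, mul_inv_cancel, mat_one, image_mob_one]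
    have hγ' : (T.image (mob (mat g⁻¹))).image (mob (mat γ)) = T.image (mob (mat g⁻¹)) := by
      apply hinj
      change Finset.image _ _ = Finset.image _ _
      rw [hT', ← image_mat_mul, ← image_mat_mul]
      exact hγ
    refine ⟨T.image (mob (mat g⁻¹)), ⟨image_mem_ratSets _ hT, hγ', ?_⟩, hT'⟩
    unfold IsBad at hb ⊢
    rwa [← lamProd_conj g γ hγ', hT']

end OrbitCount

section ConjugacyCount

theorem sum_conj {G : Type*} [Group G] [Fintype G] [DecidableEq G] {f : G → ℕ}
    (hf : ∀ g x : G, f (g * x * g⁻¹) = f x) {C T : Finset G} {N : ℕ} (hTC : T ⊆ C)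
    (hC : ∀ g x : G, x ∈ C → g * x * g⁻¹ ∈ C)
    (hCT : ∀ x ∈ C, ∃ g : G, g * x * g⁻¹ ∈ T)
    (hN : ∀ x ∈ T, (Finset.univ.filter fun g : G => g * x * g⁻¹ ∈ T).card = N) :
    N * ∑ x ∈ C, f x = Fintype.card G * ∑ x ∈ T, f x := by
  have hN' : ∀ x ∈ C, (Finset.univ.filter fun g : G => g * x * g⁻¹ ∈ T).card = N := by
    intro x hx
    obtain ⟨g₀, hg₀⟩ := hCT x hx
    rw [← hN _ hg₀]
    apply Finset.card_bij' (fun g _ => g * g₀⁻¹) (fun g _ => g * g₀)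
    · intro g hg
      simpa [mul_assoc] using hg
    · intro g hg
      simpa [mul_assoc] using hg
    · intro g _
      simp
    · intro g _
      simp
  have h1 : N * ∑ x ∈ C, f x = ∑ x ∈ C, ∑ g : G, if g * x * g⁻¹ ∈ T then f x else 0 := by
    rw [Finset.mul_sum]
    apply Finset.sum_congr rfl
    intro x hx
    rw [← hN' x hx, ← Finset.sum_filter, Finset.sum_const, smul_eq_mul]
  rw [h1, Finset.sum_comm, ← Finset.card_univ, ← smul_eq_mul, ← Finset.sum_const]
  apply Finset.sum_congr rfl
  intro g _
  rw [← Finset.sum_filter]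
  symm
  apply Finset.sum_bij' (fun x _ => g⁻¹ * x * g) (fun x _ => g * x * g⁻¹)
  · intro x hx
    have h := hC g⁻¹ x (hTC hx)
    rw [inv_inv] at h
    simpa [mul_assoc, hx] using h
  · intro x hx
    exact (Finset.mem_filter.1 hx).2
  · intro x _
    simp [mul_assoc]
  · intro x _
    simp [mul_assoc]
  · intro x _
    have h := hf g⁻¹ x
    rw [inv_inv] at h
    exact h.symm

/-- The torus of matrices `(a, bδ; b, a)`. -/
def torus (δ : F) : Finset (GL (Fin 2) F) :=
  Finset.univ.filter fun γ => γ.val 0 0 = γ.val 1 1 ∧ γ.val 0 1 = δ * γ.val 1 0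

/-- The nonscalar elements of the torus. -/
def regTorus (δ : F) : Finset (GL (Fin 2) F) :=
  (torus δ).filter fun γ => γ.val 1 0 ≠ 0

/-- The matrices whose discriminant is `δ` times a nonzero square. -/
def discClass (δ : F) : Finset (GL (Fin 2) F) :=
  Finset.univ.filter fun γ => ∃ b : F, b ≠ 0 ∧ γ.val.trace ^ 2 - 4 * γ.val.det = 4 * (δ * b ^ 2)

theorem mem_torus {δ : F} {γ : GL (Fin 2) F} :
    γ ∈ torus δ ↔ γ.val 0 0 = γ.val 1 1 ∧ γ.val 0 1 = δ * γ.val 1 0 := by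
  simp [torus]

theorem mem_regTorus {δ : F} {γ : GL (Fin 2) F} :
    γ ∈ regTorus δ ↔
      (γ.val 0 0 = γ.val 1 1 ∧ γ.val 0 1 = δ * γ.val 1 0) ∧ γ.val 1 0 ≠ 0 := by
  simp [regTorus, mem_torus]

theorem mem_discClass {δ : F} {γ : GL (Fin 2) F} :
    γ ∈ discClass δ ↔
      ∃ b : F, b ≠ 0 ∧ γ.val.trace ^ 2 - 4 * γ.val.det = 4 * (δ * b ^ 2) := by
  simp [discClass]

theorem regTorus_subset_discClass (δ : F) : regTorus δ ⊆ discClass δ := by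
  intro γ hγ
  obtain ⟨⟨h1, h2⟩, h3⟩ := mem_regTorus.1 hγ
  refine mem_discClass.2 ⟨_, h3, ?_⟩
  rw [Matrix.trace_fin_two, Matrix.det_fin_two, h1, h2]
  ring

omit [Fintype F] in
theorem trace_conj (g γ : GL (Fin 2) F) : (g * γ * g⁻¹).val.trace = γ.val.trace := by
  rw [Units.val_mul, Matrix.trace_mul_comm, ← Units.val_mul, inv_mul_cancel_left]

omit [Fintype F] in
theorem det_conj (g γ : GL (Fin 2) F) : (g * γ * g⁻¹).val.det = γ.val.det := by
  rw [Units.val_mul, Matrix.det_mul_comm, ← Units.val_mul, inv_mul_cancel_left]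

theorem conj_mem_discClass {δ : F} (g γ : GL (Fin 2) F) (h : γ ∈ discClass δ) :
    g * γ * g⁻¹ ∈ discClass δ := by
  rw [mem_discClass] at h ⊢
  rwa [trace_conj, det_conj]

theorem two_ne_zero_of_odd (hq : Odd (Fintype.card F)) : (2 : F) ≠ 0 := by
  apply Ring.two_ne_zero
  intro h
  rw [FiniteField.even_card_iff_char_two] at h
  obtain ⟨r, hr⟩ := hq
  omega

theorem exists_conj_mem_regTorus_of_cyclic {δ b : F} (hb : b ≠ 0) (h2 : (2 : F) ≠ 0)
    {γ : GL (Fin 2) F} (h : γ.val.trace ^ 2 - 4 * γ.val.det = 4 * (δ * b ^ 2)) {u v : F}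
    (hdet : u * (γ.val 1 0 * u - (γ.val 0 0 - γ.val 1 1) / 2 * v) -
      v * ((γ.val 0 0 - γ.val 1 1) / 2 * u + γ.val 0 1 * v) ≠ 0) :
    ∃ g : GL (Fin 2) F, g * γ * g⁻¹ ∈ regTorus δ := by
  rw [Matrix.trace_fin_two, Matrix.det_fin_two] at h
  set p := γ.val 0 0
  set r := γ.val 0 1
  set s := γ.val 1 0
  set t := γ.val 1 1
  have hdisc : ((p - t) / 2) ^ 2 + r * s = δ * b ^ 2 := by
    have h4 : (4 : F) ≠ 0 := by
      rw [show (4 : F) = 2 * 2 by norm_num]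
      exact mul_ne_zero h2 h2
    apply mul_left_cancel₀ h4
    field_simp
    linear_combination h
  set x := (p - t) / 2
  set P : Matrix (Fin 2) (Fin 2) F := !![u, (x * u + r * v) / b; v, (s * u - x * v) / b] with hP
  have hPdet : P.det ≠ 0 := by
    have : P.det = (u * (s * u - x * v) - v * (x * u + r * v)) / b := by
      rw [hP, Matrix.det_fin_two_of]
      ring
    rw [this]
    exact div_ne_zero hdet hb
  set g := Matrix.GeneralLinearGroup.mkOfDetNeZero P hPdet with hg
  have hgP : g.val = P := rfl
  have hp : p = (p + t) / 2 + x := by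
    simp only [x]
    field_simp
    ring
  have ht : t = (p + t) / 2 - x := by
    simp only [x]
    field_simp
    ring
  have hmul : γ.val * P = P * !![(p + t) / 2, δ * b; b, (p + t) / 2] := by
    have hγ : γ.val = !![p, r; s, t] := Matrix.eta_fin_two _
    have hy : (x * u + r * v) / b * b = x * u + r * v := div_mul_cancel₀ _ hb
    have hz : (s * u - x * v) / b * b = s * u - x * v := div_mul_cancel₀ _ hb
    rw [hγ, hP]
    set y := (x * u + r * v) / b
    set z := (s * u - x * v) / b
    set a := (p + t) / 2
    ext i j
    fin_cases i <;> fin_cases j <;> simp [Matrix.mul_apply, Fin.sum_univ_two]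
    · linear_combination u * hp - hy
    · apply mul_right_cancel₀ hb
      linear_combination b * y * hp + x * hy + r * hz + u * hdisc
    · linear_combination v * ht - hz
    · apply mul_right_cancel₀ hb
      linear_combination b * z * ht + s * hy - x * hz + v * hdisc
  refine ⟨g⁻¹, ?_⟩
  have hval : (g⁻¹ * γ * g⁻¹⁻¹).val = !![(p + t) / 2, δ * b; b, (p + t) / 2] := by
    rw [inv_inv, mul_assoc, Units.val_mul, Units.val_mul, hgP, hmul, ← hgP, ← mul_assoc,
      ← Units.val_mul, inv_mul_cancel, Units.val_one, one_mul]
  rw [mem_regTorus, hval]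
  simp [hb]

theorem exists_conj_mem_regTorus {δ : F} (hδ : δ ≠ 0) (h2 : (2 : F) ≠ 0) {γ : GL (Fin 2) F}
    (h : γ ∈ discClass δ) : ∃ g : GL (Fin 2) F, g * γ * g⁻¹ ∈ regTorus δ := by
  obtain ⟨b, hb, h⟩ := mem_discClass.1 h
  by_cases hs : γ.val 1 0 = 0
  · by_cases hr : γ.val 0 1 = 0
    · refine exists_conj_mem_regTorus_of_cyclic (u := 1) (v := 1) hb h2 h ?_
      intro h0
      rw [Matrix.trace_fin_two, Matrix.det_fin_two, hr, hs] at h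
      rw [hr, hs] at h0
      have h4 : 4 * (δ * b ^ 2) ≠ 0 := by
        rw [show (4 : F) = 2 * 2 by norm_num]
        exact mul_ne_zero (mul_ne_zero h2 h2) (mul_ne_zero hδ (pow_ne_zero 2 hb))
      apply h4
      rw [← h]
      field_simp at h0
      have h0' : γ.val 0 0 = γ.val 1 1 := mul_left_cancel₀ h2 (by linear_combination -h0)
      rw [h0']
      ring
    · refine exists_conj_mem_regTorus_of_cyclic (u := 0) (v := 1) hb h2 h ?_
      simpa using hr
  · refine exists_conj_mem_regTorus_of_cyclic (u := 1) (v := 0) hb h2 h ?_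
    simpa using hs

/-- The nontrivial element normalising every torus. -/
def reflGL (F : Type) [Field F] : GL (Fin 2) F :=
  Matrix.GeneralLinearGroup.mkOfDetNeZero !![1, 0; 0, -1] (by simp [Matrix.det_fin_two])

theorem torus_comm {δ : F} {g τ : GL (Fin 2) F} (hg : g ∈ torus δ) (hτ : τ ∈ torus δ) :
    g * τ * g⁻¹ = τ := by
  obtain ⟨h1, h2⟩ := mem_torus.1 hg
  obtain ⟨h3, h4⟩ := mem_torus.1 hτ
  rw [mul_inv_eq_iff_eq_mul, Units.ext_iff, Units.val_mul, Units.val_mul]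
  ext i j
  fin_cases i <;> fin_cases j <;> simp [Matrix.mul_apply, Fin.sum_univ_two, h1, h2, h3, h4] <;> ring

theorem reflGL_conj_mem_regTorus {δ : F} {τ : GL (Fin 2) F} (hτ : τ ∈ regTorus δ) :
    (reflGL F)⁻¹ * τ * reflGL F ∈ regTorus δ := by
  have hinv : (reflGL F)⁻¹ = reflGL F := by
    rw [inv_eq_iff_mul_eq_one, Units.ext_iff]
    ext i j
    fin_cases i <;> fin_cases j <;> simp [reflGL, Matrix.mul_apply, Fin.sum_univ_two]
  rw [hinv]
  rw [mem_regTorus] at hτ ⊢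
  simpa [reflGL, Matrix.mul_apply, Fin.sum_univ_two, Matrix.vecMul, dotProduct] using hτ

theorem conj_mem_regTorus_iff {δ : F} (hδ : δ ≠ 0) (h2 : (2 : F) ≠ 0) {τ : GL (Fin 2) F}
    (hτ : τ ∈ regTorus δ) (g : GL (Fin 2) F) :
    g * τ * g⁻¹ ∈ regTorus δ ↔ g ∈ torus δ ∨ g * reflGL F ∈ torus δ := by
  constructor
  · intro h
    obtain ⟨⟨h1, h3⟩, hb⟩ := mem_regTorus.1 hτ
    obtain ⟨⟨h1', h3'⟩, -⟩ := mem_regTorus.1 h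
    have htr := trace_conj g τ
    have hdet := det_conj g τ
    have hmul : g.val * τ.val = (g * τ * g⁻¹).val * g.val := by
      rw [← Units.val_mul, ← Units.val_mul, inv_mul_cancel_right]
    have e00 := congrFun (congrFun hmul 0) 0
    have e10 := congrFun (congrFun hmul 1) 0
    rw [Matrix.trace_fin_two, Matrix.trace_fin_two, h1, h1', ← two_mul, ← two_mul] at htr
    have ha := mul_left_cancel₀ h2 htr
    rw [Matrix.det_fin_two, Matrix.det_fin_two, h1, h1', h3, h3', ha] at hdet
    have hsq : (g * τ * g⁻¹).val 1 0 ^ 2 = τ.val 1 0 ^ 2 :=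
      mul_left_cancel₀ hδ (by linear_combination -hdet)
    simp only [Matrix.mul_apply, Fin.sum_univ_two, h1, h3', h1', ha] at e00 e10
    rw [mem_torus, mem_torus]
    rcases sq_eq_sq_iff_eq_or_eq_neg.1 hsq with hbb | hbb <;> rw [hbb] at e00 e10
    · left
      constructor
      · apply mul_right_cancel₀ hb
        linear_combination -e10
      · apply mul_right_cancel₀ hb
        linear_combination e00
    · right
      simp only [reflGL, Matrix.GeneralLinearGroup.mkOfDetNeZero, Units.val_mul, Matrix.mul_apply,
        Fin.sum_univ_two]
      simp
      constructor
      · apply mul_right_cancel₀ hb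
        linear_combination e10
      · apply mul_right_cancel₀ hb
        linear_combination -e00
  · rintro (h | h)
    · rwa [torus_comm h (Finset.mem_filter.1 hτ).1]
    · have h3 := reflGL_conj_mem_regTorus hτ
      have h4 := torus_comm h (Finset.mem_filter.1 h3).1
      rw [← h4] at h3
      simpa [mul_assoc] using h3

theorem card_conj_regTorus {δ : F} (hδ : δ ≠ 0) (h2 : (2 : F) ≠ 0) {τ : GL (Fin 2) F}
    (hτ : τ ∈ regTorus δ) :
    (Finset.univ.filter fun g : GL (Fin 2) F => g * τ * g⁻¹ ∈ regTorus δ).card =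
      2 * (torus δ).card := by
  rw [Finset.filter_congr fun g _ => conj_mem_regTorus_iff hδ h2 hτ g, Finset.filter_or,
    Finset.card_union_of_disjoint, two_mul]
  · congr 1
    · rw [Finset.filter_mem_eq_inter, Finset.univ_inter]
    · apply Finset.card_bij' (fun g _ => g * reflGL F) (fun g _ => g * (reflGL F)⁻¹)
      · intro g hg
        exact (Finset.mem_filter.1 hg).2
      · intro g hg
        simpa using hg
      · intro g _
        simp
      · intro g _
        simp
  · rw [Finset.disjoint_left]
    intro g hg hg'
    have h1 := mem_torus.1 (Finset.mem_filter.1 hg).2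
    have h3 := mem_torus.1 (Finset.mem_filter.1 hg').2
    simp [reflGL, Matrix.mul_apply, Fin.sum_univ_two] at h3
    have h11 : g.val 1 1 = 0 := mul_left_cancel₀ h2 (by linear_combination h3.1 - h1.1)
    have h01 : g.val 0 1 = 0 := mul_left_cancel₀ h2 (by linear_combination h1.2 - h3.2)
    apply g.det.ne_zero
    change g.val.det = 0
    rw [Matrix.det_fin_two, h11, h01]
    ring

theorem sum_discClass {δ : F} (hδ : δ ≠ 0) (h2 : (2 : F) ≠ 0) {f : GL (Fin 2) F → ℕ}
    (hf : ∀ g x : GL (Fin 2) F, f (g * x * g⁻¹) = f x) :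
    2 * (torus δ).card * ∑ x ∈ discClass δ, f x =
      Fintype.card (GL (Fin 2) F) * ∑ x ∈ regTorus δ, f x :=
  sum_conj hf (regTorus_subset_discClass δ) conj_mem_discClass
    (fun _ hx => exists_conj_mem_regTorus hδ h2 hx) fun _ hx => card_conj_regTorus hδ h2 hx

end ConjugacyCount

section DiscriminantTypes

theorem pow_succ_of_sq_zero {R : Type*} [CommRing R] {M N : Matrix (Fin 2) (Fin 2) R} {a : R}
    (hM : M = a • 1 + N) (hN : N * N = 0) (k : ℕ) :
    M ^ (k + 1) = a ^ (k + 1) • 1 + (((k + 1 : ℕ) : R) * a ^ k) • N := by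
  induction k with
  | zero => simp [hM]
  | succ k ih =>
    rw [pow_succ, ih, hM, add_mul, mul_add, mul_add, Matrix.smul_mul, Matrix.smul_mul,
      Matrix.smul_mul, Matrix.smul_mul, Matrix.one_mul, Matrix.one_mul, hN, Matrix.mul_smul,
      Matrix.mul_one, smul_smul, smul_smul, smul_zero, add_zero, add_assoc, ← add_smul]
    congr 2 <;> push_cast <;> ring

theorem badSets_eq_empty (hq : Odd (Fintype.card F)) {n : ℕ} (hn : Even n) {γ : GL (Fin 2) F}
    (hγ : γ.val.trace ^ 2 - 4 * γ.val.det = 0) : badSets n γ = ∅ := by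
  have h2 := two_ne_zero_of_odd hq
  rw [Matrix.trace_fin_two, Matrix.det_fin_two] at hγ
  set a := (γ.val 0 0 + γ.val 1 1) / 2 with ha
  have ha2 : 2 * a = γ.val 0 0 + γ.val 1 1 := mul_div_cancel₀ _ h2
  have h4 : (4 : F) ≠ 0 := by
    rw [show (4 : F) = 2 * 2 by norm_num]
    exact mul_ne_zero h2 h2
  have hdet : γ.val.det = a ^ 2 := by
    rw [Matrix.det_fin_two]
    apply mul_left_cancel₀ h4
    linear_combination -hγ + (-(γ.val 0 0 + γ.val 1 1) - 2 * a) * ha2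
  have ha0 : a ≠ 0 := by
    intro h
    rw [h, zero_pow two_ne_zero] at hdet
    exact γ.det.ne_zero hdet
  set N := γ.val - a • 1 with hN
  have hNN : N * N = 0 := by
    rw [Matrix.det_fin_two] at hdet
    ext i j
    fin_cases i <;> fin_cases j <;> simp [hN, Matrix.mul_apply, Fin.sum_univ_two]
    · linear_combination -hdet - γ.val 0 0 * ha2
    · linear_combination -γ.val 0 1 * ha2
    · linear_combination -γ.val 1 0 * ha2
    · linear_combination -hdet - γ.val 1 1 * ha2
  obtain ⟨r, hr⟩ := hq
  have hpow : γ.val ^ Fintype.card F = a • 1 := by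
    have h := pow_succ_of_sq_zero (M := γ.val) (a := a) (by rw [hN, add_sub_cancel]) hNN (2 * r)
    rw [← hr, FiniteField.cast_card_eq_zero, zero_mul, zero_smul, add_zero, FiniteField.pow_card] at h
    exact h
  have hmat : mat γ ^ Fintype.card F = em F a • 1 := by
    have h := congrArg (fun M : Matrix (Fin 2) (Fin 2) F => M.map (em F)) hpow
    simp only [Matrix.map_pow] at h
    rw [mat, h]
    ext i j
    fin_cases i <;> fin_cases j <;> simp
  rw [Set.eq_empty_iff_forall_notMem]
  rintro S ⟨hS, hγS, hb⟩
  apply hb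
  have h1 := (lamProd_pow (det_mat_ne_zero γ) hγS (Fintype.card F)).2
  rw [lamProd_pow_card hS.2, hmat, lamProd_scalar ((map_ne_zero_iff _ em_injective).2 ha0), hS.1] at h1
  obtain ⟨s, hs⟩ := hn
  rw [← h1, ← exists_square_iff ⟨r, hr⟩]
  exact ⟨a ^ s, pow_ne_zero _ ha0, by rw [hs, ← pow_add, map_pow]⟩

theorem exists_nonsquare_split (hq : Odd (Fintype.card F)) :
    ∃ δ : F, ¬ IsSquare δ ∧ ∀ d : F, ¬ IsSquare d → ∃ s, d = δ * s ^ 2 := by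
  obtain ⟨δ, hδ⟩ := FiniteField.exists_nonsquare (F := F) (by
    intro h
    rw [FiniteField.even_card_iff_char_two] at h
    obtain ⟨r, hr⟩ := hq
    omega)
  refine ⟨δ, hδ, fun d hd => ?_⟩
  have hchar : ringChar F ≠ 2 := by
    intro h
    rw [FiniteField.even_card_iff_char_two] at h
    obtain ⟨r, hr⟩ := hq
    omega
  have hδ0 : δ ≠ 0 := by
    rintro rfl
    exact hδ IsSquare.zero
  have hd0 : d ≠ 0 := by
    rintro rfl
    exact hd IsSquare.zero
  have hsq : IsSquare (d / δ) := by
    rw [← quadraticChar_one_iff_isSquare (div_ne_zero hd0 hδ0)]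
    have h1 := quadraticChar_neg_one_iff_not_isSquare.2 hδ
    have h2 := quadraticChar_neg_one_iff_not_isSquare.2 hd
    have h3 : quadraticChar F (d / δ * δ) = quadraticChar F d := by rw [div_mul_cancel₀ _ hδ0]
    rw [map_mul, h1, h2] at h3
    linarith
  obtain ⟨s, hs⟩ := hsq
  refine ⟨s, ?_⟩
  rw [sq, ← hs, mul_div_cancel₀ _ hδ0]

theorem sum_split {δ : F} (hq : Odd (Fintype.card F)) (hδ : ¬ IsSquare δ)
    (hδ' : ∀ d : F, ¬ IsSquare d → ∃ s, d = δ * s ^ 2) {f : GL (Fin 2) F → ℕ}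
    (hf : ∀ γ, γ.val.trace ^ 2 - 4 * γ.val.det = 0 → f γ = 0) :
    ∑ γ, f γ = ∑ γ ∈ discClass 1, f γ + ∑ γ ∈ discClass δ, f γ := by
  have h2 := two_ne_zero_of_odd hq
  have h4 : (4 : F) ≠ 0 := by
    rw [show (4 : F) = 2 * 2 by norm_num]
    exact mul_ne_zero h2 h2
  rw [← Finset.sum_union]
  · symm
    apply Finset.sum_subset (Finset.subset_univ _)
    intro γ _ hγ
    apply hf
    by_contra hd
    apply hγ
    rw [Finset.mem_union, mem_discClass, mem_discClass]
    by_cases hsq : IsSquare (γ.val.trace ^ 2 - 4 * γ.val.det)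
    · left
      obtain ⟨s, hs⟩ := hsq
      refine ⟨s / 2, div_ne_zero ?_ h2, ?_⟩
      · rintro rfl
        exact hd (hs.trans (mul_zero 0))
      · rw [hs]
        field_simp
        ring
    · right
      obtain ⟨s, hs⟩ := hδ' _ hsq
      refine ⟨s / 2, div_ne_zero ?_ h2, ?_⟩
      · rintro rfl
        exact hd (by rw [hs]; ring)
      · rw [hs]
        field_simp
        ring
  · rw [Finset.disjoint_left]
    intro γ h h'
    obtain ⟨b, hb, e⟩ := mem_discClass.1 h
    obtain ⟨c, hc, e'⟩ := mem_discClass.1 h'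
    rw [e] at e'
    have e2 := mul_left_cancel₀ h4 e'
    apply hδ
    refine ⟨b / c, ?_⟩
    field_simp
    linear_combination -e2

end DiscriminantTypes

section Diagonalization

theorem image_eq_iff_of_semiconj {X Y : Type*} [DecidableEq X] [DecidableEq Y] {Q : X → Y}
    (hQ : Q.Injective) {f : X → X} {f' : Y → Y} (h : ∀ x, Q (f x) = f' (Q x)) (S : Finset X) :
    (S.image Q).image f' = S.image Q ↔ S.image f = S := by
  have h1 : (S.image Q).image f' = (S.image f).image Q := by
    rw [Finset.image_image, Finset.image_image]
    exact Finset.image_congr fun x _ => (h x).symm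
  rw [h1]
  exact (Finset.image_injective hQ).eq_iff

/-- The matrix by which the Frobenius is twisted in diagonalising coordinates. -/
def twistMat (F : Type) [Field F] (e : ℤ) : Matrix (Fin 2) (Fin 2) (AlgebraicClosure F) :=
  if e = 1 then 1 else !![0, 1; 1, 0]

/-- The Frobenius in diagonalising coordinates: `z ↦ z ^ (e * q)`. -/
def twist (F : Type) [Field F] [Fintype F] (e : ℤ) (t : Option (AlgebraicClosure F)) :
    Option (AlgebraicClosure F) :=
  mob (twistMat F e) (frobP1 F t)

/-- The sets corresponding to bad sets in diagonalising coordinates. -/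
def diagSets (F : Type) [Field F] [Fintype F] (e : ℤ) (α β : AlgebraicClosure F) (n : ℕ) :
    Set (Finset (Option (AlgebraicClosure F))) :=
  {R | R.card = n ∧ R.image (twist F e) = R ∧ R.image (mob (Matrix.diagonal ![α, β])) = R ∧
    lamProd (Matrix.diagonal ![α, β]) R ^ ((Fintype.card F - 1) / 2) ≠ 1}

/-- The diagonalising matrix. -/
def diagMat (θ : AlgebraicClosure F) : Matrix (Fin 2) (Fin 2) (AlgebraicClosure F) :=
  !![1, θ; 1, -θ]

theorem two_ne_zero_closure (hq : Odd (Fintype.card F)) : (2 : AlgebraicClosure F) ≠ 0 := by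
  have h := (map_ne_zero_iff (em F) em_injective).2 (two_ne_zero_of_odd hq)
  rwa [map_ofNat] at h

theorem diagMat_det_ne_zero (hq : Odd (Fintype.card F)) {θ : AlgebraicClosure F} (hθ : θ ≠ 0) :
    (diagMat θ).det ≠ 0 := by
  have h : (diagMat θ).det = -(2 * θ) := by
    rw [diagMat, Matrix.det_fin_two_of]
    ring
  rw [h]
  exact neg_ne_zero.2 (mul_ne_zero (two_ne_zero_closure hq) hθ)

theorem mob_diagMat_frobP1 (hq : Odd (Fintype.card F)) {e : ℤ} (he : e = 1 ∨ e = -1)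
    {θ : AlgebraicClosure F} (hθ : θ ≠ 0) (hθq : θ ^ Fintype.card F = e * θ)
    (t : Option (AlgebraicClosure F)) :
    mob (diagMat θ) (frobP1 F t) = twist F e (mob (diagMat θ) t) := by
  have hmap : (diagMat θ).map (frobK F) = twistMat F e * diagMat θ := by
    rcases he with rfl | rfl
    · rw [twistMat, if_pos rfl, Matrix.one_mul]
      ext i j
      fin_cases i <;> fin_cases j <;> simp [diagMat, frobK_apply, hθq, map_neg]
    · rw [twistMat, if_neg (by norm_num)]
      ext i j
      fin_cases i <;> fin_cases j <;>
        simp [diagMat, frobK_apply, hθq, map_neg, Matrix.mul_apply, Fin.sum_univ_two]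
  have hW : twistMat F e * twistMat F e = 1 := by
    rcases he with rfl | rfl
    · rw [twistMat, if_pos rfl, Matrix.one_mul]
    · rw [twistMat, if_neg (by norm_num), Matrix.mul_fin_two, Matrix.one_fin_two]
      simp
  have hWdet : (twistMat F e).det ≠ 0 := by
    intro h
    have := congrArg Matrix.det hW
    rw [Matrix.det_mul, h, zero_mul, Matrix.det_one] at this
    exact zero_ne_one this
  have hQ := diagMat_det_ne_zero hq hθ
  rw [twist, frobP1_eq (mob (diagMat θ) t), ← mob_map, hmap, ← frobP1_eq,
    ← (mob_lam_mul hWdet (by rw [Matrix.det_mul]; exact mul_ne_zero hWdet hQ) _).1,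
    ← Matrix.mul_assoc, hW, Matrix.one_mul]

theorem diagMat_mul_mat {δ : F} {θ : AlgebraicClosure F} (hθ2 : θ ^ 2 = em F δ) {τ : GL (Fin 2) F}
    (hτ : τ ∈ torus δ) :
    diagMat θ * mat τ = Matrix.diagonal ![em F (τ.val 0 0) + em F (τ.val 1 0) * θ,
      em F (τ.val 0 0) - em F (τ.val 1 0) * θ] * diagMat θ := by
  obtain ⟨h1, h2⟩ := mem_torus.1 hτ
  ext i j
  fin_cases i <;> fin_cases j <;>
    simp [diagMat, mat, Matrix.mul_apply, Fin.sum_univ_two, ← h1, h2, ← hθ2] <;> ring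

theorem diag_ne_zero {δ : F} {θ : AlgebraicClosure F} (hθ2 : θ ^ 2 = em F δ) {τ : GL (Fin 2) F}
    (hτ : τ ∈ torus δ) :
    em F (τ.val 0 0) + em F (τ.val 1 0) * θ ≠ 0 ∧ em F (τ.val 0 0) - em F (τ.val 1 0) * θ ≠ 0 := by
  obtain ⟨h1, h2⟩ := mem_torus.1 hτ
  have hdet : em F τ.val.det ≠ 0 := (map_ne_zero_iff _ em_injective).2 τ.det.ne_zero
  have h : em F τ.val.det = (em F (τ.val 0 0) + em F (τ.val 1 0) * θ) *
      (em F (τ.val 0 0) - em F (τ.val 1 0) * θ) := by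
    rw [Matrix.det_fin_two, ← h1, h2, map_sub, map_mul, map_mul, map_mul, ← hθ2]
    ring
  rw [h] at hdet
  exact mul_ne_zero_iff.1 hdet

theorem diagSets_eq_image (hq : Odd (Fintype.card F)) {e : ℤ} (he : e = 1 ∨ e = -1) {δ : F}
    {θ : AlgebraicClosure F} (hθ : θ ≠ 0) (hθ2 : θ ^ 2 = em F δ)
    (hθq : θ ^ Fintype.card F = e * θ) {τ : GL (Fin 2) F} (hτ : τ ∈ torus δ) (n : ℕ) :
    diagSets F e (em F (τ.val 0 0) + em F (τ.val 1 0) * θ)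
      (em F (τ.val 0 0) - em F (τ.val 1 0) * θ) n =
    (fun S : Finset (Option (AlgebraicClosure F)) => S.image (mob (diagMat θ))) '' badSets n τ := by
  have hQ := diagMat_det_ne_zero hq hθ
  have hQinj := mob_injective hQ
  have hmul := diagMat_mul_mat hθ2 hτ
  have hne := diag_ne_zero hθ2 hτ
  set α := em F (τ.val 0 0) + em F (τ.val 1 0) * θ
  set β := em F (τ.val 0 0) - em F (τ.val 1 0) * θ
  have hD : (Matrix.diagonal ![α, β]).det ≠ 0 := by
    rw [Matrix.det_diagonal, Fin.prod_univ_two]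
    exact mul_ne_zero hne.1 hne.2
  have hsemi : ∀ t, mob (diagMat θ) (mob (mat τ) t) =
      mob (Matrix.diagonal ![α, β]) (mob (diagMat θ) t) := by
    intro t
    rw [← (mob_lam_mul hQ (det_mat_ne_zero τ) t).1, hmul, (mob_lam_mul hD hQ t).1]
  have key : ∀ S : Finset (Option (AlgebraicClosure F)),
      S.image (mob (diagMat θ)) ∈ diagSets F e α β n ↔ S ∈ badSets n τ := by
    intro S
    simp only [diagSets, badSets, stableSets, Set.mem_ofPred_eq]
    rw [Finset.card_image_of_injective _ hQinj,
      image_eq_iff_of_semiconj hQinj (mob_diagMat_frobP1 hq he hθ hθq),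
      image_eq_iff_of_semiconj hQinj hsemi, and_assoc]
    refine and_congr_right fun _ => and_congr_right fun _ => and_congr_right fun hτS => ?_
    have h1 := lamProd_mul hQ (det_mat_ne_zero τ) S
    rw [hmul, lamProd_mul hD hQ, hτS, mul_comm] at h1
    rw [mul_left_cancel₀ (lamProd_ne_zero hQ S) h1]
    rfl
  have hsurj : ∀ R : Finset (Option (AlgebraicClosure F)),
      ∃ S : Finset (Option (AlgebraicClosure F)), S.image (mob (diagMat θ)) = R := by
    intro R
    have h0 : IsUnit (diagMat θ).det := isUnit_iff_ne_zero.2 hQ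
    have h : ((diagMat θ)⁻¹).det ≠ 0 := by
      rw [Matrix.det_nonsing_inv]
      exact h0.ringInverse.ne_zero
    exact ⟨R.image (mob (diagMat θ)⁻¹), by
      rw [← image_mob_mul hQ h, Matrix.mul_nonsing_inv _ h0, image_mob_one]⟩
  ext R
  constructor
  · intro hR
    obtain ⟨S, rfl⟩ := hsurj R
    exact ⟨S, (key S).1 hR, rfl⟩
  · rintro ⟨S, hS, rfl⟩
    exact (key S).2 hS

theorem finite_badSets (n : ℕ) (γ : GL (Fin 2) F) : (badSets n γ).Finite :=
  (finite_ratSets n).subset fun _ h => h.1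

theorem finite_diagSets (hq : Odd (Fintype.card F)) {e : ℤ} (he : e = 1 ∨ e = -1) {δ : F}
    {θ : AlgebraicClosure F} (hθ : θ ≠ 0) (hθ2 : θ ^ 2 = em F δ)
    (hθq : θ ^ Fintype.card F = e * θ) {τ : GL (Fin 2) F} (hτ : τ ∈ torus δ) (n : ℕ) :
    (diagSets F e (em F (τ.val 0 0) + em F (τ.val 1 0) * θ)
      (em F (τ.val 0 0) - em F (τ.val 1 0) * θ) n).Finite ∧
    (diagSets F e (em F (τ.val 0 0) + em F (τ.val 1 0) * θ)
      (em F (τ.val 0 0) - em F (τ.val 1 0) * θ) n).ncard = (badSets n τ).ncard := by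
  rw [diagSets_eq_image hq he hθ hθ2 hθq hτ n]
  refine ⟨(finite_badSets n τ).image _, Set.ncard_image_of_injective _ ?_⟩
  exact Finset.image_injective (mob_injective (diagMat_det_ne_zero hq hθ))

end Diagonalization

section DiagonalCount

/-- A unit of the algebraic closure as a point of the projective line. -/
def unitPt {F : Type} [Field F] (z : (AlgebraicClosure F)ˣ) : Option (AlgebraicClosure F) :=
  some z.val

omit [Fintype F] in
theorem unitPt_injective : Function.Injective (unitPt (F := F)) :=
  fun _ _ h => Units.ext (Option.some.inj h)

omit [Fintype F] in
theorem unitPt_ne {z : (AlgebraicClosure F)ˣ} : unitPt z ≠ none ∧ unitPt z ≠ some 0 :=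
  ⟨Option.some_ne_none _, fun h => z.ne_zero (Option.some.inj h)⟩

omit [Fintype F] in
theorem pt_cases (t : Option (AlgebraicClosure F)) :
    t = none ∨ t = some 0 ∨ ∃ z, t = unitPt z := by
  cases t with
  | none => exact Or.inl rfl
  | some x =>
    by_cases hx : x = 0
    · exact Or.inr (Or.inl (by rw [hx]))
    · exact Or.inr (Or.inr ⟨Units.mk0 x hx, rfl⟩)

theorem twist_none (e : ℤ) : twist F e none = if e = 1 then none else some 0 := by
  unfold twist twistMat
  split_ifs
  · simp [frobP1, mob_one]
  · simp [frobP1, mob]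

theorem twist_zero (e : ℤ) : twist F e (some 0) = if e = 1 then some 0 else none := by
  unfold twist twistMat
  have h : Fintype.card F ≠ 0 := Fintype.card_ne_zero
  split_ifs
  · simp [frobP1, mob_one]
  · simp [frobP1, mob]

theorem twist_unitPt {e : ℤ} (he : e = 1 ∨ e = -1) (z : (AlgebraicClosure F)ˣ) :
    twist F e (unitPt z) = unitPt (powUnits F (e * Fintype.card F) z) := by
  unfold twist twistMat powUnits unitPt
  have h : Fintype.card F ≠ 0 := Fintype.card_ne_zero
  rcases he with rfl | rfl
  · simp [frobP1, mob_one]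
  · simp [frobP1, mob]

theorem twist_injective {e : ℤ} (he : e = 1 ∨ e = -1) : (twist F e).Injective := by
  intro s t h
  apply frobP1_injective
  refine mob_injective ?_ h
  rcases he with rfl | rfl <;> simp [twistMat, Matrix.det_fin_two]

section DiagonalMatrix

variable {K : Type*} [Field K]

theorem mob_diagonal_none (α β : K) : mob (Matrix.diagonal ![α, β]) none = none := by
  simp [mob]

theorem mob_diagonal_some (α : K) {β : K} (hβ : β ≠ 0) (x : K) :
    mob (Matrix.diagonal ![α, β]) (some x) = some (α / β * x) := by
  simp [mob, hβ]
  ring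

theorem lamProd_diagonal {α β : K} (hβ : β ≠ 0) (R : Finset (Option K)) :
    lamProd (Matrix.diagonal ![α, β]) R = β ^ R.card * if none ∈ R then α / β else 1 := by
  have h : ∀ t : Option K, lam (Matrix.diagonal ![α, β]) t =
      β * if t = none then α / β else 1 := by
    intro t
    cases t <;> simp [lam, hβ, mul_div_cancel₀]
  unfold lamProd
  rw [Finset.prod_congr rfl fun t _ => h t, Finset.prod_mul_distrib, Finset.prod_const,
    Finset.prod_ite_eq']

end DiagonalMatrix

theorem ncard_diagSets_part {e : ℤ} (he : e = 1 ∨ e = -1) (α β : (AlgebraicClosure F)ˣ) (n : ℕ)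
    {P : Finset (Option (AlgebraicClosure F))} (hP : ∀ t ∈ P, t = none ∨ t = some 0)
    (hPt : ∀ t ∈ P, twist F e t ∈ P) (hPn : P.card ≤ n) :
    {R ∈ diagSets F e α β n | ∀ t, t = none ∨ t = some 0 → (t ∈ R ↔ t ∈ P)}.ncard =
      if (β ^ n * if none ∈ P then α / β else 1) ^ ((Fintype.card F - 1) / 2) ≠ 1 then
        (stableCosetSets (e * Fintype.card F) (α / β) (n - P.card)).ncard else 0 := by
  have hdet : (Matrix.diagonal ![(α : AlgebraicClosure F), (β : AlgebraicClosure F)]).det ≠ 0 := by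
    rw [Matrix.det_diagonal, Fin.prod_univ_two]
    exact mul_ne_zero α.ne_zero β.ne_zero
  have hmob : ∀ z, mob (Matrix.diagonal ![(α : AlgebraicClosure F), (β : AlgebraicClosure F)])
      (unitPt z) = unitPt (α / β * z) := by
    intro z
    rw [unitPt, mob_diagonal_some _ β.ne_zero, unitPt, Units.val_mul, Units.val_div_eq_div_val]
  have hbad : ∀ R : Finset (Option (AlgebraicClosure F)), R.card = n → (none ∈ R ↔ none ∈ P) →
      (lamProd (Matrix.diagonal ![(α : AlgebraicClosure F), (β : AlgebraicClosure F)]) R ^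
        ((Fintype.card F - 1) / 2) ≠ 1 ↔
      (β ^ n * if none ∈ P then α / β else 1) ^ ((Fintype.card F - 1) / 2) ≠ 1) := by
    intro R hR hRP
    rw [lamProd_diagonal β.ne_zero, hR, not_iff_not, ← Units.val_inj]
    simp only [hRP]
    split_ifs <;> simp
  have hmemU : ∀ (R₀ : Finset (AlgebraicClosure F)ˣ) z, unitPt z ∈ P ∪ R₀.image unitPt ↔ z ∈ R₀ := by
    intro R₀ z
    rw [Finset.mem_union, unitPt_injective.mem_finset_image, or_iff_right]
    intro h
    rcases hP _ h with h | h
    · exact unitPt_ne.1 h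
    · exact unitPt_ne.2 h
  have hmemP : ∀ (R₀ : Finset (AlgebraicClosure F)ˣ) t, t = none ∨ t = some 0 →
      (t ∈ P ∪ R₀.image unitPt ↔ t ∈ P) := by
    intro R₀ t ht
    rw [Finset.mem_union, or_iff_left]
    intro h
    obtain ⟨z, -, rfl⟩ := Finset.mem_image.1 h
    rcases ht with h | h
    · exact unitPt_ne.1 h
    · exact unitPt_ne.2 h
  have hcard : ∀ R₀ : Finset (AlgebraicClosure F)ˣ,
      (P ∪ R₀.image unitPt).card = P.card + R₀.card := by
    intro R₀
    rw [Finset.card_union_of_disjoint, Finset.card_image_of_injective _ unitPt_injective]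
    rw [Finset.disjoint_left]
    intro t ht ht'
    obtain ⟨z, -, rfl⟩ := Finset.mem_image.1 ht'
    rcases hP _ ht with h | h
    · exact unitPt_ne.1 h
    · exact unitPt_ne.2 h
  by_cases hb : (β ^ n * if none ∈ P then α / β else 1) ^ ((Fintype.card F - 1) / 2) ≠ 1
  · rw [if_pos hb]
    symm
    apply Set.ncard_congr fun R₀ _ => P ∪ R₀.image unitPt
    · rintro R₀ ⟨⟨hc, hR₀⟩, hζ⟩
      have hc' : (P ∪ R₀.image unitPt).card = n := by rw [hcard, hc]; omega
      refine ⟨⟨hc', ?_, ?_, ?_⟩, hmemP R₀⟩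
      · rw [image_eq_self_iff (twist_injective he)]
        intro t ht
        rcases Finset.mem_union.1 ht with h | h
        · exact Finset.mem_union_left _ (hPt t h)
        · obtain ⟨z, hz, rfl⟩ := Finset.mem_image.1 h
          rw [twist_unitPt he, hmemU]
          exact (image_eq_self_iff (powUnits_injective he) R₀).1 hR₀ z hz
      · rw [image_eq_self_iff (mob_injective hdet)]
        intro t ht
        rcases Finset.mem_union.1 ht with h | h
        · rcases hP t h with rfl | rfl
          · rwa [mob_diagonal_none]
          · rwa [mob_diagonal_some _ β.ne_zero, mul_zero]
        · obtain ⟨z, hz, rfl⟩ := Finset.mem_image.1 h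
          rw [hmob, hmemU]
          exact hζ z hz
      · exact (hbad _ hc' (hmemP R₀ none (Or.inl rfl))).2 hb
    · intro R₀ R₁ _ _ h
      ext z
      rw [← hmemU R₀, ← hmemU R₁]
      exact iff_of_eq (congrArg (unitPt z ∈ ·) h)
    · rintro R ⟨⟨hc, hR, hζ, -⟩, hRP⟩
      rw [image_eq_self_iff (twist_injective he)] at hR
      rw [image_eq_self_iff (mob_injective hdet)] at hζ
      set R₀ : Finset (AlgebraicClosure F)ˣ := R.preimage unitPt unitPt_injective.injOn with hR₀
      have hmem : ∀ z, z ∈ R₀ ↔ unitPt z ∈ R := fun z => Finset.mem_preimage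
      have hunion : P ∪ R₀.image unitPt = R := by
        ext t
        rcases pt_cases t with h | h | ⟨z, rfl⟩
        · rw [hmemP R₀ t (Or.inl h), hRP t (Or.inl h)]
        · rw [hmemP R₀ t (Or.inr h), hRP t (Or.inr h)]
        · rw [hmemU, hmem]
      refine ⟨R₀, ⟨⟨?_, ?_⟩, ?_⟩, hunion⟩
      · have := hcard R₀
        rw [hunion, hc] at this
        omega
      · rw [image_eq_self_iff (powUnits_injective he)]
        intro z hz
        rw [hmem] at hz ⊢
        rw [← twist_unitPt he]
        exact hR _ hz
      · intro z hz
        rw [hmem] at hz ⊢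
        rw [← hmob]
        exact hζ _ hz
  · rw [if_neg hb]
    suffices h : {R ∈ diagSets F e α β n | ∀ t, t = none ∨ t = some 0 → (t ∈ R ↔ t ∈ P)} = ∅ by
      rw [h, Set.ncard_empty]
    rw [Set.eq_empty_iff_forall_notMem]
    rintro R ⟨⟨hc, -, -, hb'⟩, hRP⟩
    exact hb ((hbad R hc (hRP none (Or.inl rfl))).1 hb')

theorem ncard_diagSets (hq : Odd (Fintype.card F)) {e : ℤ} (he : e = 1 ∨ e = -1)
    {α β : (AlgebraicClosure F)ˣ} (hζ : 0 < orderOf (α / β))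
    (hα : e = 1 → α ^ (Fintype.card F - 1) = 1) (hβ : e = 1 → β ^ (Fintype.card F - 1) = 1)
    {g : ℕ} (hfin : (diagSets F e α β (2 * g + 2)).Finite) :
    (diagSets F e α β (2 * g + 2)).ncard =
      (if (β ^ (2 * g + 2)) ^ ((Fintype.card F - 1) / 2) ≠ 1 then
        (stableCosetSets (e * Fintype.card F) (α / β) (2 * g + 2)).ncard else 0) +
      (if (β ^ (2 * g + 2) * (α / β)) ^ ((Fintype.card F - 1) / 2) ≠ 1 then
        (stableCosetSets (e * Fintype.card F) (α / β) (2 * g)).ncard else 0) := by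
  obtain ⟨r, hr⟩ := hq
  have hh : (Fintype.card F - 1) / 2 = r := by omega
  have hβ1 : e = 1 → (β ^ (2 * g + 2)) ^ ((Fintype.card F - 1) / 2) = 1 := by
    intro h
    have := hβ h
    rw [show Fintype.card F - 1 = 2 * r by omega] at this
    rw [hh, ← pow_mul, show (2 * g + 2) * r = 2 * r * (g + 1) by ring, pow_mul, this, one_pow]
  have hodd : e = 1 → (β ^ (2 * g + 2) * (α / β)) ^ ((Fintype.card F - 1) / 2) ≠ 1 →
      (stableCosetSets (e * Fintype.card F) (α / β) (2 * g + 2 - 1)).ncard = 0 := by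
    intro h hne
    rw [ncard_stableCosetSets (powUnits_injective he) hζ, if_neg]
    intro hdvd
    apply hne
    rw [mul_pow, hβ1 h, one_mul, hh, ← orderOf_dvd_iff_pow_eq_one]
    have h1 : orderOf (α / β) ∣ 2 * r := by
      rw [orderOf_dvd_iff_pow_eq_one, ← show Fintype.card F - 1 = 2 * r by omega, div_pow, hα h,
        hβ h, div_one]
    refine Nat.Coprime.dvd_of_dvd_mul_left ?_ h1
    rw [Nat.coprime_two_right]
    refine Odd.of_dvd_nat ?_ hdvd
    exact ⟨g, by omega⟩
  have hiff : ∀ R ∈ diagSets F e α β (2 * g + 2), (none ∈ R ↔ some 0 ∈ R) := by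
    intro R hR
    rcases he with rfl | rfl
    · have hone : ∀ t : Option (AlgebraicClosure F), t = none ∨ t = some 0 →
          (∀ s ∈ ({t} : Finset (Option (AlgebraicClosure F))), s = none ∨ s = some 0) ∧
          (∀ s ∈ ({t} : Finset (Option (AlgebraicClosure F))), twist F 1 s ∈
            ({t} : Finset (Option (AlgebraicClosure F)))) := by
        intro t ht
        simp only [Finset.mem_singleton, forall_eq]
        refine ⟨ht, ?_⟩
        rcases ht with rfl | rfl
        · rw [twist_none, if_pos rfl]
        · rw [twist_zero, if_pos rfl]
      have hcontra : ∀ t : Option (AlgebraicClosure F), t = none ∨ t = some 0 →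
          ¬ ∀ s, s = none ∨ s = some 0 → (s ∈ R ↔ s = t) := by
        intro t ht hs
        have h := ncard_diagSets_part (F := F) (e := 1) (Or.inl rfl) α β (2 * g + 2) (hone t ht).1
          (hone t ht).2 (by rw [Finset.card_singleton]; omega)
        have h0 : {R ∈ diagSets F 1 α β (2 * g + 2) | ∀ s, s = none ∨ s = some 0 →
            (s ∈ R ↔ s ∈ ({t} : Finset (Option (AlgebraicClosure F))))}.ncard ≠ 0 := by
          refine Set.ncard_ne_zero_of_mem (a := R) ⟨hR, by simpa using hs⟩ ?_
          exact hfin.subset fun _ h => h.1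
        apply h0
        rw [h, Finset.card_singleton]
        rcases ht with rfl | rfl
        · simp only [Finset.mem_singleton, if_true]
          split_ifs with hb
          · exact hodd rfl hb
          · rfl
        · simp [hβ1]
      by_contra hne
      by_cases h : none ∈ R
      · have h0 : some 0 ∉ R := by tauto
        apply hcontra none (Or.inl rfl)
        rintro s (rfl | rfl) <;> simp [h, h0]
      · have h0 : some 0 ∈ R := by tauto
        apply hcontra (some 0) (Or.inr rfl)
        rintro s (rfl | rfl) <;> simp [h, h0]
    · have h := (image_eq_self_iff (twist_injective (Or.inr rfl)) R).1 hR.2.1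
      constructor
      · intro h1
        simpa [twist_none] using h _ h1
      · intro h1
        simpa [twist_zero] using h _ h1
  have h0 := ncard_diagSets_part he α β (2 * g + 2) (P := ∅) (by simp) (by simp) (by simp)
  have hc2 : ({none, some 0} : Finset (Option (AlgebraicClosure F))).card = 2 :=
    Finset.card_pair (by simp)
  have h1 := ncard_diagSets_part he α β (2 * g + 2) (P := {none, some 0}) (by simp)
    (by
      intro t ht
      rcases Finset.mem_insert.1 ht with rfl | ht
      · rw [twist_none]
        split_ifs <;> simp
      · rw [Finset.mem_singleton.1 ht, twist_zero]
        split_ifs <;> simp) (by rw [hc2]; omega)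
  rw [hc2, Nat.add_sub_cancel, if_pos (Finset.mem_insert_self _ _)] at h1
  rw [Finset.card_empty, Nat.sub_zero, if_neg (Finset.notMem_empty _), mul_one] at h0
  rw [← h0, ← h1, ← Set.ncard_union_eq ?_ (hfin.subset fun _ h => h.1)
    (hfin.subset fun _ h => h.1)]
  · congr 1
    ext R
    constructor
    · intro hR
      have h := hiff R hR
      by_cases h2 : none ∈ R
      · right
        refine ⟨hR, ?_⟩
        rintro s (rfl | rfl) <;> simp [h2, ← h]
      · left
        refine ⟨hR, ?_⟩
        rintro s (rfl | rfl) <;> simp [h2, ← h]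
    · rintro (h | h)
      · exact h.1
      · exact h.1
  · rw [Set.disjoint_left]
    rintro R ⟨-, hR⟩ ⟨-, hR'⟩
    have h2 := hR none (Or.inl rfl)
    have h3 := hR' none (Or.inl rfl)
    simp_all

end DiagonalCount

section FixedCounts

theorem pow_ne_one_iff_odd {G : Type*} [Monoid G] {ζ : G} (hζ : 0 < orderOf ζ) {k : ℕ}
    (h : orderOf ζ ∣ 2 * k) : ζ ^ k ≠ 1 ↔ Odd (2 * k / orderOf ζ) := by
  rw [Ne, ← orderOf_dvd_iff_pow_eq_one, ← Nat.not_even_iff_odd, not_iff_not]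
  obtain ⟨c, hc⟩ := h
  rw [hc, Nat.mul_div_cancel_left _ hζ, even_iff_exists_two_mul]
  constructor
  · rintro ⟨d, rfl⟩
    exact ⟨d, Nat.eq_of_mul_eq_mul_left hζ (by rw [← hc]; ring)⟩
  · rintro ⟨d, rfl⟩
    exact ⟨d, Nat.eq_of_mul_eq_mul_left two_pos (by rw [hc]; ring)⟩

theorem ncard_diagSets_split (hq : Odd (Fintype.card F)) {α β : (AlgebraicClosure F)ˣ}
    (hζ : 0 < orderOf (α / β)) (hα : α ^ (Fintype.card F - 1) = 1)
    (hβ : β ^ (Fintype.card F - 1) = 1) {g : ℕ} (hg : 0 < g)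
    (hfin : (diagSets F 1 α β (2 * g + 2)).Finite) :
    ((diagSets F 1 α β (2 * g + 2)).ncard : ℚ) =
      if orderOf (α / β) ∣ 2 * g ∧ Odd ((Fintype.card F - 1) / orderOf (α / β)) then
        ((Fintype.card F : ℚ) - 1) * A2 (Fintype.card F) (2 * g / orderOf (α / β)) else 0 := by
  have hh : Fintype.card F - 1 = 2 * ((Fintype.card F - 1) / 2) := by
    obtain ⟨r, hr⟩ := hq
    omega
  have hβ1 : (β ^ (2 * g + 2)) ^ ((Fintype.card F - 1) / 2) = 1 := by
    rw [← pow_mul, show (2 * g + 2) * ((Fintype.card F - 1) / 2) =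
      2 * ((Fintype.card F - 1) / 2) * (g + 1) by ring, ← hh, pow_mul, hβ, one_pow]
  have hdvd : orderOf (α / β) ∣ 2 * ((Fintype.card F - 1) / 2) := by
    rw [← hh, orderOf_dvd_iff_pow_eq_one, div_pow, hα, hβ, div_one]
  have hodd := pow_ne_one_iff_odd hζ hdvd
  rw [← hh] at hodd
  rw [ncard_diagSets hq (Or.inl rfl) hζ (fun _ => hα) (fun _ => hβ) hfin, mul_pow, hβ1,
    if_neg (fun h => h rfl), zero_add, one_mul, if_congr hodd rfl rfl,
    ncard_stableCosetSets (powUnits_injective (Or.inl rfl)) hζ]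
  by_cases h : orderOf (α / β) ∣ 2 * g
  · by_cases h' : Odd ((Fintype.card F - 1) / orderOf (α / β))
    · rw [if_pos h', if_pos h, if_pos ⟨h, h'⟩]
      exact ncard_stableSets_split (Nat.div_pos (Nat.le_of_dvd (by omega) h) hζ)
    · rw [if_neg h', if_neg fun h => h' h.2, Nat.cast_zero]
  · rw [if_neg h, ite_self, if_neg fun h' => h h'.1, Nat.cast_zero]

theorem ncard_diagSets_nonsplit (hq : Odd (Fintype.card F)) {α β : (AlgebraicClosure F)ˣ}
    (hζ : (α / β) ^ (Fintype.card F + 1) = 1) (hβ : β ^ (Fintype.card F - 1) = α / β)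
    {g : ℕ} (hg : 0 < g) (hfin : (diagSets F (-1) α β (2 * g + 2)).Finite) :
    ((diagSets F (-1) α β (2 * g + 2)).ncard : ℚ) =
      (if orderOf (α / β) ∣ 2 * g + 2 ∧ Odd ((2 * g + 2) / orderOf (α / β)) then
        ((Fintype.card F : ℚ) + 1) * A0 (Fintype.card F) ((2 * g + 2) / orderOf (α / β)) else 0) +
      (if orderOf (α / β) ∣ 2 * g ∧
          ¬ 2 * g / orderOf (α / β) % 2 = (Fintype.card F + 1) / orderOf (α / β) % 2 then
        ((Fintype.card F : ℚ) + 1) * A0 (Fintype.card F) (2 * g / orderOf (α / β)) else 0) := by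
  have hh : Fintype.card F - 1 = 2 * ((Fintype.card F - 1) / 2) := by
    obtain ⟨r, hr⟩ := hq
    omega
  have hq0 : 0 < Fintype.card F := Fintype.card_pos
  have hpos : 0 < orderOf (α / β) :=
    orderOf_pos_iff.2 (isOfFinOrder_iff_pow_eq_one.2 ⟨_, by omega, hζ⟩)
  have hβn : (β ^ (2 * g + 2)) ^ ((Fintype.card F - 1) / 2) = (α / β) ^ (g + 1) := by
    rw [← pow_mul, show (2 * g + 2) * ((Fintype.card F - 1) / 2) =
      2 * ((Fintype.card F - 1) / 2) * (g + 1) by ring, ← hh, pow_mul, hβ]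
  have hdvd := orderOf_dvd_iff_pow_eq_one.2 hζ
  rw [ncard_diagSets hq (Or.inr rfl) hpos (fun h => by norm_num at h) (fun h => by norm_num at h)
    hfin, mul_pow, hβn, ← pow_add, Nat.cast_add,
    ncard_stableCosetSets (powUnits_injective (Or.inr rfl)) hpos,
    ncard_stableCosetSets (powUnits_injective (Or.inr rfl)) hpos]
  congr 1
  · by_cases h : orderOf (α / β) ∣ 2 * g + 2
    · have h1 := pow_ne_one_iff_odd hpos (k := g + 1) h
      rw [show 2 * (g + 1) = 2 * g + 2 by ring] at h1
      rw [if_congr h1 rfl rfl]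
      by_cases h' : Odd ((2 * g + 2) / orderOf (α / β))
      · rw [if_pos h', if_pos h, if_pos ⟨h, h'⟩]
        exact ncard_stableSets_nonsplit (Nat.div_pos (Nat.le_of_dvd (by omega) h) hpos)
      · rw [if_neg h', if_neg fun h => h' h.2, Nat.cast_zero]
    · rw [if_neg h, ite_self, if_neg fun h' => h h'.1, Nat.cast_zero]
  · by_cases h : orderOf (α / β) ∣ 2 * g
    · have h2 : 2 * (g + 1 + (Fintype.card F - 1) / 2) = 2 * g + (Fintype.card F + 1) := by omega
      have h1 := pow_ne_one_iff_odd hpos (k := g + 1 + (Fintype.card F - 1) / 2)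
        (by rw [h2]; exact dvd_add h hdvd)
      rw [h2, Nat.add_div_of_dvd_right h] at h1
      have h3 : Odd (2 * g / orderOf (α / β) + (Fintype.card F + 1) / orderOf (α / β)) ↔
          ¬ 2 * g / orderOf (α / β) % 2 = (Fintype.card F + 1) / orderOf (α / β) % 2 := by
        rw [Nat.odd_iff]
        omega
      rw [if_congr (h1.trans h3) rfl rfl]
      by_cases h' : 2 * g / orderOf (α / β) % 2 = (Fintype.card F + 1) / orderOf (α / β) % 2
      · rw [if_neg (not_not.2 h'), if_neg fun h => h.2 h', Nat.cast_zero]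
      · rw [if_pos h', if_pos h, if_pos ⟨h, h'⟩]
        exact ncard_stableSets_nonsplit (Nat.div_pos (Nat.le_of_dvd (by omega) h) hpos)
    · rw [if_neg h, ite_self, if_neg fun h' => h h'.1, Nat.cast_zero]

end FixedCounts

section Ratio

theorem sum_nthRootsFinset {K : Type*} [Field K] [IsAlgClosed K] {N : ℕ} (hN : (N : K) ≠ 0)
    (Φ : ℕ → ℚ) :
    ∑ ζ ∈ (nthRootsFinset N (1 : K)).erase 1, Φ (orderOf ζ) =
      ∑ m ∈ N.divisors with 1 < m, (m.totient : ℚ) * Φ m := by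
  have hN0 : N ≠ 0 := by
    rintro rfl
    exact hN Nat.cast_zero
  have hset : (nthRootsFinset N (1 : K)).erase 1 =
      {m ∈ N.divisors | 1 < m}.biUnion fun m => primitiveRoots m K := by
    ext ζ
    rw [Finset.mem_erase, mem_nthRootsFinset (Nat.pos_of_ne_zero hN0), Finset.mem_biUnion]
    constructor
    · rintro ⟨h1, h⟩
      have hpos : 0 < orderOf ζ :=
        orderOf_pos_iff.2 (isOfFinOrder_iff_pow_eq_one.2 ⟨N, Nat.pos_of_ne_zero hN0, h⟩)
      have hne : orderOf ζ ≠ 1 := fun h => h1 (orderOf_eq_one_iff.1 h)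
      refine ⟨orderOf ζ, Finset.mem_filter.2 ⟨Nat.mem_divisors.2
        ⟨orderOf_dvd_of_pow_eq_one h, hN0⟩, by omega⟩, ?_⟩
      exact (mem_primitiveRoots hpos).2 (IsPrimitiveRoot.orderOf ζ)
    · rintro ⟨m, hm, hζ⟩
      obtain ⟨hm, h1⟩ := Finset.mem_filter.1 hm
      have hp := (mem_primitiveRoots (by omega)).1 hζ
      exact ⟨hp.ne_one h1, hp.pow_eq_one_iff_dvd _ |>.2 (Nat.dvd_of_mem_divisors hm)⟩
  rw [hset, Finset.sum_biUnion]
  · refine Finset.sum_congr rfl fun m hm => ?_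
    obtain ⟨hm, h1⟩ := Finset.mem_filter.1 hm
    have hmK : NeZero (m : K) := by
      obtain ⟨c, hc⟩ := Nat.dvd_of_mem_divisors hm
      refine ⟨fun h => hN ?_⟩
      rw [hc, Nat.cast_mul, h, zero_mul]
    obtain ⟨z, hz⟩ := HasEnoughRootsOfUnity.exists_primitiveRoot K m
    rw [← hz.card_primitiveRoots, ← nsmul_eq_mul, ← Finset.sum_const]
    refine Finset.sum_congr rfl fun ζ hζ => ?_
    rw [← ((mem_primitiveRoots (by omega)).1 hζ).eq_orderOf]
  · intro m _ m' _ h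
    exact IsPrimitiveRoot.disjoint h

/-- The ratio of the two eigenvalues of an element of a torus. -/
def ratio (θ : AlgebraicClosure F) (τ : GL (Fin 2) F) : AlgebraicClosure F :=
  (em F (τ.val 0 0) + em F (τ.val 1 0) * θ) / (em F (τ.val 0 0) - em F (τ.val 1 0) * θ)

theorem ratio_eq_one_iff (hq : Odd (Fintype.card F)) {δ : F} {θ : AlgebraicClosure F} (hθ : θ ≠ 0)
    (hθ2 : θ ^ 2 = em F δ) {τ : GL (Fin 2) F} (hτ : τ ∈ torus δ) :
    ratio θ τ = 1 ↔ τ.val 1 0 = 0 := by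
  rw [ratio, div_eq_one_iff_eq (diag_ne_zero hθ2 hτ).2]
  constructor
  · intro h
    have h' : 2 * (em F (τ.val 1 0) * θ) = 0 := by linear_combination h
    simpa [two_ne_zero_closure hq, hθ, em_injective] using h'
  · intro h
    rw [h]
    simp

theorem regTorus_eq (hq : Odd (Fintype.card F)) {δ : F} {θ : AlgebraicClosure F} (hθ : θ ≠ 0)
    (hθ2 : θ ^ 2 = em F δ) : regTorus δ = {τ ∈ torus δ | ratio θ τ ≠ 1} := by
  ext τ
  rw [regTorus, Finset.mem_filter, Finset.mem_filter, and_congr_right_iff]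
  intro hτ
  rw [Ne, Ne, ratio_eq_one_iff hq hθ hθ2 hτ]

theorem em_add_pow {e : ℤ} {θ : AlgebraicClosure F} (hθq : θ ^ Fintype.card F = e * θ) (a b : F) :
    (em F a + em F b * θ) ^ Fintype.card F = em F a + em F b * (e * θ) := by
  have h := map_add (frobK F) (em F a) (em F b * θ)
  rwa [map_mul, frobK_apply, frobK_apply, frobK_apply, frobK_apply, em_pow_card, em_pow_card,
    hθq] at h

theorem em_sub_pow {e : ℤ} {θ : AlgebraicClosure F} (hθq : θ ^ Fintype.card F = e * θ) (a b : F) :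
    (em F a - em F b * θ) ^ Fintype.card F = em F a - em F b * (e * θ) := by
  have h := em_add_pow hθq a (-b)
  rwa [map_neg, neg_mul, neg_mul, ← sub_eq_add_neg, ← sub_eq_add_neg] at h

theorem exists_ratio {e : ℤ} (he : e = 1 ∨ e = -1)
    {θ : AlgebraicClosure F} (hθq : θ ^ Fintype.card F = e * θ)
    {ζ : AlgebraicClosure F} (hζ0 : ζ ≠ 0) (hζ : ζ ^ Fintype.card F = ζ ^ e) :
    ∃ a₀ b₀ : F, (a₀ ≠ 0 ∨ b₀ ≠ 0) ∧
      em F a₀ + em F b₀ * θ = ζ * (em F a₀ - em F b₀ * θ) := by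
  by_cases h1 : ζ = 1
  · exact ⟨1, 0, Or.inl one_ne_zero, by simp [h1]⟩
  · have h1' := sub_ne_zero.2 h1
    obtain ⟨a, ha⟩ := exists_em_eq (F := F) (x := θ * (ζ + 1) / (ζ - 1)) (by
      have h : ∀ x, x ^ Fintype.card F = frobK F x := fun x => rfl
      rw [h, map_div₀, map_mul, map_add, map_sub, map_one, ← h, ← h, hζ, hθq]
      rcases he with rfl | rfl
      · simp
      · have : ζ⁻¹ - 1 ≠ 0 := by
          rw [sub_ne_zero]
          simpa using h1
        rw [zpow_neg_one, div_eq_div_iff this h1']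
        push_cast
        field_simp
        ring)
    refine ⟨a, 1, Or.inr one_ne_zero, ?_⟩
    rw [ha, map_one]
    field_simp
    ring

theorem card_ratio_fibre (hq : Odd (Fintype.card F)) {e : ℤ} (he : e = 1 ∨ e = -1) {δ : F}
    {θ : AlgebraicClosure F} (hθ : θ ≠ 0) (hθ2 : θ ^ 2 = em F δ)
    (hθq : θ ^ Fintype.card F = e * θ) {ζ : AlgebraicClosure F} (hζ0 : ζ ≠ 0)
    (hζ : ζ ^ Fintype.card F = ζ ^ e) :
    {τ ∈ torus δ | ratio θ τ = ζ}.card = Fintype.card F - 1 := by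
  obtain ⟨a₀, b₀, h0, hab⟩ := exists_ratio he hθq hζ0 hζ
  have h2 := two_ne_zero_closure hq
  have hem : ∀ x : F, em F x = 0 ↔ x = 0 := fun x => map_eq_zero (em F)
  have hne : em F a₀ - em F b₀ * θ ≠ 0 := by
    intro h
    rw [h, mul_zero] at hab
    have ha : 2 * em F a₀ = 0 := by linear_combination hab + h
    have hb : 2 * (em F b₀ * θ) = 0 := by linear_combination hab - h
    simp only [mul_eq_zero, h2, hθ, hem, false_or, or_false] at ha hb
    rcases h0 with h0 | h0
    · exact h0 ha
    · exact h0 hb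
  have hdet : ∀ c : F, c ≠ 0 →
      (!![c * a₀, δ * (c * b₀); c * b₀, c * a₀] : Matrix (Fin 2) (Fin 2) F).det ≠ 0 := by
    intro c hc
    rw [Ne, ← hem, Matrix.det_fin_two_of]
    have : em F (c * a₀ * (c * a₀) - δ * (c * b₀) * (c * b₀)) =
        em F c ^ 2 * ((em F a₀ + em F b₀ * θ) * (em F a₀ - em F b₀ * θ)) := by
      simp only [map_sub, map_mul, ← hθ2]
      ring
    rw [this, hab]
    exact mul_ne_zero (pow_ne_zero _ (mt (hem c).1 hc)) (mul_ne_zero (mul_ne_zero hζ0 hne) hne)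
  rw [← Finset.card_univ, ← Finset.card_erase_of_mem (Finset.mem_univ (0 : F))]
  symm
  refine Finset.card_bij (fun c hc => Matrix.GeneralLinearGroup.mkOfDetNeZero _
    (hdet c (Finset.ne_of_mem_erase hc))) ?_ ?_ ?_
  · intro c hc
    have hc0 := mt (hem c).1 (Finset.ne_of_mem_erase hc)
    refine Finset.mem_filter.2 ⟨mem_torus.2 ⟨rfl, rfl⟩, ?_⟩
    change (em F (c * a₀) + em F (c * b₀) * θ) / (em F (c * a₀) - em F (c * b₀) * θ) = ζ
    rw [map_mul, map_mul, mul_assoc, ← mul_add, ← mul_sub, mul_div_mul_left _ _ hc0, hab,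
      mul_div_cancel_right₀ _ hne]
  · intro c _ c' _ h
    have h' := congrArg Units.val h
    have ha : c * a₀ = c' * a₀ := congrFun (congrFun h' 0) 0
    have hb : c * b₀ = c' * b₀ := congrFun (congrFun h' 1) 0
    rcases h0 with h0 | h0
    · exact mul_right_cancel₀ h0 ha
    · exact mul_right_cancel₀ h0 hb
  · intro τ hτ
    obtain ⟨hτ, hr⟩ := Finset.mem_filter.1 hτ
    obtain ⟨h1, h3⟩ := mem_torus.1 hτ
    have hnz := diag_ne_zero hθ2 hτ
    rw [ratio, div_eq_iff hnz.2] at hr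
    have hprop : τ.val 0 0 * b₀ = τ.val 1 0 * a₀ := by
      apply em_injective
      rw [map_mul, map_mul]
      have h4 : 2 * θ * (em F (τ.val 0 0) * em F b₀ - em F (τ.val 1 0) * em F a₀) = 0 := by
        linear_combination (em F (τ.val 0 0) - em F (τ.val 1 0) * θ) * hab -
          (em F a₀ - em F b₀ * θ) * hr
      rw [mul_eq_zero, mul_eq_zero] at h4
      have := (h4.resolve_left (by tauto))
      exact sub_eq_zero.1 this
    obtain ⟨c, hca, hcb⟩ : ∃ c, c * a₀ = τ.val 0 0 ∧ c * b₀ = τ.val 1 0 := by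
      by_cases ha : a₀ = 0
      · have hb : b₀ ≠ 0 := h0.resolve_left (not_not.2 ha)
        refine ⟨τ.val 1 0 / b₀, ?_, div_mul_cancel₀ _ hb⟩
        rw [ha, mul_zero] at hprop
        rw [ha, mul_zero, (mul_eq_zero.1 hprop).resolve_right hb]
      · refine ⟨τ.val 0 0 / a₀, div_mul_cancel₀ _ ha, ?_⟩
        rw [div_mul_eq_mul_div, hprop, mul_div_cancel_right₀ _ ha]
    have hc : c ≠ 0 := by
      rintro rfl
      apply hnz.1
      rw [← hca, ← hcb]
      simp
    refine ⟨c, Finset.mem_erase.2 ⟨hc, Finset.mem_univ _⟩, Units.ext ?_⟩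
    change !![c * a₀, δ * (c * b₀); c * b₀, c * a₀] = τ.val
    rw [hca, hcb, ← h3]
    ext i j
    fin_cases i <;> fin_cases j <;> simp [h1]

theorem ratio_pow {e : ℤ} (he : e = 1 ∨ e = -1) {δ : F}
    {θ : AlgebraicClosure F} (hθ2 : θ ^ 2 = em F δ) (hθq : θ ^ Fintype.card F = e * θ) {N : ℕ}
    (hN : (N : ℤ) = Fintype.card F - e) {τ : GL (Fin 2) F} (hτ : τ ∈ torus δ) :
    ratio θ τ ^ N = 1 := by
  have hnz := diag_ne_zero hθ2 hτ
  have hadd := em_add_pow hθq (τ.val 0 0) (τ.val 1 0)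
  have hsub := em_sub_pow hθq (τ.val 0 0) (τ.val 1 0)
  have h0 : ratio θ τ ≠ 0 := div_ne_zero hnz.1 hnz.2
  rcases he with rfl | rfl
  · refine mul_right_cancel₀ h0 ?_
    rw [← pow_succ, show N + 1 = Fintype.card F by omega, ratio, div_pow, hadd, hsub]
    simp
  · rw [show N = Fintype.card F + 1 by omega, pow_succ, ratio, div_pow, hadd, hsub]
    have h1 := hnz.1
    have h2 := hnz.2
    push_cast
    rw [neg_one_mul, mul_neg, sub_neg_eq_add, ← sub_eq_add_neg]
    field_simp

theorem pow_card_eq_zpow {e : ℤ} {N : ℕ}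
    (hN : (N : ℤ) = Fintype.card F - e) {ζ : AlgebraicClosure F} (hζ0 : ζ ≠ 0) (hζ : ζ ^ N = 1) :
    ζ ^ Fintype.card F = ζ ^ e := by
  rw [← zpow_natCast, show (Fintype.card F : ℤ) = N + e by omega, zpow_add₀ hζ0, zpow_natCast, hζ,
    one_mul]

theorem two_mul_sum_discClass (hq : Odd (Fintype.card F)) {e : ℤ} (he : e = 1 ∨ e = -1) {δ : F}
    {θ : AlgebraicClosure F} (hθ : θ ≠ 0) (hθ2 : θ ^ 2 = em F δ)
    (hθq : θ ^ Fintype.card F = e * θ) {N : ℕ} (hN : (N : ℤ) = Fintype.card F - e) {n : ℕ}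
    {Ψ : ℕ → ℚ} (hΨ : ∀ τ ∈ regTorus δ, ((badSets n τ).ncard : ℚ) = N * Ψ (orderOf (ratio θ τ))) :
    2 * ((∑ γ ∈ discClass δ, (badSets n γ).ncard : ℕ) : ℚ) =
      Fintype.card (GL (Fin 2) F) * ∑ m ∈ N.divisors with 1 < m, (m.totient : ℚ) * Ψ m := by
  have hq1 : 1 < Fintype.card F := Fintype.one_lt_card
  have hN0 : 0 < N := by omega
  have hNK : (N : AlgebraicClosure F) ≠ 0 := by
    have h := congrArg (Int.cast : ℤ → AlgebraicClosure F) hN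
    push_cast at h
    rw [h, cast_card_closure]
    rcases he with rfl | rfl <;> simp
  have hfib : ∀ ζ ∈ nthRootsFinset N (1 : AlgebraicClosure F),
      {τ ∈ torus δ | ratio θ τ = ζ}.card = Fintype.card F - 1 := by
    intro ζ hζ
    rw [mem_nthRootsFinset hN0] at hζ
    have h0 : ζ ≠ 0 := by
      rintro rfl
      rw [zero_pow hN0.ne'] at hζ
      exact zero_ne_one hζ
    exact card_ratio_fibre hq he hθ hθ2 hθq h0 (pow_card_eq_zpow hN h0 hζ)
  have hmaps : ∀ τ ∈ torus δ, ratio θ τ ∈ nthRootsFinset N (1 : AlgebraicClosure F) :=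
    fun τ hτ => (mem_nthRootsFinset hN0 1).2 (ratio_pow he hθ2 hθq hN hτ)
  have hcard : (torus δ).card = N * (Fintype.card F - 1) := by
    have : NeZero (N : AlgebraicClosure F) := ⟨hNK⟩
    obtain ⟨z, hz⟩ := HasEnoughRootsOfUnity.exists_primitiveRoot (AlgebraicClosure F) N
    rw [Finset.card_eq_sum_card_fiberwise hmaps, Finset.sum_congr rfl hfib, Finset.sum_const,
      hz.card_nthRootsFinset, smul_eq_mul]
  have hreg : ∑ τ ∈ regTorus δ, ((badSets n τ).ncard : ℚ) =
      ((Fintype.card F - 1 : ℕ) : ℚ) *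
        (N * ∑ m ∈ N.divisors with 1 < m, (m.totient : ℚ) * Ψ m) := by
    have hmaps' : ∀ τ ∈ regTorus δ,
        ratio θ τ ∈ (nthRootsFinset N (1 : AlgebraicClosure F)).erase 1 := by
      intro τ hτ
      rw [regTorus_eq hq hθ hθ2, Finset.mem_filter] at hτ
      exact Finset.mem_erase.2 ⟨hτ.2, hmaps τ hτ.1⟩
    rw [← Finset.sum_fiberwise_of_maps_to hmaps', ← sum_nthRootsFinset hNK, Finset.mul_sum,
      Finset.mul_sum]
    refine Finset.sum_congr rfl fun ζ hζ => ?_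
    obtain ⟨h1, hζ⟩ := Finset.mem_erase.1 hζ
    have hset : {τ ∈ regTorus δ | ratio θ τ = ζ} = {τ ∈ torus δ | ratio θ τ = ζ} := by
      rw [regTorus_eq hq hθ hθ2, Finset.filter_filter]
      refine Finset.filter_congr fun τ _ => ?_
      constructor
      · exact fun h => h.2
      · exact fun h => ⟨h ▸ h1, h⟩
    rw [← hfib ζ hζ, ← hset, ← nsmul_eq_mul, ← Finset.sum_const]
    refine Finset.sum_congr rfl fun τ hτ => ?_
    obtain ⟨hτ, hr⟩ := Finset.mem_filter.1 hτ
    rw [← hr]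
    exact hΨ τ hτ
  have hδ : δ ≠ 0 := by
    rintro rfl
    rw [map_zero] at hθ2
    exact hθ (pow_eq_zero_iff two_ne_zero |>.1 hθ2)
  have h := congrArg (Nat.cast : ℕ → ℚ) (sum_discClass hδ (two_ne_zero_of_odd hq)
    (f := fun γ => (badSets n γ).ncard) (ncard_badSets_conj n))
  rw [hcard] at h
  push_cast at h hreg ⊢
  rw [hreg] at h
  have hne : ((N : ℚ) * ((Fintype.card F - 1 : ℕ) : ℚ)) ≠ 0 := by
    rw [← Nat.cast_mul]
    exact Nat.cast_ne_zero.2 (Nat.mul_pos hN0 (by omega)).ne'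
  refine mul_left_cancel₀ hne ?_
  linear_combination h

end Ratio

section EigenvalueForm

theorem ncard_badSets_split (hq : Odd (Fintype.card F)) {g : ℕ} (hg : 0 < g) {τ : GL (Fin 2) F}
    (hτ : τ ∈ regTorus 1) :
    ((badSets (2 * g + 2) τ).ncard : ℚ) = ((Fintype.card F - 1 : ℕ) : ℚ) *
      if orderOf (ratio 1 τ) ∣ 2 * g ∧ Odd ((Fintype.card F - 1) / orderOf (ratio 1 τ)) then
        A2 (Fintype.card F) (2 * g / orderOf (ratio 1 τ)) else 0 := by
  have hτ := (Finset.mem_filter.1 hτ).1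
  have hθ2 : (1 : AlgebraicClosure F) ^ 2 = em F 1 := by rw [one_pow, map_one]
  have hθq : (1 : AlgebraicClosure F) ^ Fintype.card F = (1 : ℤ) * 1 := by simp
  obtain ⟨hfin, hcard⟩ :=
    finite_diagSets hq (Or.inl rfl) one_ne_zero hθ2 hθq hτ (2 * g + 2)
  have hnz := diag_ne_zero hθ2 hτ
  have hadd := em_add_pow hθq (τ.val 0 0) (τ.val 1 0)
  have hsub := em_sub_pow hθq (τ.val 0 0) (τ.val 1 0)
  rw [Int.cast_one, one_mul] at hadd hsub
  have hq1 : 1 < Fintype.card F := Fintype.one_lt_card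
  have hpow : ∀ x : (AlgebraicClosure F)ˣ, x.val ^ Fintype.card F = x.val →
      x ^ (Fintype.card F - 1) = 1 := by
    intro x hx
    refine mul_right_cancel (b := x) ?_
    rw [← pow_succ, Nat.sub_add_cancel hq1.le, one_mul]
    exact Units.ext hx
  have hord : orderOf (Units.mk0 _ hnz.1 / Units.mk0 _ hnz.2) = orderOf (ratio 1 τ) := by
    rw [← orderOf_units, Units.val_div_eq_div_val]
    rfl
  have hα := hpow (Units.mk0 _ hnz.1) hadd
  have hβ := hpow (Units.mk0 _ hnz.2) hsub
  have hpos : 0 < orderOf (Units.mk0 _ hnz.1 / Units.mk0 _ hnz.2) :=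
    orderOf_pos_iff.2 (isOfFinOrder_iff_pow_eq_one.2 ⟨Fintype.card F - 1, by omega, by
      rw [div_pow, hα, hβ, div_one]⟩)
  have h := ncard_diagSets_split hq hpos hα hβ hg hfin
  rw [Units.val_mk0, Units.val_mk0, hcard, hord] at h
  rw [h, mul_ite, mul_zero, Nat.cast_sub hq1.le, Nat.cast_one]

theorem ncard_badSets_nonsplit (hq : Odd (Fintype.card F)) {g : ℕ} (hg : 0 < g) {δ : F}
    {θ : AlgebraicClosure F} (hθ : θ ≠ 0) (hθ2 : θ ^ 2 = em F δ)
    (hθq : θ ^ Fintype.card F = (-1 : ℤ) * θ) {τ : GL (Fin 2) F} (hτ : τ ∈ regTorus δ) :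
    ((badSets (2 * g + 2) τ).ncard : ℚ) = ((Fintype.card F + 1 : ℕ) : ℚ) *
      ((if orderOf (ratio θ τ) ∣ 2 * g + 2 ∧ Odd ((2 * g + 2) / orderOf (ratio θ τ)) then
        A0 (Fintype.card F) ((2 * g + 2) / orderOf (ratio θ τ)) else 0) +
      (if orderOf (ratio θ τ) ∣ 2 * g ∧
          ¬ 2 * g / orderOf (ratio θ τ) % 2 = (Fintype.card F + 1) / orderOf (ratio θ τ) % 2 then
        A0 (Fintype.card F) (2 * g / orderOf (ratio θ τ)) else 0)) := by
  have hτ := (Finset.mem_filter.1 hτ).1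
  obtain ⟨hfin, hcard⟩ := finite_diagSets hq (Or.inr rfl) hθ hθ2 hθq hτ (2 * g + 2)
  have hnz := diag_ne_zero hθ2 hτ
  have hsub := em_sub_pow hθq (τ.val 0 0) (τ.val 1 0)
  have hq1 : 1 < Fintype.card F := Fintype.one_lt_card
  have hval : (Units.mk0 _ hnz.1 / Units.mk0 _ hnz.2).val = ratio θ τ := by
    rw [Units.val_div_eq_div_val]
    rfl
  have hord : orderOf (Units.mk0 _ hnz.1 / Units.mk0 _ hnz.2) = orderOf (ratio θ τ) := by
    rw [← orderOf_units, hval]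
  have hζ : (Units.mk0 _ hnz.1 / Units.mk0 _ hnz.2) ^ (Fintype.card F + 1) = 1 := by
    apply Units.ext
    rw [Units.val_pow_eq_pow_val, hval, Units.val_one]
    exact ratio_pow (Or.inr rfl) hθ2 hθq (by push_cast; ring) hτ
  have hβ : Units.mk0 _ hnz.2 ^ (Fintype.card F - 1) = Units.mk0 _ hnz.1 / Units.mk0 _ hnz.2 := by
    rw [eq_div_iff_mul_eq', ← pow_succ, Nat.sub_add_cancel hq1.le]
    apply Units.ext
    rw [Units.val_pow_eq_pow_val, Units.val_mk0, Units.val_mk0, hsub]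
    push_cast
    ring
  have h := ncard_diagSets_nonsplit hq hζ hβ hg hfin
  rw [Units.val_mk0, Units.val_mk0, hcard, hord] at h
  rw [h, mul_add, mul_ite, mul_ite, mul_zero, Nat.cast_add, Nat.cast_one]

theorem exists_sqrt_nonsquare {δ : F} (hδ : ¬ IsSquare δ) :
    ∃ θ : AlgebraicClosure F, θ ≠ 0 ∧ θ ^ 2 = em F δ ∧
      θ ^ Fintype.card F = (-1 : ℤ) * θ := by
  obtain ⟨θ, hθ⟩ := IsAlgClosed.exists_pow_nat_eq (em F δ) two_pos
  refine ⟨θ, ?_, hθ, ?_⟩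
  · rintro rfl
    rw [zero_pow two_ne_zero, eq_comm, map_eq_zero] at hθ
    exact hδ (hθ ▸ IsSquare.zero)
  · have h : (θ ^ Fintype.card F) ^ 2 = θ ^ 2 := by
      rw [← pow_mul, mul_comm, pow_mul, hθ, em_pow_card]
    rcases sq_eq_sq_iff_eq_or_eq_neg.1 h with h | h
    · obtain ⟨y, rfl⟩ := exists_em_eq h
      refine absurd ⟨y, em_injective ?_⟩ hδ
      rw [← hθ, map_mul, sq]
    · rw [h]
      simp

end EigenvalueForm

theorem stmt18 {F : Type} [Field F] [Fintype F] (q : ℕ) (hqcard : q = Fintype.card F)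
    (hq : Odd q) (g : ℕ) (hg : 2 ≤ g) :
    (Set.ncard {A : Set (Finset (Option (AlgebraicClosure F))) |
        ∃ S : Finset (Option (AlgebraicClosure F)),
          S.card = 2 * g + 2 ∧ S.image (frobP1 F) = S ∧
          (∃ γ : GL (Fin 2) F, S.image (moebius γ.val) = S ∧ ¬ IsSquareJ γ.val S) ∧
          A = orbitSet S} : ℚ)
    = ∑ m ∈ (2 * g + 2).divisors.filter (fun m => 1 < m),
        (Nat.totient m : ℚ) *
          (if m ∣ q + 1 ∧ Odd ((2 * g + 2) / m) then A0 q ((2 * g + 2) / m) else 0)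
      + ∑ m ∈ (2 * g).divisors.filter (fun m => 1 < m),
          (Nat.totient m : ℚ) *
            ((if m ∣ q + 1 ∧ ¬ (2 * g / m) % 2 = ((q + 1) / m) % 2
                then A0 q (2 * g / m) else 0)
              + (if m ∣ q - 1 ∧ Odd ((q - 1) / m) then A2 q (2 * g / m) else 0)) := by
  subst hqcard
  have hq1 : 1 < Fintype.card F := Fintype.one_lt_card
  obtain ⟨δ, hδ, hδ'⟩ := exists_nonsquare_split hq
  obtain ⟨θ, hθ, hθ2, hθq⟩ := exists_sqrt_nonsquare hδ
  have heven : Even (2 * g + 2) := ⟨g + 1, by ring⟩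
  have hsplit := two_mul_sum_discClass (n := 2 * g + 2) (N := Fintype.card F - 1) (e := 1)
    (θ := 1) (δ := 1) (Ψ := fun m => if m ∣ 2 * g ∧ Odd ((Fintype.card F - 1) / m) then
      A2 (Fintype.card F) (2 * g / m) else 0) hq (Or.inl rfl) one_ne_zero (by simp) (by simp)
    (by omega) fun τ hτ => ncard_badSets_split hq (by omega) hτ
  have hnon := two_mul_sum_discClass (n := 2 * g + 2) (N := Fintype.card F + 1) (e := -1)
    (Ψ := fun m => (if m ∣ 2 * g + 2 ∧ Odd ((2 * g + 2) / m) then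
        A0 (Fintype.card F) ((2 * g + 2) / m) else 0) +
      (if m ∣ 2 * g ∧ ¬ 2 * g / m % 2 = (Fintype.card F + 1) / m % 2 then
        A0 (Fintype.card F) (2 * g / m) else 0)) hq (Or.inr rfl) hθ hθ2 hθq (by push_cast; ring)
    fun τ hτ => ncard_badSets_nonsplit hq (by omega) hθ hθ2 hθq hτ
  have htot := sum_split hq hδ hδ' (f := fun γ => (badSets (2 * g + 2) γ).ncard) fun γ hγ => by
    rw [badSets_eq_empty hq heven hγ, Set.ncard_empty]
  have horb := congrArg (Nat.cast : ℕ → ℚ) (orbits_mul_card (F := F) hq heven)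
  rw [htot] at horb
  push_cast at horb hsplit hnon
  rw [mul_add, hsplit, hnon, ← mul_add, mul_comm] at horb
  have hG : (Fintype.card (GL (Fin 2) F) : ℚ) ≠ 0 := Nat.cast_ne_zero.2 Fintype.card_ne_zero
  rw [mul_left_cancel₀ hG horb]
  have hswap : ∀ (a b : ℕ) (P : ℕ → Prop) (f : ℕ → ℚ) [DecidablePred fun m => m ∣ a ∧ P m]
      [DecidablePred fun m => m ∣ b ∧ P m], a ≠ 0 → b ≠ 0 →
      ∑ m ∈ a.divisors with 1 < m, (m.totient : ℚ) * (if m ∣ b ∧ P m then f m else 0) =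
      ∑ m ∈ b.divisors with 1 < m, (m.totient : ℚ) * (if m ∣ a ∧ P m then f m else 0) := by
    intro a b P f _ _ ha hb
    simp only [mul_ite, mul_zero, ← Finset.sum_filter, Finset.filter_filter]
    refine Finset.sum_congr ?_ fun _ _ => rfl
    ext m
    simp only [Finset.mem_filter, Nat.mem_divisors]
    tauto
  simp only [mul_add, Finset.sum_add_distrib]
  rw [hswap (2 * g) (Fintype.card F - 1) (fun m => Odd ((Fintype.card F - 1) / m))
      (fun m => A2 (Fintype.card F) (2 * g / m)) (by omega) (by omega),
    hswap (2 * g) (Fintype.card F + 1)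
      (fun m => ¬ 2 * g / m % 2 = (Fintype.card F + 1) / m % 2)
      (fun m => A0 (Fintype.card F) (2 * g / m)) (by omega) (by omega),
    hswap (2 * g + 2) (Fintype.card F + 1) (fun m => Odd ((2 * g + 2) / m))
      (fun m => A0 (Fintype.card F) ((2 * g + 2) / m)) (by omega) (by omega)]
  ring

end Hyp
end
end

section
/- Suppose g ≥ 2 is odd and q ≡ 1 (mod 4). Then for every rational (2g+2)-set S of P¹ and every γ ∈ GL₂(𝔽_q) with γ(S) = S, the multiplier J(γ,S) is a square in 𝔽_q*. (Consequently there are no self-dual hyperelliptic curves of genus g over 𝔽_q.) -/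
noncomputable section

open Polynomial

namespace Hyp

attribute [local instance] Classical.propDecidable Classical.decEq

variable (F : Type) [Field F] [Fintype F]

variable {F}

/-- A matrix `A` acting projectively on a set `X` of pairwise independent vectors `w x`,
moving the line of `w (τ x)` to the line of `w x` with multiplier `j x`. -/
structure ProjAction {K X : Type*} [Field K] (A : Matrix (Fin 2) (Fin 2) K) (w : X → Fin 2 → K)
    (τ : X → X) (j : X → K) : Prop where
  vec_ne_zero : ∀ x, w x ≠ 0
  indep : ∀ x y, x ≠ y → w x 0 * w y 1 - w x 1 * w y 0 ≠ 0
  mult_ne_zero : ∀ x, j x ≠ 0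
  mulVec_eq : ∀ x, A.mulVec (w (τ x)) = j x • w x

/-- A `2×2` matrix with two independent eigenvectors for the same eigenvalue is scalar. -/
theorem eq_smul_one_of_indep {K : Type*} [Field K] {B : Matrix (Fin 2) (Fin 2) K}
    {p q : Fin 2 → K} {c : K} (hpq : p 0 * q 1 - p 1 * q 0 ≠ 0)
    (hp : B.mulVec p = c • p) (hq : B.mulVec q = c • q) :
    B = c • (1 : Matrix (Fin 2) (Fin 2) K) := by
  have p0 := congrFun hp 0
  have p1 := congrFun hp 1
  have q0 := congrFun hq 0
  have q1 := congrFun hq 1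
  simp only [Matrix.mulVec, dotProduct, Fin.sum_univ_two, Pi.smul_apply, smul_eq_mul]
    at p0 p1 q0 q1
  ext a b
  apply mul_right_cancel₀ hpq
  fin_cases a <;> fin_cases b <;>
    simp only [Fin.zero_eta, Fin.mk_one, Matrix.smul_apply, Matrix.one_apply, smul_eq_mul,
      Fin.isValue,
      if_true, zero_ne_one, one_ne_zero, if_false, mul_one, mul_zero, zero_mul]
  · linear_combination q 1 * p0 - p 1 * q0
  · linear_combination p 0 * q0 - q 0 * p0
  · linear_combination q 1 * p1 - p 1 * q1
  · linear_combination p 0 * q1 - q 0 * p1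

/-- The determinant of a `2×2` matrix is the product of the eigenvalues of two independent
eigenvectors. -/
theorem det_eq_mul_of_indep {K : Type*} [Field K] {B : Matrix (Fin 2) (Fin 2) K}
    {p q : Fin 2 → K} {a b : K} (hpq : p 0 * q 1 - p 1 * q 0 ≠ 0)
    (hp : B.mulVec p = a • p) (hq : B.mulVec q = b • q) : B.det = a * b := by
  have p0 := congrFun hp 0
  have p1 := congrFun hp 1
  have q0 := congrFun hq 0
  have q1 := congrFun hq 1
  simp only [Matrix.mulVec, dotProduct, Fin.sum_univ_two, Pi.smul_apply, smul_eq_mul]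
    at p0 p1 q0 q1
  apply mul_right_cancel₀ hpq
  rw [Matrix.det_fin_two]
  calc _ = (B 0 0 * p 0 + B 0 1 * p 1) * (B 1 0 * q 0 + B 1 1 * q 1)
        - (B 1 0 * p 0 + B 1 1 * p 1) * (B 0 0 * q 0 + B 0 1 * q 1) := by ring
    _ = _ := by rw [p0, p1, q0, q1]; ring

namespace ProjAction

variable {K X : Type*} [Field K] {A : Matrix (Fin 2) (Fin 2) K} {w : X → Fin 2 → K}
  {τ : X → X} {j : X → K}

theorem eq_of_smul_eq (h : ProjAction A w τ j) {x y : X} {a b : K} (ha : a ≠ 0)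
    (hxy : a • w x = b • w y) : x = y := by
  by_contra hne
  have e0 := congrFun hxy 0
  have e1 := congrFun hxy 1
  simp only [Pi.smul_apply, smul_eq_mul] at e0 e1
  apply mul_ne_zero ha (h.indep x y hne)
  linear_combination w y 1 * e0 - w y 0 * e1

theorem smul_vec_inj (h : ProjAction A w τ j) {x : X} {a b : K}
    (hab : a • w x = b • w x) : a = b :=
  smul_left_injective K (h.vec_ne_zero x) hab

theorem injective (h : ProjAction A w τ j) : Function.Injective τ := by
  intro x y hxy
  apply h.eq_of_smul_eq (h.mult_ne_zero x) (b := j y)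
  rw [← h.mulVec_eq, ← h.mulVec_eq, hxy]

theorem pow_mulVec (h : ProjAction A w τ j) (n : ℕ) (x : X) :
    (A ^ n).mulVec (w (τ^[n] x)) = (∏ i ∈ Finset.range n, j (τ^[i] x)) • w x := by
  induction n with
  | zero => simp
  | succ n ih =>
    rw [pow_succ, ← Matrix.mulVec_mulVec, Function.iterate_succ_apply', h.mulVec_eq,
      Matrix.mulVec_smul, ih, smul_smul, Finset.prod_range_succ, mul_comm]

theorem orbit_of_pow_eq (h : ProjAction A w τ j) {m : ℕ} {lam : K} (hlam : lam ≠ 0)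
    (hm : A ^ m = lam • (1 : Matrix (Fin 2) (Fin 2) K)) (x : X) :
    τ^[m] x = x ∧ ∏ i ∈ Finset.range m, j (τ^[i] x) = lam := by
  have e := h.pow_mulVec m x
  rw [hm, Matrix.smul_mulVec, Matrix.one_mulVec] at e
  have hx := h.eq_of_smul_eq hlam e
  rw [hx] at e
  exact ⟨hx, (h.smul_vec_inj e).symm⟩

theorem pow_scalar_of_iterate_fixed (h : ProjAction A w τ j) {l : ℕ} {x : X}
    (hl : τ^[l] x = x) (hx : τ x ≠ x) :
    ∃ c : K, A ^ l = c • (1 : Matrix (Fin 2) (Fin 2) K) := by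
  have e := h.pow_mulVec l x
  have e' := h.pow_mulVec l (τ x)
  have hl' : τ^[l] (τ x) = τ x := by
    rw [← Function.iterate_succ_apply, Function.iterate_succ_apply', hl]
  rw [hl] at e
  rw [hl'] at e'
  set c := ∏ i ∈ Finset.range l, j (τ^[i] x)
  set d := ∏ i ∈ Finset.range l, j (τ^[i] (τ x))
  have comm : (A ^ l).mulVec (A.mulVec (w (τ x))) = A.mulVec ((A ^ l).mulVec (w (τ x))) := by
    rw [Matrix.mulVec_mulVec, Matrix.mulVec_mulVec, (Commute.pow_self A l).eq]
  rw [e', Matrix.mulVec_smul, h.mulVec_eq, Matrix.mulVec_smul, e, smul_smul, smul_smul] at comm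
  have hcd : c = d := by
    have := h.smul_vec_inj comm
    rw [mul_comm] at this
    exact mul_right_cancel₀ (h.mult_ne_zero x) this
  exact ⟨c, eq_smul_one_of_indep (h.indep (τ x) x hx) (hcd ▸ e') e⟩

/-- Points that are not fixed fall into orbits of full length `m`, each contributing `lam`. -/
theorem prod_of_no_fixed [DecidableEq X] (h : ProjAction A w τ j) {m : ℕ} (hm0 : 0 < m) {lam : K}
    (hlam : lam ≠ 0) (hm : A ^ m = lam • (1 : Matrix (Fin 2) (Fin 2) K))
    (hmin : ∀ l, 0 < l → l < m → ∀ c : K, A ^ l ≠ c • (1 : Matrix (Fin 2) (Fin 2) K))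
    (T : Finset X) (hT : T.image τ = T) (hfix : ∀ x ∈ T, τ x ≠ x) :
    ∃ r : ℕ, T.card = r * m ∧ ∏ x ∈ T, j x = lam ^ r := by
  induction T using Finset.strongInduction with
  | H T ih =>
    obtain rfl | ⟨x, hx⟩ := T.eq_empty_or_nonempty
    · exact ⟨0, by simp, by simp⟩
    have hmaps : ∀ y ∈ T, τ y ∈ T := fun y hy => hT ▸ Finset.mem_image_of_mem τ hy
    have hit : ∀ i, τ^[i] x ∈ T := by
      intro i
      induction i with
      | zero => exact hx
      | succ i hi => rw [Function.iterate_succ_apply']; exact hmaps _ hi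
    have hinj : Set.InjOn (fun i => τ^[i] x) (Finset.range m : Set ℕ) := by
      have key : ∀ a b, a < b → b < m → τ^[a] x ≠ τ^[b] x := by
        intro a b hab hb e
        obtain ⟨c, hc⟩ := h.pow_scalar_of_iterate_fixed (l := b - a) (x := τ^[a] x)
          (by rw [← Function.iterate_add_apply, Nat.sub_add_cancel hab.le, e])
          (hfix _ (hit a))
        exact hmin (b - a) (by omega) (by omega) c hc
      intro a ha b hb e
      simp only [Finset.coe_range, Set.mem_Iio] at ha hb
      rcases lt_trichotomy a b with hab | hab | hab
      · exact absurd e (key a b hab hb)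
      · exact hab
      · exact absurd e.symm (key b a hab ha)
    obtain ⟨hper, hprod⟩ := h.orbit_of_pow_eq hlam hm x
    set O := (Finset.range m).image (fun i => τ^[i] x) with hO
    have hOT : O ⊆ T := by
      intro y hy
      obtain ⟨i, -, rfl⟩ := Finset.mem_image.1 hy
      exact hit i
    have hOcard : O.card = m := by
      rw [hO, Finset.card_image_of_injOn hinj, Finset.card_range]
    have hOτ : O.image τ = O := by
      apply Finset.eq_of_subset_of_card_le
      · intro y hy
        obtain ⟨z, hz, rfl⟩ := Finset.mem_image.1 hy
        obtain ⟨i, hi, rfl⟩ := Finset.mem_image.1 hz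
        rw [← Function.iterate_succ_apply' τ]
        rcases Nat.lt_or_ge (i + 1) m with hlt | hge
        · exact Finset.mem_image.2 ⟨i + 1, Finset.mem_range.2 hlt, rfl⟩
        · have : i + 1 = m := le_antisymm (Finset.mem_range.1 hi) hge
          refine Finset.mem_image.2 ⟨0, Finset.mem_range.2 hm0, ?_⟩
          simp only [Nat.succ_eq_add_one, this, hper, Function.iterate_zero, id]
      · rw [Finset.card_image_of_injective _ h.injective]
    have hxO : x ∈ O := Finset.mem_image.2 ⟨0, Finset.mem_range.2 hm0, rfl⟩
    obtain ⟨r, hr, hr'⟩ := ih (T \ O) (Finset.sdiff_ssubset hOT ⟨x, hxO⟩)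
      (by rw [Finset.image_sdiff _ _ h.injective, hT, hOτ])
      (fun y hy => hfix y (Finset.mem_sdiff.1 hy).1)
    refine ⟨r + 1, ?_, ?_⟩
    · rw [← Finset.card_sdiff_add_card_eq_card hOT, hr, hOcard]; ring
    · rw [← Finset.prod_sdiff hOT, hr', hO, Finset.prod_image hinj, hprod, pow_succ]

theorem prod_pow_eq [DecidableEq X] (h : ProjAction A w τ j) {m : ℕ} {lam : K} (hlam : lam ≠ 0)
    (hm : A ^ m = lam • (1 : Matrix (Fin 2) (Fin 2) K)) (S : Finset X) (hS : S.image τ = S) :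
    (∏ x ∈ S, j x) ^ m = lam ^ S.card := by
  have shift : ∀ i, ∏ x ∈ S, j (τ^[i] x) = ∏ x ∈ S, j x := by
    intro i
    induction i with
    | zero => rfl
    | succ i ih =>
      rw [← ih]
      conv_rhs => rw [← hS]
      rw [Finset.prod_image h.injective.injOn]
      rfl
  calc (∏ x ∈ S, j x) ^ m = ∏ i ∈ Finset.range m, ∏ x ∈ S, j (τ^[i] x) := by
        simp [shift]
    _ = ∏ x ∈ S, ∏ i ∈ Finset.range m, j (τ^[i] x) := Finset.prod_comm
    _ = lam ^ S.card := by
        rw [Finset.prod_congr rfl fun x _ => (h.orbit_of_pow_eq hlam hm x).2,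
          Finset.prod_const]

/-- A nonscalar matrix has at most two fixed points. -/
theorem card_fixed_le_two (h : ProjAction A w τ j) (hA : ∀ c : K, A ≠ c • 1)
    (T : Finset X) (hT : ∀ x ∈ T, τ x = x) : T.card ≤ 2 := by
  by_contra! hcard
  obtain ⟨a, b, c, ha, hb, hc, hab, hac, hbc⟩ := Finset.two_lt_card_iff.1 hcard
  have eig : ∀ x ∈ T, A.mulVec (w x) = j x • w x := by
    intro x hx
    have := h.mulVec_eq x
    rwa [hT x hx] at this
  have e₁ := det_eq_mul_of_indep (h.indep a c hac) (eig a ha) (eig c hc)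
  have e₂ := det_eq_mul_of_indep (h.indep b c hbc) (eig b hb) (eig c hc)
  have e : j b = j a := mul_right_cancel₀ (h.mult_ne_zero c) (e₂.symm.trans e₁)
  exact hA _ (eq_smul_one_of_indep (h.indep a b hab) (eig a ha) (e ▸ eig b hb))

/-- When the number of points and the order are both even, either no point of `S` is fixed or
exactly two are, and the latter contribute the determinant. -/
theorem prod_of_even [DecidableEq X] (h : ProjAction A w τ j) {m : ℕ} (hm0 : 0 < m) (hme : Even m) {lam : K}
    (hlam : lam ≠ 0) (hm : A ^ m = lam • (1 : Matrix (Fin 2) (Fin 2) K))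
    (hmin : ∀ l, 0 < l → l < m → ∀ c : K, A ^ l ≠ c • (1 : Matrix (Fin 2) (Fin 2) K))
    (S : Finset X) (hS : S.image τ = S) (hcard : Even S.card) :
    ∃ r e : ℕ, S.card = r * m + 2 * e ∧ ∏ x ∈ S, j x = lam ^ r * A.det ^ e := by
  have hmaps : ∀ y ∈ S, τ y ∈ S := fun y hy => hS ▸ Finset.mem_image_of_mem τ hy
  obtain ⟨r, hr, hr'⟩ := h.prod_of_no_fixed hm0 hlam hm hmin (S.filter fun x => ¬ τ x = x)
    (by
      apply Finset.eq_of_subset_of_card_le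
      · intro y hy
        obtain ⟨z, hz, rfl⟩ := Finset.mem_image.1 hy
        rw [Finset.mem_filter] at hz ⊢
        exact ⟨hmaps z hz.1, fun e => hz.2 (h.injective e)⟩
      · rw [Finset.card_image_of_injective _ h.injective])
    (fun x hx => (Finset.mem_filter.1 hx).2)
  have hA : ∀ c : K, A ≠ c • 1 := by
    intro c hc
    have h1m : 1 < m := by obtain ⟨k, rfl⟩ := hme; omega
    exact hmin 1 one_pos h1m c (by rwa [pow_one])
  have hfix : ∀ x ∈ S.filter (fun x => τ x = x), τ x = x :=
    fun x hx => (Finset.mem_filter.1 hx).2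
  have hle := h.card_fixed_le_two hA _ hfix
  have hsum := Finset.card_filter_add_card_filter_not (s := S) (fun x => τ x = x)
  have hprod := Finset.prod_filter_mul_prod_filter_not S (fun x => τ x = x) j
  rw [hr] at hsum
  rw [hr'] at hprod
  have hev : Even (S.filter (fun x => τ x = x)).card := by
    rw [← hsum, Nat.even_add] at hcard
    exact hcard.2 (hme.mul_left r)
  have hcases : (S.filter (fun x => τ x = x)).card = 0 ∨
      (S.filter (fun x => τ x = x)).card = 2 := by
    obtain ⟨k, hk⟩ := hev
    omega
  rcases hcases with h0 | h2
  · refine ⟨r, 0, by omega, ?_⟩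
    rw [Finset.card_eq_zero] at h0
    rw [← hprod, h0]
    simp
  · refine ⟨r, 1, by omega, ?_⟩
    obtain ⟨a, b, hab, hT⟩ := Finset.card_eq_two.1 h2
    rw [hT] at hfix hprod
    have ea := h.mulVec_eq a
    have eb := h.mulVec_eq b
    rw [hfix a (by simp)] at ea
    rw [hfix b (by simp)] at eb
    rw [← hprod, Finset.prod_pair hab, det_eq_mul_of_indep (h.indep a b hab) ea eb]
    ring

end ProjAction

/-- A representative vector for each point of `P¹(k̄)`. -/
def repVec : Option (AlgebraicClosure F) → Fin 2 → AlgebraicClosure F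
  | none => ![-1, 0]
  | some x => ![x, 1]

/-- The local multipliers are the multipliers of the adjugate matrix. -/
theorem projAction_moebius (γ : Matrix (Fin 2) (Fin 2) F) (hγ : γ.det ≠ 0) :
    ProjAction ((em F).mapMatrix γ.adjugate) repVec (moebius γ) (locMult γ) := by
  have hdet : em F γ.det ≠ 0 := (_root_.map_ne_zero _).2 hγ
  have hdet' : em F γ.det = em F (γ 0 0) * em F (γ 1 1) - em F (γ 0 1) * em F (γ 1 0) := by
    rw [Matrix.det_fin_two]; simp
  refine ⟨?_, ?_, ?_, ?_⟩
  · rintro (_ | x) h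
    · simpa [repVec] using congrFun h 0
    · simpa [repVec] using congrFun h 1
  · rintro (_ | x) (_ | y) hxy
    · exact absurd rfl hxy
    · simp [repVec]
    · simp [repVec]
    · simp only [repVec, Matrix.cons_val_zero, Matrix.cons_val_one, mul_one, one_mul]
      exact sub_ne_zero.2 fun e => hxy (congrArg some e)
  · rintro (_ | x)
    · by_cases hc : γ 1 0 = 0
      · simp only [locMult, hc, if_true]
        rw [hc] at hdet'
        intro h
        exact hdet (by rw [hdet', h]; simp)
      · simp [locMult, hc, hγ]
    · by_cases hc : em F (γ 1 0) * x + em F (γ 1 1) = 0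
      · simp only [locMult, hc, if_true]
        intro h0
        rw [h0] at hdet' hc
        have h1 : em F (γ 1 1) = 0 := by simpa using hc
        exact hdet (by rw [hdet', h1]; simp)
      · simp only [locMult, hc, if_false]
        exact div_ne_zero hdet hc
  · rintro (_ | x)
    · by_cases hc : γ 1 0 = 0
      · ext i
        fin_cases i <;>
          simp [moebius, locMult, repVec, hc, Matrix.adjugate_fin_two, Matrix.mulVec, dotProduct,
            Fin.sum_univ_two]
      · have hc' : em F (γ 1 0) ≠ 0 := (_root_.map_ne_zero _).2 hc
        ext i
        fin_cases i <;>
          simp [moebius, locMult, repVec, hc, Matrix.adjugate_fin_two, Matrix.mulVec, dotProduct,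
            Fin.sum_univ_two, hdet'] <;>
          field_simp <;> ring
    · by_cases hc : em F (γ 1 0) * x + em F (γ 1 1) = 0
      · ext i
        fin_cases i <;>
          simp [moebius, locMult, repVec, hc, Matrix.adjugate_fin_two, Matrix.mulVec, dotProduct,
            Fin.sum_univ_two]
        linear_combination -hc
      · ext i
        fin_cases i <;>
          simp only [moebius, locMult, repVec, hc, Matrix.adjugate_fin_two, Matrix.mulVec,
            dotProduct, Fin.sum_univ_two, hdet', if_false, RingHom.mapMatrix_apply,
            Matrix.map_apply, Matrix.of_apply, Matrix.cons_val', Matrix.cons_val_zero,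
            Matrix.cons_val_one, Matrix.cons_val_fin_one, Pi.smul_apply, smul_eq_mul, map_neg,
            Fin.zero_eta, Fin.mk_one, Fin.isValue, mul_one, ← mul_div_assoc, div_mul_eq_mul_div]
        · rw [eq_div_iff hc, add_mul, div_mul_cancel₀ _ hc]
          ring
        · rw [eq_div_iff hc, add_mul, div_mul_cancel₀ _ hc]
          ring

theorem locMult_frobP1 (γ : Matrix (Fin 2) (Fin 2) F) (t : Option (AlgebraicClosure F)) :
    locMult γ (frobP1 F t) = locMult γ t ^ Fintype.card F := by
  let φ := FiniteField.frobeniusAlgHom F (AlgebraicClosure F)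
  have hφ : ∀ x, x ^ Fintype.card F = φ x := fun x => rfl
  have hem : ∀ a : F, φ (em F a) = em F a := fun a => φ.commutes a
  rw [hφ]
  rcases t with _ | x
  · simp only [frobP1, Option.map_none, locMult]
    split_ifs <;> rw [hem]
  · simp only [frobP1, Option.map_some, locMult, hφ]
    have e : em F (γ 1 0) * φ x + em F (γ 1 1) = φ (em F (γ 1 0) * x + em F (γ 1 1)) := by
      rw [map_add, map_mul, hem, hem]
    rw [e]
    simp only [map_eq_zero]
    split_ifs
    · rw [hem]
    · rw [map_div₀, hem]

theorem exists_em_eq_of_pow_card_eq {x : AlgebraicClosure F} (hx : x ^ Fintype.card F = x) :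
    ∃ a : F, em F a = x := by
  by_contra! hne
  have hp := FiniteField.X_pow_card_sub_X_ne_zero (AlgebraicClosure F)
    (Fintype.one_lt_card (α := F))
  have hle := Polynomial.card_le_degree_of_subset_roots (p := X ^ Fintype.card F - X)
    (Z := insert x (Finset.univ.image (em F))) (by
      intro y hy
      rw [Finset.mem_val, Finset.mem_insert, Finset.mem_image] at hy
      rw [mem_roots hp]
      rcases hy with rfl | ⟨a, -, rfl⟩
      · simp [hx]
      · simp [← map_pow, FiniteField.pow_card])
  rw [FiniteField.X_pow_card_sub_X_natDegree_eq _ Fintype.one_lt_card,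
    Finset.card_insert_of_notMem (by simpa using hne),
    Finset.card_image_of_injective _ (em F).injective, Finset.card_univ] at hle
  omega

theorem exists_em_eq_Jmult (γ : Matrix (Fin 2) (Fin 2) F)
    (S : Finset (Option (AlgebraicClosure F))) (hS : S.image (frobP1 F) = S) :
    ∃ a : F, em F a = Jmult γ S := by
  apply exists_em_eq_of_pow_card_eq
  have hinj : Set.InjOn (frobP1 F) (S : Set (Option (AlgebraicClosure F))) :=
    Finset.card_image_iff.1 (congrArg Finset.card hS)
  unfold Jmult
  conv_rhs => rw [← hS]
  rw [Finset.prod_image hinj, ← Finset.prod_pow]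
  exact Finset.prod_congr rfl fun t _ => (locMult_frobP1 γ t).symm

/-- Every invertible matrix over a finite field has a least positive power that is scalar. -/
theorem exists_isPGLOrder (B : Matrix (Fin 2) (Fin 2) F) (hB : B.det ≠ 0) :
    ∃ m, IsPGLOrder B m := by
  have hne : {n : ℕ | 0 < n ∧
      ∃ lam : F, B ^ n = lam • (1 : Matrix (Fin 2) (Fin 2) F)}.Nonempty := by
    obtain ⟨u, rfl⟩ := (Matrix.isUnit_iff_isUnit_det B).2 hB.isUnit
    refine ⟨orderOf u, orderOf_pos u, 1, ?_⟩
    rw [← Units.val_pow_eq_pow_val, pow_orderOf_eq_one]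
    simp
  exact ⟨_, Nat.sInf_mem hne, fun n hn => Nat.sInf_le hn⟩

theorem stmt19 {F : Type} [Field F] [Fintype F]
    (hq : Fintype.card F % 4 = 1) (g : ℕ) (hg : 2 ≤ g) (hgodd : Odd g)
    (S : Finset (Option (AlgebraicClosure F))) (hS : IsRatSet (2 * g + 2) S)
    (γ : GL (Fin 2) F) (hstab : S.image (moebius γ.val) = S) :
    IsSquareJ γ.val S := by
  obtain ⟨hcard, hfrob⟩ := hS
  have hγ : γ.val.det ≠ 0 := ((Matrix.isUnit_iff_isUnit_det _).1 γ.isUnit).ne_zero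
  have h := projAction_moebius γ.val hγ
  have hBdet : γ.val.adjugate.det = γ.val.det := by
    rw [Matrix.det_adjugate]; simp
  obtain ⟨m, ⟨hm0, lam, hlam⟩, hmin⟩ := exists_isPGLOrder γ.val.adjugate (hBdet ▸ hγ)
  set B := γ.val.adjugate
  have hdet : lam ^ 2 = γ.val.det ^ m := by
    have := congrArg Matrix.det hlam
    rw [Matrix.det_pow, hBdet, Matrix.det_smul] at this
    simpa using this.symm
  have hlam0 : lam ≠ 0 := by
    rintro rfl
    exact pow_ne_zero m hγ (by rw [← hdet]; simp)
  have hlam0' : em F lam ≠ 0 := (_root_.map_ne_zero _).2 hlam0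
  have hpow : (em F).mapMatrix B ^ m = em F lam • 1 := by
    rw [← map_pow, hlam]
    ext a b
    simp [Matrix.one_apply, apply_ite (em F)]
  have hminK : ∀ l, 0 < l → l < m → ∀ c : AlgebraicClosure F,
      (em F).mapMatrix B ^ l ≠ c • 1 := by
    intro l hl hlm c hc
    rw [← map_pow] at hc
    refine absurd (hmin ⟨hl, (B ^ l) 0 0, ?_⟩) (not_le.2 hlm)
    have hent : ∀ a b, em F ((B ^ l) a b) = (c • (1 : Matrix (Fin 2) (Fin 2) _)) a b :=
      fun a b => congrFun (congrFun hc a) b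
    ext a b
    apply (em F).injective
    rw [hent]
    simp [hent, Matrix.one_apply, apply_ite (em F)]
  obtain ⟨s, hs⟩ := hgodd
  rcases Nat.even_or_odd m with hme | ⟨k, hk⟩
  · obtain ⟨r, e, hre, hprod⟩ := h.prod_of_even hm0 hme hlam0' hpow hminK S hstab
      (hcard ▸ ⟨g + 1, by ring⟩)
    have hAdet : ((em F).mapMatrix B).det = em F γ.val.det := by
      rw [← RingHom.map_det, hBdet]
    obtain ⟨k, hk⟩ := hme
    obtain ⟨i, hi⟩ := (FiniteField.isSquare_neg_one_iff (F := F)).2 (by omega)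
    have hi0 : i ≠ 0 := by rintro rfl; simp at hi
    have hexp : k * r + e = (s + 1) + (s + 1) := by
      rw [hcard, hk, hs] at hre
      linarith [hre, mul_comm k r, mul_add r k k]
    have hJ : Jmult γ.val S = em F (lam ^ r * γ.val.det ^ e) := by
      rw [map_mul, map_pow, map_pow, ← hAdet]
      exact hprod
    have hlam' : lam = γ.val.det ^ k ∨ lam = i * i * γ.val.det ^ k := by
      rw [← hi, neg_one_mul]
      exact sq_eq_sq_iff_eq_or_eq_neg.1 (by rw [hdet, hk]; ring)
    rcases hlam' with hl | hl
    · refine ⟨γ.val.det ^ (s + 1), pow_ne_zero _ hγ, ?_⟩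
      rw [hJ, hl, ← pow_mul, ← pow_add, hexp, pow_add]
    · refine ⟨i ^ r * γ.val.det ^ (s + 1), mul_ne_zero (pow_ne_zero _ hi0) (pow_ne_zero _ hγ), ?_⟩
      rw [hJ, hl, mul_pow, ← pow_mul, mul_assoc, ← pow_add, hexp, pow_add]
      ring_nf
  · obtain ⟨J, hJ⟩ := exists_em_eq_Jmult γ.val S hfrob
    have hJm := h.prod_pow_eq hlam0' hpow S hstab
    change Jmult γ.val S ^ m = _ at hJm
    rw [← hJ, ← map_pow, ← map_pow, hcard] at hJm
    replace hJm := (em F).injective hJm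
    have hJ0 : J ≠ 0 := by
      rintro rfl
      exact pow_ne_zero _ hlam0 (by rw [← hJm, zero_pow hm0.ne'])
    refine ⟨lam ^ (g + 1) / J ^ k, div_ne_zero (pow_ne_zero _ hlam0) (pow_ne_zero _ hJ0), ?_⟩
    rw [← hJ]
    congr 1
    field_simp
    rw [hk] at hJm
    linear_combination hJm

end Hyp
end
end
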